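/- Let p>1 and ω>0. There exists m* ∈ ℕ such that for every integer m ≥ m* the following holds: for every φ ∈ C²((0,∞), ℝ) with φ(r) > 0 for all r > 0 satisfying φ''(r) + φ'(r)/r − (ω + m²/r²)·φ(r) + φ(r)^p = 0 on (0,∞), the limits lim_{r→0} φ(r)/r^m and lim_{r→0} φ'(r)/(m r^{m−1}) existing, finite and equal, and lim_{r→∞} φ(r) = 0, there exist j ∈ ℤ, λ ∈ ℂ with Re λ > 0, and functions y₊, y₋ ∈ C²((0,∞), ℂ), not both identically zero, with ∫₀^∞ ( |y_±(r)|² + |y_±'(r)|² + r^{−2}|y_±(r)|² ) r dr < ∞, such that on (0,∞): y₊'' + y₊'/r − (ω + (m+j)²/r²)y₊ + iλ·y₊ + β₁·y₊ + β₂·y₋ = 0 and y₋'' + y₋'/r − (ω + (m−j)²/r²)y₋ − iλ·y₋ + β₁·y₋ + β₂·y₊ = 0, where β₁(r) = ((p+1)/2)·φ(r)^{p−1} and β₂(r) = ((p−1)/2)·φ(r)^{p−1}. (Linear instability of the vortex soliton e^{i(mθ+ωt)}φ(r).) -/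

import Mathlib

open MeasureTheory Real Filter

open scoped BoundedContinuousFunction in
/-- The weighted Volterra operator `ζ ↦ e^{-2|B|} ∫₀ˣ e^{2|B|} A ζ`, where `B' = b`. -/
theorem exists_weighted_volterra {E : Type*} [NormedAddCommGroup E] [NormedSpace ℂ E]
    [CompleteSpace E] {A : ℝ → E →L[ℂ] E} (hA : Continuous A) {b B : ℝ → ℝ}
    (hb : Continuous b) (hB : ∀ x, HasDerivAt B (b x) x) (hB0 : B 0 = 0) {c : ℝ} (hc : 0 ≤ c)
    (hb0 : ∀ x, 0 ≤ b x) (hAb : ∀ x, ‖A x‖ ≤ c * b x) :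
    ∃ K : (ℝ →ᵇ E) →L[ℂ] (ℝ →ᵇ E), ‖K‖ ≤ c / 2 ∧
      ∀ ζ x, K ζ x = (rexp (-(2 * |B x|)) : ℝ) • ∫ s in (0:ℝ)..x, rexp (2 * |B s|) • A s (ζ s) := by
  have hBc : Continuous B := continuous_iff_continuousAt.2 fun x => (hB x).continuousAt
  have hcont : ∀ ζ : ℝ →ᵇ E, Continuous fun s => rexp (2 * |B s|) • A s (ζ s) := fun ζ => by
    have := hA.clm_apply ζ.continuous
    fun_prop
  have hmono : Monotone B := monotone_of_deriv_nonneg (fun x => (hB x).differentiableAt)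
    (fun x => by rw [(hB x).deriv]; exact hb0 x)
  have hbound : ∀ (ζ : ℝ →ᵇ E) (x : ℝ),
      ‖(rexp (-(2 * |B x|)) : ℝ) • ∫ s in (0:ℝ)..x, rexp (2 * |B s|) • A s (ζ s)‖
        ≤ c / 2 * ‖ζ‖ := by
    intro ζ x
    have h1 : ∀ s, ‖rexp (2 * |B s|) • A s (ζ s)‖ ≤ c * ‖ζ‖ * (rexp (2 * |B s|) * b s) := by
      intro s
      rw [norm_smul, Real.norm_of_nonneg (exp_pos _).le]
      have := (A s).le_of_opNorm_le_of_le (hAb s) (ζ.norm_coe_le_norm s)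
      calc _ ≤ rexp (2 * |B s|) * (c * b s * ‖ζ‖) := by gcongr
        _ = _ := by ring
    have key : |∫ s in (0:ℝ)..x, rexp (2 * |B s|) * b s| ≤ rexp (2 * |B x|) / 2 := by
      rcases le_total 0 x with hx | hx
      · have e1 : ∫ s in (0:ℝ)..x, rexp (2 * |B s|) * b s
            = rexp (2 * B x) / 2 - rexp (2 * B 0) / 2 := by
          rw [← intervalIntegral.integral_eq_sub_of_hasDerivAt
            (f' := fun s => rexp (2 * B s) * b s) (f := fun s => rexp (2 * B s) / 2)]
          · refine intervalIntegral.integral_congr fun s hs => ?_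
            rw [Set.uIcc_of_le hx] at hs
            have : 0 ≤ B s := hB0 ▸ hmono hs.1
            simp [abs_of_nonneg this]
          · intro s _
            exact (((hB s).const_mul 2).exp.div_const 2).congr_deriv (by ring)
          · exact Continuous.intervalIntegrable (by fun_prop) _ _
        have h0 : 0 ≤ B x := hB0 ▸ hmono hx
        have : (1:ℝ) ≤ rexp (2 * B x) := one_le_exp (by linarith)
        rw [e1, hB0, abs_of_nonneg h0, abs_of_nonneg] <;> simp <;> linarith
      · have e1 : ∫ s in (0:ℝ)..x, rexp (2 * |B s|) * b s
            = -rexp (-(2 * B x)) / 2 - -rexp (-(2 * B 0)) / 2 := by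
          rw [← intervalIntegral.integral_eq_sub_of_hasDerivAt
            (f' := fun s => rexp (-(2 * B s)) * b s) (f := fun s => -rexp (-(2 * B s)) / 2)]
          · refine intervalIntegral.integral_congr fun s hs => ?_
            rw [Set.uIcc_of_ge hx] at hs
            have : B s ≤ 0 := hB0 ▸ hmono hs.2
            simp [abs_of_nonpos this]
          · intro s _
            exact (((hB s).const_mul 2).fun_neg.exp.fun_neg.div_const 2).congr_deriv (by ring)
          · exact Continuous.intervalIntegrable (by fun_prop) _ _
        have h0 : B x ≤ 0 := hB0 ▸ hmono hx
        have : (1:ℝ) ≤ rexp (-(2 * B x)) := one_le_exp (by linarith)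
        rw [e1, hB0, abs_of_nonpos h0, abs_of_nonpos] <;> simp <;> ring_nf at * <;> linarith
    have h2 : ‖∫ s in (0:ℝ)..x, rexp (2 * |B s|) • A s (ζ s)‖
        ≤ |∫ s in (0:ℝ)..x, c * ‖ζ‖ * (rexp (2 * |B s|) * b s)| :=
      intervalIntegral.norm_integral_le_abs_of_norm_le (Eventually.of_forall fun s => h1 s)
        (Continuous.intervalIntegrable (by fun_prop) _ _)
    rw [intervalIntegral.integral_const_mul, abs_mul, abs_of_nonneg (by positivity)] at h2
    rw [norm_smul, Real.norm_of_nonneg (exp_pos _).le]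
    calc _ ≤ rexp (-(2 * |B x|)) * (c * ‖ζ‖ * (rexp (2 * |B x|) / 2)) := by gcongr; exact h2.trans (by gcongr)
      _ = c / 2 * ‖ζ‖ * (rexp (-(2 * |B x|)) * rexp (2 * |B x|)) := by ring
      _ = _ := by rw [← Real.exp_add]; simp
  have hcont2 : ∀ ζ : ℝ →ᵇ E, Continuous fun x =>
      (rexp (-(2 * |B x|)) : ℝ) • ∫ s in (0:ℝ)..x, rexp (2 * |B s|) • A s (ζ s) := by
    intro ζ
    have : Continuous fun x => ∫ s in (0:ℝ)..x, rexp (2 * |B s|) • A s (ζ s) :=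
      intervalIntegral.continuous_primitive (fun a b => (hcont ζ).intervalIntegrable a b) 0
    fun_prop
  let L : (ℝ →ᵇ E) →ₗ[ℂ] (ℝ →ᵇ E) :=
    { toFun := fun ζ => BoundedContinuousFunction.ofNormedAddCommGroup _ (hcont2 ζ) _ (hbound ζ)
      map_add' := fun ζ ξ => by
        ext x
        simp only [BoundedContinuousFunction.coe_ofNormedAddCommGroup,
          BoundedContinuousFunction.coe_add, Pi.add_apply, map_add, smul_add]
        rw [intervalIntegral.integral_add ((hcont ζ).intervalIntegrable _ _)
          ((hcont ξ).intervalIntegrable _ _), smul_add]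
      map_smul' := fun a ζ => by
        ext x
        simp only [BoundedContinuousFunction.coe_ofNormedAddCommGroup,
          BoundedContinuousFunction.coe_smul, map_smul, RingHom.id_apply]
        rw [smul_comm, ← intervalIntegral.integral_smul a]
        congr 1
        refine intervalIntegral.integral_congr fun s _ => ?_
        exact smul_comm _ _ _ }
  refine ⟨L.mkContinuous (c / 2) fun ζ => ?_, L.mkContinuous_norm_le (by positivity) _,
    fun ζ x => rfl⟩
  exact BoundedContinuousFunction.norm_ofNormedAddCommGroup_le _ (by positivity) (hbound ζ)

theorem gronwall_backward_forward {E : Type*} [NormedAddCommGroup E] [NormedSpace ℝ E]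
    {Z Z' : ℝ → E} {K a b : ℝ} (hZ : ∀ x, HasDerivAt Z (Z' x) x)
    (hb : ∀ x ∈ Set.Icc a b, ‖Z' x‖ ≤ K * ‖Z x‖) {x y : ℝ} (hx : x ∈ Set.Icc a b)
    (hy : y ∈ Set.Icc a b) : ‖Z x‖ ≤ ‖Z y‖ * rexp (K * |x - y|) := by
  have hc : Continuous Z := continuous_iff_continuousAt.2 fun x => (hZ x).continuousAt
  rcases le_total y x with h | h
  · have := norm_le_gronwallBound_of_norm_deriv_right_le (f := Z) (f' := Z') (δ := ‖Z y‖) (K := K)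
      (ε := 0) (a := y) (b := x) hc.continuousOn
      (fun t _ => (hZ t).hasDerivWithinAt) le_rfl
      (fun t ht => by
        rw [add_zero]; exact hb t ⟨by linarith [ht.1, hy.1], by linarith [ht.2, hx.2]⟩) x ⟨h, le_rfl⟩
    rwa [gronwallBound_ε0, ← abs_of_nonneg (sub_nonneg.2 h)] at this
  · have hZ2 : ∀ t, HasDerivAt (fun t => Z (-t)) (-Z' (-t)) t := fun t => by
      simpa [Function.comp_def] using (hZ (-t)).scomp t (hasDerivAt_neg t)
    have := norm_le_gronwallBound_of_norm_deriv_right_le (f := fun t => Z (-t))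
      (f' := fun t => -Z' (-t)) (δ := ‖Z y‖) (K := K)
      (ε := 0) (a := -y) (b := -x) (by fun_prop)
      (fun t _ => (hZ2 t).hasDerivWithinAt) (by simp)
      (fun t ht => by
        rw [add_zero, norm_neg]
        exact hb _ ⟨by linarith [ht.2, hx.1], by linarith [ht.1, hy.2]⟩) (-x) ⟨by linarith, le_rfl⟩
    rw [gronwallBound_ε0] at this
    simp only [neg_neg] at this
    rwa [show -x - -y = |x - y| by rw [abs_of_nonpos (by linarith)]; ring] at this

/-- Solutions of linear equations depend continuously on the coefficients and initial data. -/
theorem linear_ode_tendsto {E : Type*} [NormedAddCommGroup E] [NormedSpace ℂ E]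
    {An : ℕ → ℝ → E →L[ℂ] E} {A : ℝ → E →L[ℂ] E} (hA : Continuous A)
    (hconv : ∀ S, ∀ δ > 0, ∀ᶠ n in atTop, ∀ x ∈ Set.Icc 0 S, ‖An n x - A x‖ ≤ δ)
    {Zn : ℕ → ℝ → E} {Z : ℝ → E} (hZn : ∀ᶠ n in atTop, ∀ x, HasDerivAt (Zn n) (An n x (Zn n x)) x)
    (hZ : ∀ x, HasDerivAt Z (A x (Z x)) x) (h0 : Tendsto (fun n => Zn n 0) atTop (nhds (Z 0)))
    {x : ℝ} (hx : 0 ≤ x) : Tendsto (fun n => Zn n x) atTop (nhds (Z x)) := by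
  have hZc : Continuous Z := continuous_iff_continuousAt.2 fun x => (hZ x).continuousAt
  obtain ⟨B, hB⟩ := (isCompact_Icc (a := 0) (b := x)).exists_bound_of_continuousOn
    hA.continuousOn
  obtain ⟨C, hC⟩ := (isCompact_Icc (a := 0) (b := x)).exists_bound_of_continuousOn
    hZc.continuousOn
  have hB0 : 0 ≤ B := (norm_nonneg _).trans (hB 0 ⟨le_rfl, hx⟩)
  have hC0 : 0 ≤ C := (norm_nonneg _).trans (hC 0 ⟨le_rfl, hx⟩)
  have hbound : ∀ δ, 0 < δ → δ ≤ 1 → ∀ᶠ n in atTop, ‖Zn n x - Z x‖ ≤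
      δ * rexp ((B + 1) * (x - 0)) + δ * C / (B + 1) * (rexp ((B + 1) * (x - 0)) - 1) := by
    intro δ hδ hδ1
    filter_upwards [hconv x δ hδ, hZn,
      Metric.tendsto_nhds.1 h0 δ hδ] with n h1 h2 h3
    rw [dist_eq_norm] at h3
    have hgb := congrFun (gronwallBound_of_K_ne_0 (δ := δ) (ε := δ * C)
      (show B + 1 ≠ 0 by positivity)) (x - 0)
    rw [← hgb]
    have hd : ∀ t, HasDerivAt (fun t => Zn n t - Z t) (An n t (Zn n t) - A t (Z t)) t := fun t =>
      (h2 t).sub (hZ t)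
    refine norm_le_gronwallBound_of_norm_deriv_right_le (f := fun t => Zn n t - Z t)
      (f' := fun t => An n t (Zn n t) - A t (Z t)) (a := 0) (b := x)
      (fun t _ => (hd t).continuousAt.continuousWithinAt)
      (fun t _ => (hd t).hasDerivWithinAt) h3.le (fun t ht => ?_) x ⟨hx, le_rfl⟩
    have ht' : t ∈ Set.Icc 0 x := ⟨ht.1, ht.2.le⟩
    have e : An n t (Zn n t) - A t (Z t) = An n t (Zn n t - Z t) + (An n t - A t) (Z t) := by
      simp
    rw [e]
    refine (norm_add_le _ _).trans (add_le_add ?_ ?_)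
    · refine ContinuousLinearMap.le_of_opNorm_le _ ?_ _
      calc ‖An n t‖ = ‖A t + (An n t - A t)‖ := by simp
        _ ≤ ‖A t‖ + ‖An n t - A t‖ := norm_add_le _ _
        _ ≤ B + 1 := add_le_add (hB t ht') ((h1 t ht').trans hδ1)
    · exact ContinuousLinearMap.le_of_opNorm_le_of_le _ (h1 t ht') (hC t ht')
  rw [tendsto_iff_norm_sub_tendsto_zero]
  set E1 := rexp ((B + 1) * (x - 0)) + C / (B + 1) * (rexp ((B + 1) * (x - 0)) - 1) with hE1
  have hE : 0 < E1 := by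
    have : 1 ≤ rexp ((B + 1) * (x - 0)) := one_le_exp (by simp; positivity)
    have : 0 ≤ C / (B + 1) * (rexp ((B + 1) * (x - 0)) - 1) :=
      mul_nonneg (by positivity) (by linarith)
    rw [hE1]; positivity
  rw [Metric.tendsto_nhds]
  intro δ hδ
  have hδ' : 0 < min 1 (δ / (2 * E1)) := by positivity
  filter_upwards [hbound _ hδ' (min_le_left _ _)] with n hn
  rw [dist_zero_right, norm_norm]
  calc _ ≤ _ := hn
    _ = min 1 (δ / (2 * E1)) * E1 := by rw [hE1]; ring
    _ ≤ δ / (2 * E1) * E1 := by gcongr; exact min_le_right _ _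
    _ = δ / 2 := by field_simp
    _ < δ := by linarith

theorem linear_ode_unique {E : Type*} [NormedAddCommGroup E] [NormedSpace ℂ E]
    {A : ℝ → E →L[ℂ] E} (hA : Continuous A) {Z Y : ℝ → E}
    (hZ : ∀ x, HasDerivAt Z (A x (Z x)) x) (hY : ∀ x, HasDerivAt Y (A x (Y x)) x)
    (h0 : Z 0 = Y 0) : Z = Y := by
  funext x
  obtain ⟨K, hK⟩ := (isCompact_Icc (a := -|x|) (b := |x|)).exists_bound_of_continuousOn
    hA.continuousOn
  have hD : ∀ t, HasDerivAt (Z - Y) (A t ((Z - Y) t)) t := fun t => by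
    simpa using (hZ t).sub (hY t)
  have := gronwall_backward_forward hD (fun t ht => (A t).le_of_opNorm_le (hK t ht) _)
    (abs_le.1 (le_refl |x|)) (y := 0) (by simp)
  simp only [Pi.sub_apply, h0, sub_self, norm_zero, zero_mul] at this
  exact sub_eq_zero.1 (norm_le_zero_iff.1 this)

open scoped BoundedContinuousFunction in
theorem exists_linear_flow_on_ball {E : Type*} [NormedAddCommGroup E] [NormedSpace ℂ E]
    [CompleteSpace E] {A M : ℝ → E →L[ℂ] E} (hA : Continuous A) (hM : Continuous M) (z : E)
    {N : ℝ} (hN : 0 < N) :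
    ∃ Z : ℂ → ℝ → E, (∀ ν ∈ Metric.ball (0:ℂ) N, Z ν 0 = z ∧
        ∀ x, HasDerivAt (Z ν) ((A x + ν • M x) (Z ν x)) x) ∧
      ∀ x, DifferentiableOn ℂ (fun ν => Z ν x) (Metric.ball 0 N) := by
  set b : ℝ → ℝ := fun x => ‖A x‖ + N * ‖M x‖
  have hb : Continuous b := by fun_prop
  set B : ℝ → ℝ := fun x => ∫ s in (0:ℝ)..x, b s
  have hB : ∀ x, HasDerivAt B (b x) x := fun x =>
    intervalIntegral.integral_hasDerivAt_right (hb.intervalIntegrable _ _)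
      (hb.stronglyMeasurableAtFilter _ _) hb.continuousAt
  have hBc : Continuous B := continuous_iff_continuousAt.2 fun x => (hB x).continuousAt
  have hB0 : B 0 = 0 := by simp [B]
  have hb0 : ∀ x, 0 ≤ b x := fun x => by positivity
  obtain ⟨KA, hKA, hKA'⟩ := exists_weighted_volterra hA hb hB hB0 zero_le_one hb0
    (fun x => by simp [b]; positivity)
  obtain ⟨KM, hKM, hKM'⟩ := exists_weighted_volterra hM hb hB hB0 (inv_nonneg.2 hN.le) hb0
    (fun x => by rw [← div_eq_inv_mul, le_div_iff₀ hN]; simp [b, mul_comm])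
  let ζ0 : ℝ →ᵇ E := BoundedContinuousFunction.ofNormedAddCommGroup
    (fun x => (rexp (-(2 * |B x|)) : ℝ) • z) (by fun_prop) ‖z‖ (fun x => by
      rw [norm_smul, Real.norm_of_nonneg (exp_pos _).le]
      exact mul_le_of_le_one_left (norm_nonneg _) (exp_le_one_iff.2 (by simp)))
  let Kν : ℂ → (ℝ →ᵇ E) →L[ℂ] (ℝ →ᵇ E) := fun ν => KA + ν • KM
  have hKν : ∀ ν ∈ Metric.ball (0:ℂ) N, ‖Kν ν‖ < 1 := by
    intro ν hν
    rw [mem_ball_zero_iff] at hν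
    calc ‖Kν ν‖ ≤ ‖KA‖ + ‖ν‖ * ‖KM‖ := (norm_add_le _ _).trans (by rw [norm_smul])
      _ ≤ 1 / 2 + ‖ν‖ * (N⁻¹ / 2) := by gcongr
      _ < 1 / 2 + N * (N⁻¹ / 2) := by gcongr
      _ = 1 := by field_simp; norm_num
  have hunit : ∀ ν ∈ Metric.ball (0:ℂ) N, IsUnit (1 - Kν ν) := fun ν hν =>
    isUnit_one_sub_of_norm_lt_one (hKν ν hν)
  let ζ : ℂ → ℝ →ᵇ E := fun ν => Ring.inverse (1 - Kν ν) ζ0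
  have hζ : ∀ ν ∈ Metric.ball (0:ℂ) N, ζ ν = ζ0 + Kν ν (ζ ν) := by
    intro ν hν
    have : ((1 - Kν ν) * Ring.inverse (1 - Kν ν)) ζ0 = ζ0 := by
      rw [Ring.mul_inverse_cancel _ (hunit ν hν)]; rfl
    have h2 : ζ ν - Kν ν (ζ ν) = ζ0 := this
    rw [← h2]; abel
  have hζd : DifferentiableOn ℂ ζ (Metric.ball 0 N) := by
    intro ν hν
    have h1 : DifferentiableAt ℂ (fun ν => 1 - Kν ν) ν := by fun_prop
    obtain ⟨U, hU⟩ := hunit ν hν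
    have h2 : DifferentiableAt ℂ Ring.inverse (1 - Kν ν) := by
      rw [← hU]; exact differentiableAt_inverse (𝕜 := ℂ) U.isUnit
    exact ((h2.comp ν h1).clm_apply (differentiableAt_const ζ0)).differentiableWithinAt
  refine ⟨fun ν x => (rexp (2 * |B x|) : ℝ) • ζ ν x, fun ν hν => ?_, fun x => ?_⟩
  · have hform : ∀ x, (rexp (2 * |B x|) : ℝ) • ζ ν x
        = z + ∫ s in (0:ℝ)..x, (A s + ν • M s) (rexp (2 * |B s|) • ζ ν s) := by
      intro x
      have e := congrArg (fun f : ℝ →ᵇ E => f x) (hζ ν hν)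
      simp only [BoundedContinuousFunction.coe_add, Pi.add_apply] at e
      have e2 : Kν ν (ζ ν) x = KA (ζ ν) x + ν • KM (ζ ν) x := rfl
      have cA : Continuous fun s => rexp (2 * |B s|) • A s (ζ ν s) := by
        have := hA.clm_apply (ζ ν).continuous
        fun_prop
      have cM : Continuous fun s => rexp (2 * |B s|) • M s (ζ ν s) := by
        have := hM.clm_apply (ζ ν).continuous
        fun_prop
      rw [e2, hKA', hKM', smul_comm ν, ← intervalIntegral.integral_smul ν, ← smul_add,
        ← intervalIntegral.integral_add (cA.intervalIntegrable _ _)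
          ((cM.fun_const_smul ν).intervalIntegrable _ _)] at e
      rw [e]
      have e3 : ζ0 x = (rexp (-(2 * |B x|)) : ℝ) • z := rfl
      rw [e3, ← smul_add, smul_smul, ← Real.exp_add]
      simp only [add_neg_cancel, Real.exp_zero, one_smul]
      congr 1
      refine intervalIntegral.integral_congr fun s _ => ?_
      simp only [add_apply, smul_apply]
      rw [(A s).map_smul_of_tower, (M s).map_smul_of_tower, smul_comm ν]
    refine ⟨by simpa [hB0] using hform 0, fun x => ?_⟩
    have cF : Continuous fun s => (A s + ν • M s) (rexp (2 * |B s|) • ζ ν s) := by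
      have : Continuous fun s => A s + ν • M s := by fun_prop
      exact this.clm_apply (by have := (ζ ν).continuous; fun_prop)
    have hd := (intervalIntegral.integral_hasDerivAt_right (cF.intervalIntegrable 0 x)
      (cF.stronglyMeasurableAtFilter _ _) cF.continuousAt).const_add z
    exact hd.congr_of_eventuallyEq (Eventually.of_forall hform)
  · have : DifferentiableOn ℂ (fun ν => ζ ν x) (Metric.ball 0 N) :=
      (BoundedContinuousFunction.evalCLM ℂ x (β := E)).differentiable.comp_differentiableOn hζd
    exact this.const_smul (rexp (2 * |B x|))

theorem exists_linear_flow {E : Type*} [NormedAddCommGroup E] [NormedSpace ℂ E]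
    [CompleteSpace E] {A M : ℝ → E →L[ℂ] E} (hA : Continuous A) (hM : Continuous M) (z : E) :
    ∃ Z : ℂ → ℝ → E, (∀ ν, Z ν 0 = z ∧ ∀ x, HasDerivAt (Z ν) ((A x + ν • M x) (Z ν x)) x) ∧
      ∀ x, Differentiable ℂ fun ν => Z ν x := by
  choose Y hY hYd using fun n : ℕ =>
    exists_linear_flow_on_ball hA hM z (N := (n:ℝ) + 1) (by positivity)
  have hmem : ∀ ν : ℂ, ν ∈ Metric.ball (0:ℂ) ((⌈‖ν‖⌉₊ : ℝ) + 1) := fun ν => by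
    rw [mem_ball_zero_iff]; linarith [Nat.le_ceil ‖ν‖]
  refine ⟨fun ν => Y ⌈‖ν‖⌉₊ ν, fun ν => hY _ ν (hmem ν), fun x ν => ?_⟩
  have hopen := (Metric.isOpen_ball (x := (0:ℂ)) (ε := (⌈‖ν‖⌉₊ : ℝ) + 1)).mem_nhds (hmem ν)
  refine ((hYd ⌈‖ν‖⌉₊ x).differentiableAt hopen).congr_of_eventuallyEq ?_
  filter_upwards [hopen] with ξ hξ
  have hc : Continuous fun x => A x + ξ • M x := by fun_prop
  have h1 := hY _ ξ (hmem ξ)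
  have h2 := hY _ ξ hξ
  exact congrFun (linear_ode_unique hc h1.2 h2.2 (h1.1.trans h2.1.symm)) x

/-- Phase space of the pair of second order equations: `(u, u', v, v')`. -/
abbrev Phase := ℂ × ℂ × ℂ × ℂ

/-- Coefficients of `u'' = q₁ u - (c + ν w) v`, `v'' = q₂ v - (c + ν w) u`, together with the
weight `W` of the energy. -/
structure Coef where
  q1 : ℝ → ℝ
  q2 : ℝ → ℝ
  c : ℝ → ℝ
  w : ℝ → ℝ
  W : ℝ → ℝ
  q1_cont : Continuous q1
  q2_cont : Continuous q2
  c_cont : Continuous c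
  w_cont : Continuous w
  W_cont : Continuous W
  one_le_W : ∀ x, 1 ≤ W x

namespace Phase

noncomputable def shift : Phase →L[ℂ] Phase :=
  LinearMap.toContinuousLinearMap
    { toFun := fun z => (z.2.1, 0, z.2.2.2, 0)
      map_add' := fun z y => by simp
      map_smul' := fun a z => by simp }

noncomputable def proj1 : Phase →L[ℂ] Phase :=
  LinearMap.toContinuousLinearMap
    { toFun := fun z => (0, z.1, 0, 0)
      map_add' := fun z y => by simp
      map_smul' := fun a z => by simp }

noncomputable def proj2 : Phase →L[ℂ] Phase :=
  LinearMap.toContinuousLinearMap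
    { toFun := fun z => (0, 0, 0, z.2.2.1)
      map_add' := fun z y => by simp
      map_smul' := fun a z => by simp }

noncomputable def cross : Phase →L[ℂ] Phase :=
  LinearMap.toContinuousLinearMap
    { toFun := fun z => (0, -z.2.2.1, 0, -z.1)
      map_add' := fun z y => by simp [add_comm]
      map_smul' := fun a z => by simp }

/-- Sum of the squared moduli of the components. -/
def tot (z : Phase) : ℝ :=
  z.1.re ^ 2 + z.1.im ^ 2 + (z.2.1.re ^ 2 + z.2.1.im ^ 2) + (z.2.2.1.re ^ 2 + z.2.2.1.im ^ 2)
    + (z.2.2.2.re ^ 2 + z.2.2.2.im ^ 2)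

theorem tot_nonneg (z : Phase) : 0 ≤ tot z := by unfold tot; positivity

theorem _root_.Complex.norm_sq_eq_re_im (z : ℂ) : ‖z‖ ^ 2 = z.re ^ 2 + z.im ^ 2 := by
  rw [Complex.sq_norm, Complex.normSq_apply]; ring

theorem norm_sq_le_tot (z : Phase) : ‖z‖ ^ 2 ≤ tot z := by
  have h1 := Complex.norm_sq_eq_re_im z.1
  have h2 := Complex.norm_sq_eq_re_im z.2.1
  have h3 := Complex.norm_sq_eq_re_im z.2.2.1
  have h4 := Complex.norm_sq_eq_re_im z.2.2.2
  have : ‖z‖ = ‖z.1‖ ∨ ‖z‖ = ‖z.2.1‖ ∨ ‖z‖ = ‖z.2.2.1‖ ∨ ‖z‖ = ‖z.2.2.2‖ := by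
    simp only [Prod.norm_def]
    rcases max_choice ‖z.1‖ (max ‖z.2.1‖ (max ‖z.2.2.1‖ ‖z.2.2.2‖)) with h | h
    · exact Or.inl h
    rcases max_choice ‖z.2.1‖ (max ‖z.2.2.1‖ ‖z.2.2.2‖) with h' | h'
    · exact Or.inr (Or.inl (h.trans h'))
    rcases max_choice ‖z.2.2.1‖ ‖z.2.2.2‖ with h'' | h''
    · exact Or.inr (Or.inr (Or.inl (h.trans (h'.trans h''))))
    · exact Or.inr (Or.inr (Or.inr (h.trans (h'.trans h''))))
  unfold tot
  rcases this with h | h | h | h <;> rw [h] <;> nlinarith [sq_nonneg ‖z.1‖, sq_nonneg ‖z.2.1‖, sq_nonneg ‖z.2.2.1‖, sq_nonneg ‖z.2.2.2‖]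

theorem tot_le_norm_sq (z : Phase) : tot z ≤ 4 * ‖z‖ ^ 2 := by
  have h1 := Complex.norm_sq_eq_re_im z.1
  have h2 := Complex.norm_sq_eq_re_im z.2.1
  have h3 := Complex.norm_sq_eq_re_im z.2.2.1
  have h4 := Complex.norm_sq_eq_re_im z.2.2.2
  have e1 : ‖z.1‖ ^ 2 ≤ ‖z‖ ^ 2 := by gcongr; simp [Prod.norm_def]
  have e2 : ‖z.2.1‖ ^ 2 ≤ ‖z‖ ^ 2 := by gcongr; simp [Prod.norm_def]
  have e3 : ‖z.2.2.1‖ ^ 2 ≤ ‖z‖ ^ 2 := by gcongr; simp [Prod.norm_def]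
  have e4 : ‖z.2.2.2‖ ^ 2 ≤ ‖z‖ ^ 2 := by gcongr; simp [Prod.norm_def]
  unfold tot
  linarith

theorem eq_zero_of_tot (z : Phase) (h : tot z ≤ 0) : z = 0 := by
  have := (norm_sq_le_tot z).trans h
  exact norm_le_zero_iff.1 (by nlinarith [norm_nonneg z])

end Phase

namespace Coef

variable (K : Coef)

noncomputable def A (x : ℝ) : Phase →L[ℂ] Phase :=
  Phase.shift + (K.q1 x : ℂ) • Phase.proj1 + (K.q2 x : ℂ) • Phase.proj2
    + (K.c x : ℂ) • Phase.cross

noncomputable def M (x : ℝ) : Phase →L[ℂ] Phase := (K.w x : ℂ) • Phase.cross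

theorem continuous_A : Continuous K.A := by
  have := K.q1_cont; have := K.q2_cont; have := K.c_cont
  unfold A; fun_prop

theorem continuous_M : Continuous K.M := by
  have := K.w_cont
  unfold M; fun_prop

theorem field_apply (ν : ℂ) (x : ℝ) (z : Phase) :
    (K.A x + ν • K.M x) z = (z.2.1, K.q1 x * z.1 - (K.c x + ν * K.w x) * z.2.2.1, z.2.2.2,
      K.q2 x * z.2.2.1 - (K.c x + ν * K.w x) * z.1) := by
  have e0 : Phase.shift z = (z.2.1, 0, z.2.2.2, 0) := rfl
  have e1 : Phase.proj1 z = (0, z.1, 0, 0) := rfl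
  have e2 : Phase.proj2 z = (0, 0, 0, z.2.2.1) := rfl
  have e3 : Phase.cross z = (0, -z.2.2.1, 0, -z.1) := rfl
  simp only [A, M, add_apply, smul_apply, e0, e1, e2, e3,
    Prod.smul_mk, Prod.mk_add_mk, smul_eq_mul]
  refine Prod.ext ?_ (Prod.ext ?_ (Prod.ext ?_ ?_)) <;> simp <;> ring

def IsSol (ν : ℂ) (Z : ℝ → Phase) : Prop :=
  ∀ x, HasDerivAt Z ((K.A x + ν • K.M x) (Z x)) x

variable {K}

namespace IsSol

variable {ν : ℂ} {Z Y : ℝ → Phase}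

theorem continuous (h : K.IsSol ν Z) : Continuous Z :=
  continuous_iff_continuousAt.2 fun x => (h x).continuousAt

theorem comps (h : K.IsSol ν Z) (x : ℝ) :
    HasDerivAt (fun x => (Z x).1) (Z x).2.1 x ∧
    HasDerivAt (fun x => (Z x).2.1)
      (K.q1 x * (Z x).1 - (K.c x + ν * K.w x) * (Z x).2.2.1) x ∧
    HasDerivAt (fun x => (Z x).2.2.1) (Z x).2.2.2 x ∧
    HasDerivAt (fun x => (Z x).2.2.2)
      (K.q2 x * (Z x).2.2.1 - (K.c x + ν * K.w x) * (Z x).1) x := by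
  have := h x
  rw [field_apply] at this
  exact ⟨this.fst, this.snd.fst, this.snd.snd.fst, this.snd.snd.snd⟩

theorem _root_.HasDerivAt.re_comp {f : ℝ → ℂ} {d : ℂ} {x : ℝ} (h : HasDerivAt f d x) :
    HasDerivAt (fun x => (f x).re) d.re x := (Complex.reCLM.hasFDerivAt.comp_hasDerivAt x h)

theorem _root_.HasDerivAt.im_comp {f : ℝ → ℂ} {d : ℂ} {x : ℝ} (h : HasDerivAt f d x) :
    HasDerivAt (fun x => (f x).im) d.im x := (Complex.imCLM.hasFDerivAt.comp_hasDerivAt x h)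

theorem reals (h : K.IsSol ν Z) (x : ℝ) :
    HasDerivAt (fun x => (Z x).1.re) (Z x).2.1.re x ∧
    HasDerivAt (fun x => (Z x).1.im) (Z x).2.1.im x ∧
    HasDerivAt (fun x => (Z x).2.1.re)
      (K.q1 x * (Z x).1.re - ((K.c x + ν.re * K.w x) * (Z x).2.2.1.re
        - ν.im * K.w x * (Z x).2.2.1.im)) x ∧
    HasDerivAt (fun x => (Z x).2.1.im)
      (K.q1 x * (Z x).1.im - ((K.c x + ν.re * K.w x) * (Z x).2.2.1.im
        + ν.im * K.w x * (Z x).2.2.1.re)) x ∧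
    HasDerivAt (fun x => (Z x).2.2.1.re) (Z x).2.2.2.re x ∧
    HasDerivAt (fun x => (Z x).2.2.1.im) (Z x).2.2.2.im x ∧
    HasDerivAt (fun x => (Z x).2.2.2.re)
      (K.q2 x * (Z x).2.2.1.re - ((K.c x + ν.re * K.w x) * (Z x).1.re
        - ν.im * K.w x * (Z x).1.im)) x ∧
    HasDerivAt (fun x => (Z x).2.2.2.im)
      (K.q2 x * (Z x).2.2.1.im - ((K.c x + ν.re * K.w x) * (Z x).1.im
        + ν.im * K.w x * (Z x).1.re)) x := by
  obtain ⟨h1, h2, h3, h4⟩ := h.comps x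
  refine ⟨h1.re_comp, h1.im_comp, h2.re_comp.congr_deriv ?_, h2.im_comp.congr_deriv ?_,
    h3.re_comp, h3.im_comp, h4.re_comp.congr_deriv ?_, h4.im_comp.congr_deriv ?_⟩ <;>
  simp

theorem add (h : K.IsSol ν Z) (h' : K.IsSol ν Y) : K.IsSol ν (Z + Y) := fun x => by
  have := (h x).add (h' x)
  rwa [← ContinuousLinearMap.map_add] at this

theorem smul (h : K.IsSol ν Z) (a : ℂ) : K.IsSol ν (a • Z) := fun x => by
  have := (h x).const_smul a
  rwa [← ContinuousLinearMap.map_smul] at this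

theorem neg (h : K.IsSol ν Z) : K.IsSol ν (-Z) := by simpa using h.smul (-1)

theorem sub (h : K.IsSol ν Z) (h' : K.IsSol ν Y) : K.IsSol ν (Z - Y) := by
  simpa [sub_eq_add_neg] using h.add h'.neg

theorem unique (h : K.IsSol ν Z) (h' : K.IsSol ν Y) (h0 : Z 0 = Y 0) : Z = Y := by
  refine linear_ode_unique (A := fun x => K.A x + ν • K.M x) ?_ h h' h0
  have := K.continuous_A
  have := K.continuous_M
  fun_prop

theorem eq_zero_of_eq_zero (h : K.IsSol ν Z) {x : ℝ} (hx : Z x = 0) : Z 0 = 0 := by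
  have hc : Continuous fun x => K.A x + ν • K.M x := by
    have := K.continuous_A
    have := K.continuous_M
    fun_prop
  obtain ⟨B, hB⟩ := (isCompact_Icc (a := -|x|) (b := |x|)).exists_bound_of_continuousOn
    hc.continuousOn
  have := gronwall_backward_forward h (fun t ht =>
    ContinuousLinearMap.le_of_opNorm_le _ (hB t ht) _) (x := 0) (by simp) (abs_le.1 (le_refl |x|))
  simpa [hx] using this

end IsSol

theorem exists_sol (K : Coef) (z : Phase) : ∃ Z : ℂ → ℝ → Phase,
    (∀ ν, Z ν 0 = z ∧ K.IsSol ν (Z ν)) ∧ ∀ x, Differentiable ℂ fun ν => Z ν x :=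
  exists_linear_flow K.continuous_A K.continuous_M z

/-- Energy density. -/
def en (K : Coef) (x : ℝ) (z : Phase) : ℝ :=
  (z.2.1.re ^ 2 + z.2.1.im ^ 2) + (z.2.2.2.re ^ 2 + z.2.2.2.im ^ 2)
    + K.W x * (z.1.re ^ 2 + z.1.im ^ 2 + (z.2.2.1.re ^ 2 + z.2.2.1.im ^ 2))

theorem tot_le_en (x : ℝ) (z : Phase) : Phase.tot z ≤ K.en x z := by
  have := K.one_le_W x
  unfold Phase.tot en
  nlinarith [sq_nonneg z.1.re, sq_nonneg z.1.im, sq_nonneg z.2.2.1.re, sq_nonneg z.2.2.1.im]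

theorem en_nonneg (x : ℝ) (z : Phase) : 0 ≤ K.en x z := (Phase.tot_nonneg z).trans (K.tot_le_en x z)

theorem continuous_en {Z : ℝ → Phase} (h : Continuous Z) : Continuous fun x => K.en x (Z x) := by
  have := K.W_cont
  unfold en; fun_prop

def FinEn (K : Coef) (Z : ℝ → Phase) : Prop := ∃ C, ∀ T, 0 ≤ T → ∫ x in (0:ℝ)..T, K.en x (Z x) ≤ C

theorem FinEn.smul {Z : ℝ → Phase} (h : K.FinEn Z) (a : ℂ) : K.FinEn (a • Z) := by
  obtain ⟨C, hC⟩ := h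
  refine ⟨‖a‖ ^ 2 * C, fun T hT => ?_⟩
  have : ∀ x, K.en x ((a • Z) x) = ‖a‖ ^ 2 * K.en x (Z x) := fun x => by
    simp only [en, Complex.norm_sq_eq_re_im, Pi.smul_apply, Prod.smul_fst, Prod.smul_snd,
      smul_eq_mul, Complex.mul_re, Complex.mul_im]
    ring
  simp only [this, intervalIntegral.integral_const_mul]
  gcongr
  exact hC T hT

theorem FinEn.add {Z Y : ℝ → Phase} (h : K.FinEn Z) (h' : K.FinEn Y) (hZ : Continuous Z)
    (hY : Continuous Y) : K.FinEn (Z + Y) := by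
  obtain ⟨C, hC⟩ := h
  obtain ⟨D, hD⟩ := h'
  refine ⟨2 * C + 2 * D, fun T hT => ?_⟩
  have key : ∀ x, K.en x ((Z + Y) x) ≤ 2 * K.en x (Z x) + 2 * K.en x (Y x) := fun x => by
    have h2 := K.en_nonneg x ((Z - Y) x)
    have : K.en x ((Z + Y) x) + K.en x ((Z - Y) x) = 2 * K.en x (Z x) + 2 * K.en x (Y x) := by
      simp only [en, Pi.add_apply, Pi.sub_apply, Prod.fst_add, Prod.snd_add, Prod.fst_sub,
        Prod.snd_sub, Complex.add_re, Complex.add_im, Complex.sub_re, Complex.sub_im]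
      ring
    linarith
  have iZ := (K.continuous_en hZ).intervalIntegrable (μ := volume) 0 T
  have iY := (K.continuous_en hY).intervalIntegrable (μ := volume) 0 T
  calc _ ≤ ∫ x in (0:ℝ)..T, (2 * K.en x (Z x) + 2 * K.en x (Y x)) :=
        intervalIntegral.integral_mono_on hT ((K.continuous_en (hZ.add hY)).intervalIntegrable _ _)
          ((iZ.const_mul 2).add (iY.const_mul 2)) fun x _ => key x
    _ = 2 * (∫ x in (0:ℝ)..T, K.en x (Z x)) + 2 * ∫ x in (0:ℝ)..T, K.en x (Y x) := by
        rw [intervalIntegral.integral_add (iZ.const_mul 2) (iY.const_mul 2)]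
        simp only [intervalIntegral.integral_const_mul]
    _ ≤ _ := by linarith [hC T hT, hD T hT]

theorem FinEn.exists_small {Z : ℝ → Phase} (h : K.FinEn Z) (hZ : Continuous Z) {δ : ℝ}
    (hδ : 0 < δ) (X : ℝ) : ∃ T, X ≤ T ∧ 0 ≤ T ∧ Phase.tot (Z T) ≤ δ := by
  obtain ⟨C, hC⟩ := h
  by_contra! hcon
  set X' := max X 0
  have hX' : 0 ≤ X' := le_max_right _ _
  set T := X' + (|C| + 1) / δ
  have hT : X' ≤ T := le_add_of_nonneg_right (by positivity)
  have hi : ∀ a b, IntervalIntegrable (fun x => K.en x (Z x)) volume a b := fun a b =>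
    (K.continuous_en hZ).intervalIntegrable a b
  have h1 : ∫ x in X'..T, δ ≤ ∫ x in X'..T, K.en x (Z x) :=
    intervalIntegral.integral_mono_on hT (by simp) (hi _ _) fun x hx =>
      (hcon x ((le_max_left _ _).trans hx.1) (hX'.trans hx.1)).le.trans (K.tot_le_en x _)
  have h2 : 0 ≤ ∫ x in (0:ℝ)..X', K.en x (Z x) :=
    intervalIntegral.integral_nonneg hX' fun x _ => K.en_nonneg x _
  have h3 := intervalIntegral.integral_add_adjacent_intervals (hi 0 X') (hi X' T)
  have h4 := hC T (hX'.trans hT)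
  have h5 : ∫ x in X'..T, δ = |C| + 1 := by
    rw [intervalIntegral.integral_const, smul_eq_mul]; simp only [T]; field_simp; ring
  linarith [le_abs_self C]

end Coef

/-- A Riccati certificate of coercivity on the half line. -/
structure Cert where
  g1 : ℝ → ℝ
  g2 : ℝ → ℝ
  d1 : ℝ → ℝ
  d2 : ℝ → ℝ
  h1 : ∀ x, 0 ≤ x → HasDerivAt g1 (d1 x) x
  h2 : ∀ x, 0 ≤ x → HasDerivAt g2 (d2 x) x
  θ : ℝ
  c0 : ℝ
  α0 : ℝ
  C : ℝ
  θ_pos : 0 < θ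
  θ_le : θ ≤ 1
  c0_pos : 0 < c0
  c0_le : c0 ≤ θ
  alpha_pos : 0 < α0
  b1 : ∀ x, 0 ≤ x → |g1 x| ≤ C
  b2 : ∀ x, 0 ≤ x → |g2 x| ≤ C
  g2_zero : g2 0 = 0

namespace Cert

variable (G : Cert)

/-- The monotone flux. -/
def fl (x : ℝ) (z : Phase) : ℝ :=
  z.1.re * z.2.1.re + z.1.im * z.2.1.im + (z.2.2.1.re * z.2.2.2.re + z.2.2.1.im * z.2.2.2.im)
    - (1 - G.θ) * (G.g1 x * (z.1.re ^ 2 + z.1.im ^ 2) + G.g2 x * (z.2.2.1.re ^ 2 + z.2.2.1.im ^ 2))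

structure Coercive (K : Coef) : Prop where
  w_nonneg : ∀ x, 0 ≤ x → 0 ≤ K.w x
  q1_ge : ∀ x, 0 ≤ x → (1 - G.θ) * (G.d1 x + G.g1 x ^ 2) + |K.c x| + G.α0 * K.w x
    + G.c0 * K.W x ≤ K.q1 x
  q2_ge : ∀ x, 0 ≤ x → (1 - G.θ) * (G.d2 x + G.g2 x ^ 2) + |K.c x| + G.α0 * K.w x
    + G.c0 * K.W x ≤ K.q2 x

variable {G} {K : Coef} {ν : ℂ} {Z : ℝ → Phase}

theorem C_nonneg : 0 ≤ G.C := (abs_nonneg _).trans (G.b1 0 le_rfl)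

theorem abs_fl_le {x : ℝ} (hx : 0 ≤ x) (z : Phase) : |G.fl x z| ≤ (1 + G.C) * Phase.tot z := by
  have h1 := abs_le.1 (G.b1 x hx)
  have h2 := abs_le.1 (G.b2 x hx)
  have hθ := G.θ_pos
  have hθ' := G.θ_le
  have hC := G.C_nonneg
  have aux : ∀ {g n : ℝ}, -G.C ≤ g → g ≤ G.C → 0 ≤ n → |(1 - G.θ) * (g * n)| ≤ G.C * n := by
    intro g n h h' hn
    rw [abs_mul, abs_mul, abs_of_nonneg (sub_nonneg.2 hθ'), abs_of_nonneg hn]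
    calc _ ≤ 1 * (G.C * n) := by gcongr; linarith; exact abs_le.2 ⟨h, h'⟩
      _ = _ := one_mul _
  have a1 := abs_le.1 (aux h1.1 h1.2 (show 0 ≤ z.1.re ^ 2 + z.1.im ^ 2 by positivity))
  have a2 := abs_le.1 (aux h2.1 h2.2 (show 0 ≤ z.2.2.1.re ^ 2 + z.2.2.1.im ^ 2 by positivity))
  have hn1 : 0 ≤ G.C * (z.2.1.re ^ 2 + z.2.1.im ^ 2) := by positivity
  have hn2 : 0 ≤ G.C * (z.2.2.2.re ^ 2 + z.2.2.2.im ^ 2) := by positivity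
  unfold fl Phase.tot
  rw [abs_le]
  constructor
  · nlinarith [sq_nonneg (z.1.re + z.2.1.re), sq_nonneg (z.1.im + z.2.1.im),
      sq_nonneg (z.2.2.1.re + z.2.2.2.re), sq_nonneg (z.2.2.1.im + z.2.2.2.im)]
  · nlinarith [sq_nonneg (z.1.re - z.2.1.re), sq_nonneg (z.1.im - z.2.1.im),
      sq_nonneg (z.2.2.1.re - z.2.2.2.re), sq_nonneg (z.2.2.1.im - z.2.2.2.im)]

theorem hasDerivAt_fl (hK : G.Coercive K) (hν : |ν.re| ≤ G.α0) (hZ : K.IsSol ν Z) {x : ℝ}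
    (hx : 0 ≤ x) :
    ∃ d, HasDerivAt (fun x => G.fl x (Z x)) d x ∧ G.c0 * K.en x (Z x) ≤ d := by
  obtain ⟨h1, h2, h3, h4, h5, h6, h7, h8⟩ := hZ.reals x
  refine ⟨_, (((h1.mul h3).add (h2.mul h4)).add ((h5.mul h7).add (h6.mul h8))).sub
    ((((G.h1 x hx).mul ((h1.pow 2).add (h2.pow 2))).add
      ((G.h2 x hx).mul ((h5.pow 2).add (h6.pow 2)))).const_mul (1 - G.θ)), ?_⟩
  have q1 := hK.q1_ge x hx
  have q2 := hK.q2_ge x hx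
  have hw := hK.w_nonneg x hx
  simp only [Coef.en, Pi.add_apply, Pi.pow_apply, Nat.cast_ofNat, Nat.add_one_sub_one, pow_one]
  generalize (Z x).1.re = a at *
  generalize (Z x).1.im = b at *
  generalize (Z x).2.1.re = a' at *
  generalize (Z x).2.1.im = b' at *
  generalize (Z x).2.2.1.re = s at *
  generalize (Z x).2.2.1.im = t at *
  generalize (Z x).2.2.2.re = s' at *
  generalize (Z x).2.2.2.im = t' at *
  clear h1 h2 h3 h4 h5 h6 h7 h8
  set cr := K.c x + ν.re * K.w x with hcr
  have hcr' : |cr| ≤ |K.c x| + G.α0 * K.w x := by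
    refine (abs_add_le _ _).trans ?_
    rw [abs_mul, abs_of_nonneg hw]
    gcongr
  have hc1 : |cr * (2 * (a * s + b * t))| ≤
      (|K.c x| + G.α0 * K.w x) * (a ^ 2 + b ^ 2 + (s ^ 2 + t ^ 2)) := by
    rw [abs_mul]
    refine mul_le_mul hcr' ?_ (abs_nonneg _) ((abs_nonneg _).trans hcr')
    rw [abs_le]
    constructor <;> nlinarith [sq_nonneg (a + s), sq_nonneg (a - s), sq_nonneg (b + t), sq_nonneg (b - t)]
  have hc2 := (le_abs_self _).trans hc1
  have hθ := G.θ_le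
  have hc0 := G.c0_le
  have p1 : 0 ≤ (1 - G.θ) * ((a' - G.g1 x * a) ^ 2 + (b' - G.g1 x * b) ^ 2
      + (s' - G.g2 x * s) ^ 2 + (t' - G.g2 x * t) ^ 2) :=
    mul_nonneg (sub_nonneg.2 hθ) (by positivity)
  have p2 : 0 ≤ (G.θ - G.c0) * (a' ^ 2 + b' ^ 2 + s' ^ 2 + t' ^ 2) :=
    mul_nonneg (sub_nonneg.2 hc0) (by positivity)
  have p3 := mul_le_mul_of_nonneg_right q1 (show 0 ≤ a ^ 2 + b ^ 2 by positivity)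
  have p4 := mul_le_mul_of_nonneg_right q2 (show 0 ≤ s ^ 2 + t ^ 2 by positivity)
  linarith

theorem integral_en_le (hK : G.Coercive K) (hν : |ν.re| ≤ G.α0) (hZ : K.IsSol ν Z) {a b : ℝ}
    (ha : 0 ≤ a) (hab : a ≤ b) :
    G.c0 * ∫ x in a..b, K.en x (Z x) ≤ G.fl b (Z b) - G.fl a (Z a) := by
  have hc := K.continuous_en hZ.continuous
  have hI : ∀ x, HasDerivAt (fun x => ∫ t in a..x, K.en t (Z t)) (K.en x (Z x)) x := fun x =>
    intervalIntegral.integral_hasDerivAt_right (hc.intervalIntegrable _ _)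
      (hc.stronglyMeasurableAtFilter _ _) hc.continuousAt
  have hm : MonotoneOn (fun x => G.fl x (Z x) - G.c0 * ∫ t in a..x, K.en t (Z t)) (Set.Ici 0) := by
    choose! d hd hd' using fun x (hx : 0 ≤ x) => hasDerivAt_fl hK hν hZ hx
    refine monotoneOn_of_hasDerivWithinAt_nonneg (convex_Ici 0)
      (f' := fun x => d x - G.c0 * K.en x (Z x)) (fun x hx => ?_) (fun x hx => ?_) (fun x hx => ?_)
    · exact ((hd x hx).sub ((hI x).const_mul _)).continuousAt.continuousWithinAt
    · rw [interior_Ici] at hx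
      exact ((hd x hx.le).sub ((hI x).const_mul _)).hasDerivWithinAt
    · rw [interior_Ici] at hx
      exact sub_nonneg.2 (hd' x hx.le)
  have := hm (Set.mem_Ici.2 ha) (Set.mem_Ici.2 (ha.trans hab)) hab
  simp only [intervalIntegral.integral_same, mul_zero, sub_zero] at this
  linarith

theorem fl_mono (hK : G.Coercive K) (hν : |ν.re| ≤ G.α0) (hZ : K.IsSol ν Z) {a b : ℝ}
    (ha : 0 ≤ a) (hab : a ≤ b) : G.fl a (Z a) ≤ G.fl b (Z b) := by
  have h1 := integral_en_le hK hν hZ ha hab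
  have h2 : 0 ≤ ∫ x in a..b, K.en x (Z x) :=
    intervalIntegral.integral_nonneg hab fun x _ => K.en_nonneg x _
  nlinarith [G.c0_pos]

theorem fl_nonpos (hK : G.Coercive K) (hν : |ν.re| ≤ G.α0) (hZ : K.IsSol ν Z) (hf : K.FinEn Z)
    {x : ℝ} (hx : 0 ≤ x) : G.fl x (Z x) ≤ 0 := by
  refine le_of_forall_pos_le_add fun δ hδ => ?_
  have hC := G.C_nonneg
  obtain ⟨T, hT, hT0, hs⟩ := hf.exists_small hZ.continuous (δ := δ / (1 + G.C)) (by positivity) x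
  have h1 := fl_mono hK hν hZ hx hT
  have h2 := (abs_le.1 (G.abs_fl_le hT0 (Z T))).2
  have h3 : (1 + G.C) * Phase.tot (Z T) ≤ (1 + G.C) * (δ / (1 + G.C)) := by gcongr
  rw [mul_div_cancel₀ _ (by positivity)] at h3
  linarith

theorem finEn_of_fl_nonpos (hK : G.Coercive K) (hν : |ν.re| ≤ G.α0) (hZ : K.IsSol ν Z)
    (h : ∀ x, 0 ≤ x → G.fl x (Z x) ≤ 0) : K.FinEn Z := by
  refine ⟨-G.fl 0 (Z 0) / G.c0, fun T hT => ?_⟩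
  rw [le_div_iff₀ G.c0_pos]
  linarith [integral_en_le hK hν hZ le_rfl hT, h T hT]

theorem fl_eq_zero {x : ℝ} {z : Phase} (h1 : z.1 = 0) (h2 : z.2.2.1 = 0) : G.fl x z = 0 := by
  simp [fl, h1, h2]

theorem eq_zero_of_dirichlet (hK : G.Coercive K) (hν : |ν.re| ≤ G.α0) (hZ : K.IsSol ν Z)
    (h1 : (Z 0).1 = 0) (h2 : (Z 0).2.2.1 = 0) {T : ℝ} (hT : 0 < T) (hf : G.fl T (Z T) ≤ 0) :
    Z 0 = 0 := by
  have hz : ∀ x ∈ Set.Icc 0 T, G.fl x (Z x) = 0 := fun x hx => by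
    have a1 := fl_mono hK hν hZ le_rfl hx.1
    have a2 := fl_mono hK hν hZ hx.1 hx.2
    rw [fl_eq_zero h1 h2] at a1
    linarith
  obtain ⟨d, hd, hd'⟩ := hasDerivAt_fl hK hν hZ (x := T / 2) (by linarith)
  have hd0 : HasDerivAt (fun x => G.fl x (Z x)) 0 (T / 2) := by
    refine (hasDerivAt_const (T / 2) (0:ℝ)).congr_of_eventuallyEq ?_
    filter_upwards [Icc_mem_nhds (show 0 < T / 2 by linarith) (show T / 2 < T by linarith)]
      with x hx using hz x hx
  rw [hd.unique hd0] at hd'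
  have := K.tot_le_en (T / 2) (Z (T / 2))
  exact hZ.eq_zero_of_eq_zero (x := T / 2) (Phase.eq_zero_of_tot _ (by nlinarith [G.c0_pos]))

theorem unique_finEn (hK : G.Coercive K) (hν : |ν.re| ≤ G.α0) (hZ : K.IsSol ν Z)
    (hf : K.FinEn Z) {Y : ℝ → Phase} (hY : K.IsSol ν Y) (hf' : K.FinEn Y)
    (h1 : (Z 0).1 = (Y 0).1) (h2 : (Z 0).2.2.1 = (Y 0).2.2.1) : Z 0 = Y 0 := by
  have hD := hZ.sub hY
  have hfD : K.FinEn (Z - Y) := by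
    have := hf.add (hf'.smul (-1)) hZ.continuous (hY.continuous.const_smul _)
    simpa [sub_eq_add_neg] using this
  have := eq_zero_of_dirichlet hK hν hD (by simp [h1]) (by simp [h2]) one_pos
    (fl_nonpos hK hν hD hfD zero_le_one)
  exact sub_eq_zero.1 this

end Cert

namespace Coef

/-- Locally uniform convergence of the coefficients on the half line. -/
def Tends (Kn : ℕ → Coef) (K : Coef) : Prop :=
  ∀ S, ∀ δ > 0, ∀ᶠ n in atTop, ∀ x ∈ Set.Icc 0 S,
    ‖(Kn n).A x - K.A x‖ ≤ δ ∧ ‖(Kn n).M x - K.M x‖ ≤ δ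

theorem Tends.const (K : Coef) : Tends (fun _ => K) K := fun S δ hδ =>
  Eventually.of_forall fun n x _ => by simp [hδ.le]

theorem Tends.comp {Kn : ℕ → Coef} {K : Coef} (h : Tends Kn K) {φ : ℕ → ℕ}
    (hφ : Tendsto φ atTop atTop) : Tends (Kn ∘ φ) K := fun S δ hδ => hφ.eventually (h S δ hδ)

theorem continuous_field (K : Coef) (ν : ℂ) : Continuous fun x => K.A x + ν • K.M x := by
  have := K.continuous_A
  have := K.continuous_M
  fun_prop

theorem Tends.field {Kn : ℕ → Coef} {K : Coef} (h : Tends Kn K) {νn : ℕ → ℂ} {ν : ℂ}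
    (hν : Tendsto νn atTop (nhds ν)) (S : ℝ) {δ : ℝ} (hδ : 0 < δ) : ∀ᶠ n in atTop,
    ∀ x ∈ Set.Icc 0 S, ‖((Kn n).A x + νn n • (Kn n).M x) - (K.A x + ν • K.M x)‖ ≤ δ := by
  obtain ⟨B, hB⟩ := (isCompact_Icc (a := 0) (b := S)).exists_bound_of_continuousOn
    K.continuous_M.continuousOn
  set η := δ / (2 + ‖ν‖ + |B|)
  have hη : 0 < η := by positivity
  filter_upwards [h S η hη, Metric.tendsto_nhds.1 hν (min η 1) (by positivity)] with n h1 h2 x hx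
  rw [dist_eq_norm] at h2
  obtain ⟨hA, hM⟩ := h1 x hx
  have e : ((Kn n).A x + νn n • (Kn n).M x) - (K.A x + ν • K.M x)
      = ((Kn n).A x - K.A x) + νn n • ((Kn n).M x - K.M x) + (νn n - ν) • K.M x := by
    module
  have h3 : ‖νn n‖ ≤ ‖ν‖ + 1 := by
    have := norm_add_le ν (νn n - ν)
    rw [add_sub_cancel] at this
    linarith [min_le_right η 1]
  calc _ ≤ ‖(Kn n).A x - K.A x‖ + ‖νn n‖ * ‖(Kn n).M x - K.M x‖ + ‖νn n - ν‖ * ‖K.M x‖ := by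
        rw [e, ← norm_smul, ← norm_smul]; exact norm_add₃_le
    _ ≤ η + (‖ν‖ + 1) * η + η * |B| := by
        gcongr
        · exact h2.le.trans (min_le_left _ _)
        · exact (hB x hx).trans (le_abs_self B)
    _ = η * (2 + ‖ν‖ + |B|) := by ring
    _ = δ := div_mul_cancel₀ _ (by positivity)

open Classical in
/-- Initial data of the finite energy solution with prescribed Dirichlet data. -/
noncomputable def dat (K : Coef) (a b ν : ℂ) : Phase :=
  if h : ∃ Z, K.IsSol ν Z ∧ K.FinEn Z ∧ (Z 0).1 = a ∧ (Z 0).2.2.1 = b then h.choose 0 else 0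

end Coef

namespace Cert

variable {G : Cert}

theorem initial_bound {K : Coef} {ν : ℂ} {Z : ℝ → Phase} (hK : G.Coercive K)
    (hν : |ν.re| ≤ G.α0) (hZ : K.IsSol ν Z) (hf : G.fl 1 (Z 1) ≤ 0) {B : ℝ} (hB0 : 0 ≤ B)
    (hB : ∀ x ∈ Set.Icc (0:ℝ) 1, ‖K.A x + ν • K.M x‖ ≤ B) {κ : ℝ} (hκ : 0 < κ)
    (hκ' : κ ≤ G.c0 * (rexp (-(2 * B)) / 4)) :
    κ / 2 * Phase.tot (Z 0) ≤ (1 / (2 * κ) + G.C) * ((Z 0).1.re ^ 2 + (Z 0).1.im ^ 2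
      + ((Z 0).2.2.1.re ^ 2 + (Z 0).2.2.1.im ^ 2)) := by
  have h1 := integral_en_le hK hν hZ le_rfl zero_le_one
  have h2 : ∀ x ∈ Set.Icc (0:ℝ) 1, rexp (-(2 * B)) / 4 * Phase.tot (Z 0) ≤ K.en x (Z x) := by
    intro x hx
    have e1 := gronwall_backward_forward (a := 0) (b := 1) hZ (fun t ht =>
      ContinuousLinearMap.le_of_opNorm_le _ (hB t ht) _) (x := 0) (y := x) (by simp) hx
    have e2 : ‖Z 0‖ ≤ ‖Z x‖ * rexp B := e1.trans (by
      gcongr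
      rw [zero_sub, abs_neg, abs_of_nonneg hx.1]
      exact mul_le_of_le_one_right hB0 hx.2)
    have e3 : ‖Z 0‖ ^ 2 ≤ ‖Z x‖ ^ 2 * rexp (2 * B) := by
      calc _ ≤ (‖Z x‖ * rexp B) ^ 2 := by gcongr
        _ = _ := by rw [mul_pow, ← Real.exp_nat_mul]; norm_num
    calc _ ≤ rexp (-(2 * B)) / 4 * (4 * ‖Z 0‖ ^ 2) := by gcongr; exact Phase.tot_le_norm_sq _
      _ ≤ rexp (-(2 * B)) / 4 * (4 * (‖Z x‖ ^ 2 * rexp (2 * B))) := by gcongr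
      _ = ‖Z x‖ ^ 2 * (rexp (-(2 * B)) * rexp (2 * B)) := by ring
      _ = ‖Z x‖ ^ 2 := by rw [← Real.exp_add]; simp
      _ ≤ _ := (Phase.norm_sq_le_tot _).trans (K.tot_le_en _ _)
  have h3 : ∫ x in (0:ℝ)..1, rexp (-(2 * B)) / 4 * Phase.tot (Z 0) ≤ ∫ x in (0:ℝ)..1, K.en x (Z x) :=
    intervalIntegral.integral_mono_on zero_le_one (by simp)
      ((K.continuous_en hZ.continuous).intervalIntegrable _ _) h2
  rw [intervalIntegral.integral_const, sub_zero, one_smul] at h3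
  have h4 : κ * Phase.tot (Z 0) ≤ -G.fl 0 (Z 0) := by
    have := mul_le_mul_of_nonneg_right hκ' (Phase.tot_nonneg (Z 0))
    have h5 := mul_le_mul_of_nonneg_left h3 G.c0_pos.le
    linarith
  refine le_trans ?_ (sub_le_sub_right (h4.trans ?_) (κ / 2 * Phase.tot (Z 0))
    |>.trans_eq (add_sub_cancel_right _ _))
  · linarith
  unfold fl
  generalize hz : Z 0 = z at *
  clear h4 h3 h2 h1 hz hf hZ
  have hθ := G.θ_le
  have hθ0 := G.θ_pos
  have aux : ∀ {g n : ℝ}, |g| ≤ G.C → 0 ≤ n → (1 - G.θ) * (g * n) ≤ G.C * n := by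
    intro g n h hn
    have : g * n ≤ G.C * n := mul_le_mul_of_nonneg_right ((le_abs_self g).trans h) hn
    have : 0 ≤ G.C * n := mul_nonneg G.C_nonneg hn
    nlinarith
  have a1 := aux (G.b1 0 le_rfl) (show 0 ≤ z.1.re ^ 2 + z.1.im ^ 2 by positivity)
  have a2 := aux (G.b2 0 le_rfl) (show 0 ≤ z.2.2.1.re ^ 2 + z.2.2.1.im ^ 2 by positivity)
  have am : ∀ s t : ℝ, -(s * t) ≤ 1 / (2 * κ) * s ^ 2 + κ / 2 * t ^ 2 := by
    intro s t
    have : 0 ≤ 1 / (2 * κ) * (s + κ * t) ^ 2 := by positivity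
    have e : 1 / (2 * κ) * (s + κ * t) ^ 2 = 1 / (2 * κ) * s ^ 2 + κ / 2 * t ^ 2 + s * t := by
      field_simp; ring
    linarith
  have b1 := am z.1.re z.2.1.re
  have b2 := am z.1.im z.2.1.im
  have b3 := am z.2.2.1.re z.2.2.2.re
  have b4 := am z.2.2.1.im z.2.2.2.im
  have hp : 0 ≤ κ / 2 * (z.1.re ^ 2 + z.1.im ^ 2 + (z.2.2.1.re ^ 2 + z.2.2.1.im ^ 2)) := by positivity
  unfold Phase.tot
  linarith

/-- Compactness: solutions that are almost of finite energy converge along a subsequence. -/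
theorem compactness {Kn : ℕ → Coef} {K : Coef} (hT : Coef.Tends Kn K) {νn : ℕ → ℂ} {ν : ℂ}
    (hν : Tendsto νn atTop (nhds ν)) (hK : G.Coercive K) (hKn : ∀ n, G.Coercive (Kn n))
    (hre : |ν.re| ≤ G.α0) {ζ : ℕ → Phase} {a b : ℂ}
    (hζ : ∀ X, 0 ≤ X → ∀ᶠ n in atTop, |(νn n).re| ≤ G.α0 ∧ ∃ Z, (Kn n).IsSol (νn n) Z ∧
      Z 0 = ζ n ∧ (Z 0).1 = a ∧ (Z 0).2.2.1 = b ∧ G.fl X (Z X) ≤ 0) :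
    ∃ φ : ℕ → ℕ, StrictMono φ ∧ ∃ W, K.IsSol ν W ∧ K.FinEn W ∧ (W 0).1 = a ∧ (W 0).2.2.1 = b ∧
      Tendsto (ζ ∘ φ) atTop (nhds (W 0)) := by
  obtain ⟨B, hB⟩ := (isCompact_Icc (a := (0:ℝ)) (b := 1)).exists_bound_of_continuousOn
    (K.continuous_field ν).continuousOn
  have hB0 : 0 ≤ B := (norm_nonneg _).trans (hB 0 (by simp))
  set κ := G.c0 * (rexp (-(2 * (B + 1))) / 4) with hκ
  have hκ0 : 0 < κ := by have := G.c0_pos; positivity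
  set R := (1 / (2 * κ) + G.C) * (a.re ^ 2 + a.im ^ 2 + (b.re ^ 2 + b.im ^ 2)) / (κ / 2)
  have hbd : ∀ᶠ n in atTop, ζ n ∈ Metric.closedBall (0 : Phase) (max R 1) := by
    filter_upwards [hζ 1 zero_le_one, hT.field hν 1 one_pos] with n ⟨h1, Z, hZ, h2, h3, h4, h5⟩ h6
    have := initial_bound (hKn n) h1 hZ h5 (B := B + 1) (by positivity) (fun x hx => by
      have := norm_add_le (K.A x + ν • K.M x)
        (((Kn n).A x + νn n • (Kn n).M x) - (K.A x + ν • K.M x))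
      rw [add_sub_cancel] at this
      exact this.trans (add_le_add (hB x hx) (h6 x hx))) hκ0 le_rfl
    rw [h3, h4, h2, mul_comm, ← le_div_iff₀ (by positivity)] at this
    have h7 : ‖ζ n‖ ^ 2 ≤ R := (Phase.norm_sq_le_tot (ζ n)).trans this
    rw [mem_closedBall_zero_iff]
    by_contra! hcon
    have h8 := (le_max_left R 1).trans_lt hcon
    have h9 := (le_max_right R 1).trans_lt hcon
    nlinarith
  obtain ⟨z, -, φ, hφ, hz⟩ := tendsto_subseq_of_frequently_bounded Metric.isBounded_closedBall
    hbd.frequently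
  obtain ⟨Zf, hZf, -⟩ := K.exists_sol z
  obtain ⟨hW0, hW⟩ := hZf ν
  set W := Zf ν
  refine ⟨φ, hφ, W, hW, ?_, ?_, ?_, hW0.symm ▸ hz⟩
  · refine finEn_of_fl_nonpos hK hre hW fun X hX => ?_
    have hev := hφ.tendsto_atTop.eventually (hζ X hX)
    have hex : ∀ n, ∃ Z : ℝ → Phase, (∃ Z, (Kn (φ n)).IsSol (νn (φ n)) Z ∧
      Z 0 = ζ (φ n) ∧ (Z 0).1 = a ∧ (Z 0).2.2.1 = b ∧ G.fl X (Z X) ≤ 0) →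
      (Kn (φ n)).IsSol (νn (φ n)) Z ∧ Z 0 = ζ (φ n) ∧ G.fl X (Z X) ≤ 0 := by
      intro n
      by_cases h : ∃ Z, (Kn (φ n)).IsSol (νn (φ n)) Z ∧
        Z 0 = ζ (φ n) ∧ (Z 0).1 = a ∧ (Z 0).2.2.1 = b ∧ G.fl X (Z X) ≤ 0
      · obtain ⟨Z, h1, h2, -, -, h3⟩ := h
        exact ⟨Z, fun _ => ⟨h1, h2, h3⟩⟩
      · exact ⟨0, fun h' => absurd h' h⟩
    choose Y hY using hex
    have hlim : Tendsto (fun n => Y n X) atTop (nhds (W X)) := by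
      refine linear_ode_tendsto (K.continuous_field ν)
        (fun S δ hδ => (hT.comp hφ.tendsto_atTop).field (hν.comp hφ.tendsto_atTop) S hδ)
        (hev.mono fun n hn => (hY n hn.2).1) hW ?_ hX
      rw [hW0]
      refine hz.congr' (hev.mono fun n hn => ?_)
      exact (hY n hn.2).2.1.symm
    have hc : Continuous (G.fl X) := by unfold fl; fun_prop
    exact le_of_tendsto (hc.continuousAt.tendsto.comp hlim)
      (hev.mono fun n hn => (hY n hn.2).2.2)
  · have h1 : Tendsto (fun n => (ζ (φ n)).1) atTop (nhds z.1) :=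
      (continuous_fst.tendsto z).comp hz
    have h2 : Tendsto (fun n => (ζ (φ n)).1) atTop (nhds a) := by
      refine tendsto_const_nhds.congr' ?_
      filter_upwards [hφ.tendsto_atTop.eventually (hζ 0 le_rfl)] with n ⟨_, Z, _, e1, e2, _⟩
      rw [← e1, e2]
    rw [hW0]
    exact tendsto_nhds_unique h1 h2
  · have h1 : Tendsto (fun n => (ζ (φ n)).2.2.1) atTop (nhds z.2.2.1) :=
      ((continuous_fst.comp (continuous_snd.comp continuous_snd)).tendsto z).comp hz
    have h2 : Tendsto (fun n => (ζ (φ n)).2.2.1) atTop (nhds b) := by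
      refine tendsto_const_nhds.congr' ?_
      filter_upwards [hφ.tendsto_atTop.eventually (hζ 0 le_rfl)] with n ⟨_, Z, _, e1, _, e2, _⟩
      rw [← e1, e2]
    rw [hW0]
    exact tendsto_nhds_unique h1 h2

/-- The open strip of admissible spectral parameters. -/
def strip (G : Cert) : Set ℂ := {ν | |ν.re| < G.α0}

theorem isOpen_strip : IsOpen G.strip :=
  isOpen_lt (by fun_prop) continuous_const

/-- Solvability of the Dirichlet problem on `[0, T]`, analytically in the spectral parameter. -/
theorem exists_truncated {K : Coef} (hK : G.Coercive K) (a b : ℂ) {T : ℝ} (hT : 0 < T) :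
    ∃ ζ : ℂ → Phase, DifferentiableOn ℂ ζ G.strip ∧ ∀ ν ∈ G.strip, ∃ Z, K.IsSol ν Z ∧ Z 0 = ζ ν ∧
      (Z 0).1 = a ∧ (Z 0).2.2.1 = b ∧ (Z T).1 = 0 ∧ (Z T).2.2.1 = 0 := by
  obtain ⟨P, hP, dP⟩ := K.exists_sol (a, 0, b, 0)
  obtain ⟨Q, hQ, dQ⟩ := K.exists_sol (0, 1, 0, 0)
  obtain ⟨S, hS, dS⟩ := K.exists_sol (0, 0, 0, 1)
  set det : ℂ → ℂ := fun ν => (Q ν T).1 * (S ν T).2.2.1 - (S ν T).1 * (Q ν T).2.2.1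
  have hdet : ∀ ν ∈ G.strip, det ν ≠ 0 := by
    intro ν hν h0
    have hν' : |ν.re| ≤ G.α0 := le_of_lt hν
    have main : ∀ s t : ℂ, s * (Q ν T).1 + t * (S ν T).1 = 0 →
        s * (Q ν T).2.2.1 + t * (S ν T).2.2.1 = 0 → s = 0 ∧ t = 0 := by
      intro s t e1 e2
      have hsol := ((hQ ν).2.smul s).add ((hS ν).2.smul t)
      have := eq_zero_of_dirichlet hK hν' hsol (by simp [(hQ ν).1, (hS ν).1])
        (by simp [(hQ ν).1, (hS ν).1]) hT (fl_eq_zero (by simpa using e1) (by simpa using e2)).le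
      simpa [(hQ ν).1, (hS ν).1] using this
    have h1 := main ((S ν T).2.2.1) (-(Q ν T).2.2.1) (by linear_combination h0) (by ring)
    have h2 := main ((S ν T).1) (-(Q ν T).1) (by ring) (by linear_combination -h0)
    have h3 := main 1 0 (by linear_combination -h2.2) (by linear_combination -h1.2)
    exact one_ne_zero h3.1
  set s : ℂ → ℂ := fun ν => (-(P ν T).1 * (S ν T).2.2.1 + (P ν T).2.2.1 * (S ν T).1) / det ν with hs
  set t : ℂ → ℂ := fun ν => (-(P ν T).2.2.1 * (Q ν T).1 + (P ν T).1 * (Q ν T).2.2.1) / det ν with ht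
  have dP1 := (dP T).fst
  have dP2 := (dP T).snd.snd.fst
  have dQ1 := (dQ T).fst
  have dQ2 := (dQ T).snd.snd.fst
  have dS1 := (dS T).fst
  have dS2 := (dS T).snd.snd.fst
  have ddet : Differentiable ℂ det := (dQ1.mul dS2).sub (dS1.mul dQ2)
  have ds : DifferentiableOn ℂ s G.strip :=
    ((dP1.neg.mul dS2).add (dP2.mul dS1)).differentiableOn.div ddet.differentiableOn hdet
  have dt : DifferentiableOn ℂ t G.strip :=
    ((dP2.neg.mul dQ1).add (dP1.mul dQ2)).differentiableOn.div ddet.differentiableOn hdet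
  refine ⟨fun ν => (a, s ν, b, t ν), (differentiableOn_const a).prodMk
    (ds.prodMk ((differentiableOn_const b).prodMk dt)), fun ν hν => ?_⟩
  have hd := hdet ν hν
  refine ⟨P ν + (s ν • Q ν + t ν • S ν),
    (hP ν).2.add (((hQ ν).2.smul _).add ((hS ν).2.smul _)), ?_, ?_, ?_, ?_, ?_⟩
  · simp [(hP ν).1, (hQ ν).1, (hS ν).1]
  · simp [(hP ν).1, (hQ ν).1, (hS ν).1]
  · simp [(hP ν).1, (hQ ν).1, (hS ν).1]
  · simp only [Pi.add_apply, Pi.smul_apply, Prod.fst_add, Prod.smul_fst, smul_eq_mul, hs, ht]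
    field_simp
    simp only [det]
    ring
  · simp only [Pi.add_apply, Pi.smul_apply, Prod.fst_add, Prod.snd_add, Prod.smul_fst,
      Prod.smul_snd, smul_eq_mul, hs, ht]
    field_simp
    simp only [det]
    ring

theorem dat_spec {K : Coef} (hK : G.Coercive K) (a b : ℂ) {ν : ℂ} (hν : ν ∈ G.strip) :
    ∃ Z, K.IsSol ν Z ∧ K.FinEn Z ∧ (Z 0).1 = a ∧ (Z 0).2.2.1 = b ∧ Z 0 = K.dat a b ν := by
  have hν' : |ν.re| ≤ G.α0 := le_of_lt hν
  have hex : ∃ Z, K.IsSol ν Z ∧ K.FinEn Z ∧ (Z 0).1 = a ∧ (Z 0).2.2.1 = b := by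
    choose ζ _ Zn hZn h0 h1 h2 h3 h4 using fun n : ℕ =>
      exists_truncated hK a b (T := (n:ℝ) + 1) (by positivity)
    obtain ⟨-, -, W, hW, hf, ha, hb, -⟩ := compactness (Coef.Tends.const K)
      (tendsto_const_nhds (x := ν)) hK (fun _ => hK) hν' (ζ := fun n => ζ n ν) (a := a) (b := b)
      (fun X hX => by
        filter_upwards [eventually_ge_atTop ⌈X⌉₊] with n hn
        refine ⟨hν', Zn n ν hν, hZn n ν hν, h0 n ν hν, h1 n ν hν, h2 n ν hν, ?_⟩
        have hX' : X ≤ (n:ℝ) + 1 := (Nat.ceil_le.1 hn).trans (by linarith)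
        refine (fl_mono hK hν' (hZn n ν hν) hX hX').trans ?_
        exact (fl_eq_zero (h3 n ν hν) (h4 n ν hν)).le)
    exact ⟨W, hW, hf, ha, hb⟩
  refine ⟨hex.choose, hex.choose_spec.1, hex.choose_spec.2.1, hex.choose_spec.2.2.1,
    hex.choose_spec.2.2.2, ?_⟩
  rw [Coef.dat, dif_pos hex]

theorem dat_unique {K : Coef} (hK : G.Coercive K) {ν : ℂ} (hν : ν ∈ G.strip) {Z : ℝ → Phase}
    (hZ : K.IsSol ν Z) (hf : K.FinEn Z) : Z 0 = K.dat (Z 0).1 (Z 0).2.2.1 ν := by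
  obtain ⟨Y, hY, hfY, h1, h2, h3⟩ := dat_spec hK (Z 0).1 (Z 0).2.2.1 hν
  rw [← h3]
  exact unique_finEn hK (le_of_lt hν) hZ hf hY hfY h1.symm h2.symm

theorem tendsto_dat {Kn : ℕ → Coef} {K : Coef} (hT : Coef.Tends Kn K) {νn : ℕ → ℂ} {ν : ℂ}
    (hν : Tendsto νn atTop (nhds ν)) (hK : G.Coercive K) (hKn : ∀ n, G.Coercive (Kn n))
    (hre : ν ∈ G.strip) {ζ : ℕ → Phase} {a b : ℂ}
    (hζ : ∀ X, 0 ≤ X → ∀ᶠ n in atTop, |(νn n).re| ≤ G.α0 ∧ ∃ Z, (Kn n).IsSol (νn n) Z ∧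
      Z 0 = ζ n ∧ (Z 0).1 = a ∧ (Z 0).2.2.1 = b ∧ G.fl X (Z X) ≤ 0) :
    Tendsto ζ atTop (nhds (K.dat a b ν)) := by
  refine tendsto_of_subseq_tendsto fun ns hns => ?_
  obtain ⟨φ, -, W, hW, hf, ha, hb, hlim⟩ := compactness (hT.comp hns) (hν.comp hns) hK
    (fun n => hKn (ns n)) (le_of_lt hre) (ζ := ζ ∘ ns) (a := a) (b := b)
    (fun X hX => hns.eventually (hζ X hX))
  refine ⟨φ, ?_⟩
  have := dat_unique hK hre hW hf
  rw [ha, hb] at this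
  rwa [← this]

theorem tendsto_dat_dat {Kn : ℕ → Coef} {K : Coef} (hT : Coef.Tends Kn K) {νn : ℕ → ℂ} {ν : ℂ}
    (hν : Tendsto νn atTop (nhds ν)) (hK : G.Coercive K) (hKn : ∀ n, G.Coercive (Kn n))
    (hre : ν ∈ G.strip) (a b : ℂ) :
    Tendsto (fun n => (Kn n).dat a b (νn n)) atTop (nhds (K.dat a b ν)) := by
  refine tendsto_dat hT hν hK hKn hre fun X hX => ?_
  filter_upwards [hν.eventually (isOpen_strip.mem_nhds hre)] with n hn
  obtain ⟨Z, hZ, hf, h1, h2, h3⟩ := dat_spec (hKn n) a b hn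
  exact ⟨le_of_lt hn, Z, hZ, h3, h1, h2, fl_nonpos (hKn n) (le_of_lt hn) hZ hf hX⟩

theorem differentiableOn_dat {K : Coef} (hK : G.Coercive K) (a b : ℂ) :
    DifferentiableOn ℂ (K.dat a b) G.strip := by
  choose ζ hζd hζ using fun n : ℕ => exists_truncated hK a b (T := (n:ℝ) + 1) (by positivity)
  refine TendstoLocallyUniformlyOn.differentiableOn (F := ζ) (φ := atTop) ?_
    (Eventually.of_forall hζd) isOpen_strip
  rw [isOpen_strip.tendstoLocallyUniformlyOn_iff_forall_tendsto]
  intro ν hν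
  refine tendsto_of_seq_tendsto fun u hu => ?_
  have hn : Tendsto (fun k => (u k).1) atTop atTop := tendsto_fst.comp hu
  have hν2 : Tendsto (fun k => (u k).2) atTop (nhds ν) := tendsto_snd.comp hu
  have l1 : Tendsto (fun k => K.dat a b (u k).2) atTop (nhds (K.dat a b ν)) :=
    tendsto_dat_dat (Coef.Tends.const K) hν2 hK (fun _ => hK) hν a b
  have l2 : Tendsto (fun k => ζ (u k).1 (u k).2) atTop (nhds (K.dat a b ν)) := by
    refine tendsto_dat (Coef.Tends.const K) hν2 hK (fun _ => hK) hν fun X hX => ?_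
    filter_upwards [hν2.eventually (isOpen_strip.mem_nhds hν),
      hn.eventually (eventually_ge_atTop ⌈X⌉₊)] with k hk hk2
    obtain ⟨Z, hZ, h1, h2, h3, h4, h5⟩ := hζ (u k).1 (u k).2 hk
    refine ⟨le_of_lt hk, Z, hZ, h1, h2, h3, ?_⟩
    have hX' : X ≤ ((u k).1:ℝ) + 1 := (Nat.ceil_le.1 hk2).trans (by linarith)
    exact (fl_mono hK (le_of_lt hk) hZ hX hX').trans (fl_eq_zero h4 h5).le
  exact (l1.prodMk_nhds l2).mono_right (nhds_le_uniformity (K.dat a b ν))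

theorem dat_linear {K : Coef} (hK : G.Coercive K) {ν : ℂ} (hν : ν ∈ G.strip) (a b : ℂ) :
    K.dat a b ν = a • K.dat 1 0 ν + b • K.dat 0 1 ν := by
  obtain ⟨Z, hZ, hf, h1, h2, h3⟩ := dat_spec hK 1 0 hν
  obtain ⟨Y, hY, hg, k1, k2, k3⟩ := dat_spec hK 0 1 hν
  rw [h3] at h1 h2
  rw [k3] at k1 k2
  have := dat_unique hK hν ((hZ.smul a).add (hY.smul b))
    ((hf.smul a).add (hg.smul b) (hZ.continuous.const_smul a) (hY.continuous.const_smul b))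
  simp only [Pi.add_apply, Pi.smul_apply, Prod.fst_add, Prod.snd_add, Prod.smul_fst,
    Prod.smul_snd, h1, h2, k1, k2, h3, k3, smul_eq_mul, mul_one, mul_zero, add_zero,
    zero_add] at this
  exact this.symm

end Cert

namespace Coef

/-- The coefficients seen after the reflection `x ↦ -x`. -/
def refl (K : Coef) : Coef where
  q1 x := K.q1 (-x)
  q2 x := K.q2 (-x)
  c x := K.c (-x)
  w x := K.w (-x)
  W x := K.W (-x)
  q1_cont := K.q1_cont.comp continuous_neg
  q2_cont := K.q2_cont.comp continuous_neg
  c_cont := K.c_cont.comp continuous_neg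
  w_cont := K.w_cont.comp continuous_neg
  W_cont := K.W_cont.comp continuous_neg
  one_le_W x := K.one_le_W (-x)

def _root_.Phase.flip (z : Phase) : Phase := (z.1, -z.2.1, z.2.2.1, -z.2.2.2)

theorem IsSol.flip {K : Coef} {ν : ℂ} {Y : ℝ → Phase} (h : K.refl.IsSol ν Y) :
    K.IsSol ν (fun x => (Y (-x)).flip) := fun x => by
  obtain ⟨h1, h2, h3, h4⟩ := h.comps (-x)
  rw [field_apply]
  have k1 := h1.scomp x (hasDerivAt_neg x)
  have k2 := (h2.scomp x (hasDerivAt_neg x)).neg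
  have k3 := h3.scomp x (hasDerivAt_neg x)
  have k4 := (h4.scomp x (hasDerivAt_neg x)).neg
  refine (k1.prodMk (k2.prodMk (k3.prodMk k4))).congr_deriv ?_
  simp [Phase.flip, refl]

/-- The matching determinant of the half line problems to the right and to the left of `0`. -/
noncomputable def disc (K : Coef) (ν : ℂ) : ℂ :=
  ((K.dat 1 0 ν).2.1 + (K.refl.dat 1 0 ν).2.1)
      * ((K.dat 0 1 ν).2.2.2 + (K.refl.dat 0 1 ν).2.2.2)
    - ((K.dat 0 1 ν).2.1 + (K.refl.dat 0 1 ν).2.1)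
      * ((K.dat 1 0 ν).2.2.2 + (K.refl.dat 1 0 ν).2.2.2)

end Coef

namespace Cert

variable {G : Cert}

theorem exists_global_sol {K : Coef} (hK : G.Coercive K) (hK' : G.Coercive K.refl) {ν : ℂ}
    (hν : ν ∈ G.strip) (h : K.disc ν = 0) :
    ∃ Z, K.IsSol ν Z ∧ Z 0 ≠ 0 ∧ K.FinEn Z ∧ K.refl.FinEn (fun x => Z (-x)) := by
  obtain ⟨s, t, hst, e1, e2⟩ : ∃ s t : ℂ, (s ≠ 0 ∨ t ≠ 0) ∧
      s * ((K.dat 1 0 ν).2.1 + (K.refl.dat 1 0 ν).2.1)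
        + t * ((K.dat 0 1 ν).2.1 + (K.refl.dat 0 1 ν).2.1) = 0 ∧
      s * ((K.dat 1 0 ν).2.2.2 + (K.refl.dat 1 0 ν).2.2.2)
        + t * ((K.dat 0 1 ν).2.2.2 + (K.refl.dat 0 1 ν).2.2.2) = 0 := by
    unfold Coef.disc at h
    generalize (K.dat 1 0 ν).2.1 + (K.refl.dat 1 0 ν).2.1 = a at *
    generalize (K.dat 0 1 ν).2.1 + (K.refl.dat 0 1 ν).2.1 = b at *
    generalize (K.dat 1 0 ν).2.2.2 + (K.refl.dat 1 0 ν).2.2.2 = c at *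
    generalize (K.dat 0 1 ν).2.2.2 + (K.refl.dat 0 1 ν).2.2.2 = d at *
    by_cases hb : b = 0
    · by_cases hd : d = 0
      · exact ⟨0, 1, by simp, by simp [hb], by simp [hd]⟩
      · exact ⟨d, -c, Or.inl hd, by linear_combination h, by ring⟩
    · exact ⟨b, -a, Or.inl hb, by ring, by linear_combination -h⟩
  obtain ⟨Z, hZ, hf, h1, h2, h3⟩ := dat_spec hK s t hν
  obtain ⟨Y, hY, hg, k1, k2, k3⟩ := dat_spec hK' s t hν
  have hZY : Z = fun x => (Y (-x)).flip := by
    refine hZ.unique hY.flip ?_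
    have l1 := dat_linear hK hν s t
    have l2 := dat_linear hK' hν s t
    rw [← h3] at l1
    rw [← k3] at l2
    simp only [neg_zero, Phase.flip]
    refine Prod.ext (h1.trans k1.symm) (Prod.ext ?_ (Prod.ext (h2.trans k2.symm) ?_))
    · simp only [l1, l2, Prod.snd_add, Prod.fst_add, Prod.smul_snd, Prod.smul_fst, smul_eq_mul]
      linear_combination e1
    · simp only [l1, l2, Prod.snd_add, Prod.smul_snd, smul_eq_mul]
      linear_combination e2
  refine ⟨Z, hZ, fun h0 => ?_, hf, ?_⟩
  · rw [h0] at h1 h2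
    rcases hst with h | h
    · exact h h1.symm
    · exact h h2.symm
  · obtain ⟨C, hC⟩ := hg
    refine ⟨C, fun T hT => ?_⟩
    have : ∀ x, K.refl.en x (Z (-x)) = K.refl.en x (Y x) := fun x => by
      rw [hZY]; simp [Coef.en, Phase.flip]
    simpa only [this] using hC T hT

theorem tendsto_disc {Kn : ℕ → Coef} {K : Coef} (hT : Coef.Tends Kn K)
    (hT' : Coef.Tends (fun n => (Kn n).refl) K.refl) {νn : ℕ → ℂ} {ν : ℂ}
    (hν : Tendsto νn atTop (nhds ν)) (hK : G.Coercive K) (hK' : G.Coercive K.refl)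
    (hKn : ∀ n, G.Coercive (Kn n)) (hKn' : ∀ n, G.Coercive (Kn n).refl) (hre : ν ∈ G.strip) :
    Tendsto (fun n => (Kn n).disc (νn n)) atTop (nhds (K.disc ν)) := by
  have a1 := tendsto_dat_dat hT hν hK hKn hre 1 0
  have a2 := tendsto_dat_dat hT hν hK hKn hre 0 1
  have b1 := tendsto_dat_dat hT' hν hK' hKn' hre 1 0
  have b2 := tendsto_dat_dat hT' hν hK' hKn' hre 0 1
  exact ((a1.snd_nhds.fst_nhds.add b1.snd_nhds.fst_nhds).mul
      (a2.snd_nhds.snd_nhds.snd_nhds.add b2.snd_nhds.snd_nhds.snd_nhds)).sub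
    ((a2.snd_nhds.fst_nhds.add b2.snd_nhds.fst_nhds).mul
      (a1.snd_nhds.snd_nhds.snd_nhds.add b1.snd_nhds.snd_nhds.snd_nhds))

theorem differentiableOn_disc {K : Coef} (hK : G.Coercive K) (hK' : G.Coercive K.refl) :
    DifferentiableOn ℂ K.disc G.strip := by
  have a1 := differentiableOn_dat hK 1 0
  have a2 := differentiableOn_dat hK 0 1
  have b1 := differentiableOn_dat hK' 1 0
  have b2 := differentiableOn_dat hK' 0 1
  exact ((a1.snd.fst.add b1.snd.fst).mul (a2.snd.snd.snd.add b2.snd.snd.snd)).sub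
    ((a2.snd.fst.add b2.snd.fst).mul (a1.snd.snd.snd.add b1.snd.snd.snd))

theorem isPreconnected_strip : IsPreconnected G.strip := by
  have : G.strip = Complex.reLm ⁻¹' (Metric.ball 0 G.α0) := by
    ext ν; simp [strip, Metric.mem_ball, dist_eq_norm]
  rw [this]
  exact ((convex_ball (0:ℝ) G.α0).linear_preimage Complex.reLm).isPreconnected

/-- Zeros of the limit determinant persist. -/
theorem exists_disc_eq_zero {Kn : ℕ → Coef} {K : Coef} (hT : Coef.Tends Kn K)
    (hT' : Coef.Tends (fun n => (Kn n).refl) K.refl) (hK : G.Coercive K)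
    (hK' : G.Coercive K.refl) (hKn : ∀ n, G.Coercive (Kn n)) (hKn' : ∀ n, G.Coercive (Kn n).refl)
    {ν0 ν1 : ℂ} (h0 : ν0 ∈ G.strip) (h1 : ν1 ∈ G.strip) (hz : K.disc ν0 = 0)
    (hnz : K.disc ν1 ≠ 0) {r : ℝ} (hr : 0 < r) :
    ∃ n, ∃ z ∈ G.strip, ‖z - ν0‖ ≤ r ∧ (Kn n).disc z = 0 := by
  have han : AnalyticOnNhd ℂ K.disc G.strip :=
    (differentiableOn_disc hK hK').analyticOnNhd isOpen_strip
  have hne : ∀ᶠ z in nhdsWithin ν0 {ν0}ᶜ, K.disc z ≠ 0 := by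
    by_contra hcon
    rw [not_eventually] at hcon
    refine hnz (han.eqOn_zero_of_preconnected_of_frequently_eq_zero isPreconnected_strip h0 ?_ h1)
    exact hcon.mono fun z hz => not_not.1 hz
  obtain ⟨r1, hr1, hball⟩ := Metric.mem_nhdsWithin_iff.1 hne
  obtain ⟨r2, hr2, hsub⟩ := Metric.isOpen_iff.1 isOpen_strip ν0 h0
  set ρ := min r (min (r1 / 2) (r2 / 2)) with hρdef
  have hρ : 0 < ρ := by positivity
  have hρ1 : ρ < r1 := by
    have : ρ ≤ r1 / 2 := (min_le_right _ _).trans (min_le_left _ _)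
    linarith
  have hρ2 : ρ < r2 := by
    have : ρ ≤ r2 / 2 := (min_le_right _ _).trans (min_le_right _ _)
    linarith
  have hcb : Metric.closedBall ν0 ρ ⊆ G.strip := (Metric.closedBall_subset_ball hρ2).trans hsub
  obtain ⟨z1, hz1, hmin⟩ := (isCompact_sphere ν0 ρ).exists_isMinOn
    (NormedSpace.sphere_nonempty.2 hρ.le)
    (f := fun z => ‖K.disc z‖) (han.continuousOn.norm.mono
      (Metric.sphere_subset_closedBall.trans hcb))
  set e := ‖K.disc z1‖ with he
  have hepos : 0 < e := by
    refine norm_pos_iff.2 (hball ⟨?_, ?_⟩)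
    · rw [Metric.mem_ball, Metric.mem_sphere.1 hz1]; exact hρ1
    · rintro rfl
      simp [hρ.ne] at hz1
  have hloc : TendstoUniformlyOn (fun n => (Kn n).disc) K.disc atTop (Metric.closedBall ν0 ρ) := by
    have : TendstoLocallyUniformlyOn (fun n => (Kn n).disc) K.disc atTop G.strip := by
      rw [isOpen_strip.tendstoLocallyUniformlyOn_iff_forall_tendsto]
      intro ν hν
      refine tendsto_of_seq_tendsto fun u hu => ?_
      have hn : Tendsto (fun k => (u k).1) atTop atTop := tendsto_fst.comp hu
      have hν2 : Tendsto (fun k => (u k).2) atTop (nhds ν) := tendsto_snd.comp hu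
      have l1 : Tendsto (fun k => K.disc (u k).2) atTop (nhds (K.disc ν)) :=
        tendsto_disc (Coef.Tends.const K) (Coef.Tends.const K.refl) hν2 hK hK' (fun _ => hK)
          (fun _ => hK') hν
      have l2 : Tendsto (fun k => (Kn (u k).1).disc (u k).2) atTop (nhds (K.disc ν)) :=
        tendsto_disc (hT.comp hn) (hT'.comp hn) hν2 hK hK' (fun k => hKn _)
          (fun k => hKn' _) hν
      exact (l1.prodMk_nhds l2).mono_right (nhds_le_uniformity (K.disc ν))
    exact (tendstoLocallyUniformlyOn_iff_tendstoUniformlyOn_of_compact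
      (isCompact_closedBall _ _)).1 (this.mono hcb)
  obtain ⟨n, hn⟩ := (Metric.tendstoUniformlyOn_iff.1 hloc (e / 8) (by positivity)).exists
  have hdiff := differentiableOn_disc (hKn n) (hKn' n)
  have hc0 : ‖(Kn n).disc ν0‖ < e / 8 := by
    have := hn ν0 (Metric.mem_closedBall_self hρ.le)
    rwa [hz, dist_zero_left] at this
  have hsph : ∀ z ∈ Metric.sphere ν0 ρ, e / 2 ≤ ‖(Kn n).disc z - (Kn n).disc ν0‖ := fun z hz' => by
    have a1 := hn z (Metric.sphere_subset_closedBall hz')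
    have a2 : e ≤ ‖K.disc z‖ := hmin hz'
    rw [dist_eq_norm] at a1
    have a3 := norm_sub_norm_le (K.disc z) (K.disc z - (Kn n).disc z)
    rw [sub_sub_cancel] at a3
    have a4 := norm_sub_norm_le ((Kn n).disc z) ((Kn n).disc ν0)
    linarith
  have himg := (hdiff.diffContOnCl_ball hcb).ball_subset_image_closedBall hρ hsph ?_
  · obtain ⟨z, hzb, hz0⟩ := himg (a := 0) (by
      rw [Metric.mem_ball, dist_zero_left]; linarith)
    refine ⟨n, z, hcb hzb, ?_, hz0⟩
    rw [← dist_eq_norm]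
    exact (Metric.mem_closedBall.1 hzb).trans (min_le_left _ _)
  · intro hcon
    have hcon : ∀ᶠ z in nhds ν0, (Kn n).disc z = (Kn n).disc ν0 := by
      filter_upwards [hcon] with z hz using not_not.1 hz
    have heq := (hdiff.analyticOnNhd isOpen_strip).eqOn_of_preconnected_of_eventuallyEq
      (analyticOnNhd_const (v := (Kn n).disc ν0)) isPreconnected_strip h0 hcon
    have := hsph z1 hz1
    rw [heq (hcb (Metric.sphere_subset_closedBall hz1)), sub_self, norm_zero] at this
    linarith

end Cert

theorem neg_of_hasDerivAt_nonneg {S S' : ℝ → ℝ} (hS : ∀ x, 0 ≤ x → HasDerivAt S (S' x) x)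
    (h0 : ∀ x, 0 ≤ x → 0 ≤ S' x) (hp : 0 < S' 0) (hs : ∀ δ > 0, ∀ X, ∃ T, X ≤ T ∧ 0 ≤ T ∧ S T ≤ δ) :
    S 0 < 0 := by
  have hm : MonotoneOn S (Set.Ici 0) := by
    refine monotoneOn_of_hasDerivWithinAt_nonneg (convex_Ici 0) (f' := S')
      (fun x hx => (hS x hx).continuousAt.continuousWithinAt) (fun x hx => ?_) (fun x hx => ?_)
    · rw [interior_Ici] at hx
      exact (hS x hx.le).hasDerivWithinAt
    · rw [interior_Ici] at hx
      exact h0 x hx.le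
  have hle : ∀ x, 0 ≤ x → S x ≤ 0 := fun x hx => le_of_forall_pos_le_add fun δ hδ => by
    obtain ⟨T, h1, h2, h3⟩ := hs δ hδ x
    linarith [hm (Set.mem_Ici.2 hx) (Set.mem_Ici.2 h2) h1]
  by_contra! hcon
  have hz : ∀ x ∈ Set.Ici (0:ℝ), S x = 0 := fun x hx =>
    le_antisymm (hle x hx) (hcon.trans (hm (Set.mem_Ici.2 le_rfl) hx hx))
  have h1 : HasDerivWithinAt S 0 (Set.Ici 0) 0 :=
    (hasDerivWithinAt_const (0:ℝ) (Set.Ici 0) (0:ℝ)).congr hz (hz 0 (Set.mem_Ici.2 le_rfl))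
  have := (uniqueDiffWithinAt_Ici (0:ℝ)).eq_deriv _ (hS 0 le_rfl).hasDerivWithinAt h1
  linarith

namespace Cert

variable {G : Cert} {K : Coef}

theorem dat_slope_re_neg (hK : G.Coercive K) {ν : ℂ} (hν : ν ∈ G.strip) :
    (K.dat 0 1 ν).2.2.2.re < 0 := by
  obtain ⟨Z, hZ, hf, h1, h2, h3⟩ := dat_spec hK 0 1 hν
  have hν' : |ν.re| ≤ G.α0 := le_of_lt hν
  choose! d hd hd' using fun x (hx : 0 ≤ x) => hasDerivAt_fl hK hν' hZ hx
  have := neg_of_hasDerivAt_nonneg (S := fun x => G.fl x (Z x)) (S' := d) hd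
    (fun x hx => (mul_nonneg G.c0_pos.le (K.en_nonneg x _)).trans (hd' x hx)) ?_ ?_
  · simpa [fl, h1, h2, G.g2_zero, ← h3] using this
  · refine lt_of_lt_of_le (mul_pos G.c0_pos ?_) (hd' 0 le_rfl)
    refine lt_of_lt_of_le ?_ (K.tot_le_en 0 _)
    by_contra! hcon
    have := Phase.eq_zero_of_tot _ hcon
    rw [this] at h2
    simp at h2
  · intro δ hδ X
    refine ⟨max X 0, le_max_left _ _, le_max_right _ _, ?_⟩
    exact (fl_nonpos hK hν' hZ hf (le_max_right _ _)).trans hδ.le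

/-- The slope of `u` for the half line solution with `u = 1`, `v' = 0` at the origin. -/
noncomputable def slope (K : Coef) (ν : ℂ) : ℂ :=
  (K.dat 1 0 ν).2.1 - (K.dat 1 0 ν).2.2.2 / (K.dat 0 1 ν).2.2.2 * (K.dat 0 1 ν).2.1

theorem dat_slope_ne (hK : G.Coercive K) {ν : ℂ} (hν : ν ∈ G.strip) :
    (K.dat 0 1 ν).2.2.2 ≠ 0 := fun h => by
  have := dat_slope_re_neg hK hν
  rw [h] at this
  simp at this

theorem slope_spec (hK : G.Coercive K) {ν : ℂ} (hν : ν ∈ G.strip) :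
    ∃ Z, K.IsSol ν Z ∧ K.FinEn Z ∧ (Z 0).1 = 1 ∧ (Z 0).2.1 = slope K ν ∧ (Z 0).2.2.2 = 0 := by
  have hne := dat_slope_ne hK hν
  set t := -((K.dat 1 0 ν).2.2.2 / (K.dat 0 1 ν).2.2.2) with ht
  obtain ⟨Z, hZ, hf, h1, h2, h3⟩ := dat_spec hK 1 t hν
  have l := dat_linear hK hν 1 t
  rw [← h3] at l
  refine ⟨Z, hZ, hf, h1, ?_, ?_⟩
  · simp only [l, Prod.snd_add, Prod.fst_add, Prod.smul_snd, Prod.smul_fst, smul_eq_mul, slope, ht]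
    ring
  · simp only [l, Prod.snd_add, Prod.smul_snd, smul_eq_mul, ht]
    field_simp
    ring

theorem continuousOn_slope (hK : G.Coercive K) : ContinuousOn (slope K) G.strip := by
  have a1 := (differentiableOn_dat hK 1 0).continuousOn
  have a2 := (differentiableOn_dat hK 0 1).continuousOn
  exact a1.snd.fst.sub ((a1.snd.snd.snd.div a2.snd.snd.snd fun ν hν => dat_slope_ne hK hν).mul
    a2.snd.fst)

theorem disc_eq_slope (hK : G.Coercive K) (hr : K.refl = K) {ν : ℂ} (hν : ν ∈ G.strip) :
    K.disc ν = 4 * (K.dat 0 1 ν).2.2.2 * slope K ν := by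
  have hne := dat_slope_ne hK hν
  rw [Coef.disc, hr, slope]
  field_simp
  ring

theorem imag_mem_strip (η : ℝ) : (η * Complex.I : ℂ) ∈ G.strip := by
  simp [strip, G.alpha_pos]

theorem slope_im (hK : G.Coercive K) (hc : ∀ x, K.c x = 0) (η : ℝ) :
    (slope K (η * Complex.I)).im = 0 := by
  obtain ⟨Z, hZ, hf, h1, h2, h3⟩ := slope_spec hK (imag_mem_strip η)
  set F : ℝ → ℝ := fun x => (Z x).1.re * (Z x).2.1.im - (Z x).1.im * (Z x).2.1.re
    + ((Z x).2.2.1.im * (Z x).2.2.2.re - (Z x).2.2.1.re * (Z x).2.2.2.im) with hF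
  have hd : ∀ x, HasDerivAt F 0 x := fun x => by
    obtain ⟨k1, k2, k3, k4, k5, k6, k7, k8⟩ := hZ.reals x
    refine (((k1.mul k4).sub (k2.mul k3)).add ((k6.mul k7).sub (k5.mul k8))).congr_deriv ?_
    simp only [hc, Complex.mul_re, Complex.mul_im, Complex.ofReal_re, Complex.ofReal_im,
      Complex.I_re, Complex.I_im]
    ring
  have hconst : ∀ x, F x = F 0 := fun x =>
    is_const_of_deriv_eq_zero (fun x => (hd x).differentiableAt) (fun x => (hd x).deriv) x 0
  have hF0 : F 0 = (slope K (η * Complex.I)).im := by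
    simp [hF, h1, h2, h3]
  rw [← hF0]
  have hsm : ∀ δ > 0, |F 0| ≤ δ := fun δ hδ => by
    obtain ⟨T, -, -, hT⟩ := hf.exists_small hZ.continuous hδ 0
    rw [← hconst T]
    refine le_trans ?_ hT
    simp only [hF, Phase.tot]
    rw [abs_le]
    constructor <;>
    nlinarith [sq_nonneg ((Z T).1.re - (Z T).2.1.im), sq_nonneg ((Z T).1.re + (Z T).2.1.im),
      sq_nonneg ((Z T).1.im - (Z T).2.1.re), sq_nonneg ((Z T).1.im + (Z T).2.1.re),
      sq_nonneg ((Z T).2.2.1.im - (Z T).2.2.2.re), sq_nonneg ((Z T).2.2.1.im + (Z T).2.2.2.re),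
      sq_nonneg ((Z T).2.2.1.re - (Z T).2.2.2.im), sq_nonneg ((Z T).2.2.1.re + (Z T).2.2.2.im)]
  exact abs_nonpos_iff.1 (le_of_forall_pos_le_add fun δ hδ => by linarith [hsm δ hδ])

theorem slope_zero_pos (hK : G.Coercive K) (hc : ∀ x, K.c x = 0) (hw : ∀ x, K.w x = 1)
    {e e' : ℝ → ℝ} {l : ℝ} (hl : 0 < l) (he : ∀ x, HasDerivAt e (e' x) x)
    (he' : ∀ x, HasDerivAt e' ((K.q1 x + l) * e x) x) (h0 : e 0 = 1) (h0' : e' 0 = 0)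
    (hlim : Tendsto e atTop (nhds 0)) (hlim' : Tendsto e' atTop (nhds 0)) :
    0 < (slope K 0).re := by
  have hs0 : (0:ℂ) ∈ G.strip := by simpa using imag_mem_strip (G := G) 0
  obtain ⟨Z, hZ, hf, h1, h2, h3⟩ := slope_spec hK hs0
  have hθ := G.θ_le
  have hθ' := G.θ_pos
  have hC := G.C_nonneg
  have := neg_of_hasDerivAt_nonneg
    (S := fun x => (Z x).1.re * (Z x).2.1.re - 2 * ((Z x).2.1.re * e x) + e x * e' x
      - (1 - G.θ) * (G.g1 x * ((Z x).1.re - e x) ^ 2))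
    (S' := fun x => ((Z x).2.1.re - e' x) ^ 2 + K.q1 x * ((Z x).1.re - e x) ^ 2 + l * e x ^ 2
      - (1 - G.θ) * (G.d1 x * ((Z x).1.re - e x) ^ 2
        + G.g1 x * (2 * ((Z x).1.re - e x) * ((Z x).2.1.re - e' x)))) ?_ ?_ ?_ ?_
  · simp only [h1, h2, h0, h0'] at this
    simp at this
    linarith
  · intro x hx
    obtain ⟨k1, k2, k3, -⟩ := hZ.reals x
    refine ((((k1.mul k3).sub ((k3.mul (he x)).const_mul 2)).add ((he x).mul (he' x))).sub
      (((G.h1 x hx).mul ((k1.sub (he x)).pow 2)).const_mul (1 - G.θ))).congr_deriv ?_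
    simp [hc]
    ring
  · intro x hx
    have q1 := hK.q1_ge x hx
    rw [hc, hw, abs_zero] at q1
    have := G.c0_pos
    have := G.alpha_pos
    have hW := K.one_le_W x
    generalize (Z x).1.re - e x = a
    generalize (Z x).2.1.re - e' x = b
    have q2 : (1 - G.θ) * (G.d1 x + G.g1 x ^ 2) ≤ K.q1 x := by nlinarith
    have := mul_le_mul_of_nonneg_right q2 (sq_nonneg a)
    have h4 := mul_nonneg (sub_nonneg.2 hθ) (sq_nonneg (b - G.g1 x * a))
    have h5 := mul_nonneg hθ'.le (sq_nonneg b)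
    have h6 := mul_nonneg hl.le (sq_nonneg (e x))
    linarith
  · simp only [h1, h0, h0']
    simpa using add_pos_of_nonneg_of_pos (sq_nonneg _) hl
  · intro δ hδ X
    set κ := δ / (4 * (2 + 2 * G.C)) with hκ
    have hκ0 : 0 < κ := by positivity
    obtain ⟨Y, hY⟩ := eventually_atTop.1 ((hlim.eventually (Metric.ball_mem_nhds 0 (sqrt_pos.2 hκ0))).and
      (hlim'.eventually (Metric.ball_mem_nhds 0 (sqrt_pos.2 hκ0))))
    obtain ⟨T, hT, hT0, hsm⟩ := hf.exists_small hZ.continuous hκ0 (max X Y)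
    obtain ⟨y1, y2⟩ := hY T ((le_max_right _ _).trans hT)
    refine ⟨T, (le_max_left _ _).trans hT, hT0, ?_⟩
    have sqb : ∀ y, y ∈ Metric.ball (0:ℝ) √κ → y ^ 2 ≤ κ := fun y hy => by
      rw [Metric.mem_ball, dist_zero_right, Real.norm_eq_abs] at hy
      rw [← sq_abs, ← sq_sqrt hκ0.le]
      exact pow_le_pow_left₀ (abs_nonneg _) hy.le 2
    have e1 := sqb _ y1
    have e2 := sqb _ y2
    have hg := abs_le.1 (G.b1 T hT0)
    have hU : (Z T).1.re ^ 2 + (Z T).2.1.re ^ 2 ≤ κ := by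
      refine le_trans ?_ hsm
      unfold Phase.tot
      nlinarith [sq_nonneg (Z T).1.im, sq_nonneg (Z T).2.1.im, sq_nonneg (Z T).2.2.1.re,
        sq_nonneg (Z T).2.2.1.im, sq_nonneg (Z T).2.2.2.re, sq_nonneg (Z T).2.2.2.im]
    generalize (Z T).1.re = a at *
    generalize (Z T).2.1.re = b at *
    have h6 : -((1 - G.θ) * (G.g1 T * (a - e T) ^ 2)) ≤ G.C * (2 * a ^ 2 + 2 * e T ^ 2) := by
      have m1 : -(G.g1 T * (a - e T) ^ 2) ≤ G.C * (a - e T) ^ 2 := by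
        nlinarith [sq_nonneg (a - e T)]
      have m2 : G.C * (a - e T) ^ 2 ≤ G.C * (2 * a ^ 2 + 2 * e T ^ 2) :=
        mul_le_mul_of_nonneg_left (by nlinarith [sq_nonneg (a + e T)]) hC
      have m3 : 0 ≤ G.C * (a - e T) ^ 2 := by positivity
      nlinarith
    have h7 : (2 + 2 * G.C) * (4 * κ) = δ := by rw [hκ]; field_simp
    have h8 : G.C * (2 * a ^ 2 + 2 * e T ^ 2) ≤ G.C * (4 * κ) :=
      mul_le_mul_of_nonneg_left (by nlinarith [sq_nonneg b]) hC
    nlinarith [sq_nonneg (a - b), sq_nonneg (b + e T), sq_nonneg (e T - e' T), sq_nonneg b,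
      sq_nonneg a]

theorem flux_bound {θ c0 B M η g d q1 q2 : ℝ} (hθ : θ ≤ 1) (hc0' : c0 ≤ θ)
    (hB0 : 0 ≤ B) (hM1 : 1 ≤ M) (hM2 : 1 + B ≤ M * c0) (hη : η = M * B + B + 1)
    (q3 : (1 - θ) * (d + g ^ 2) + c0 ≤ q2) (b1 : -B ≤ q1) (b2 : |q2| ≤ B)
    (a b a' b' s t s' t' : ℝ) :
    a ^ 2 + b ^ 2 ≤ M * (a' ^ 2 + b' ^ 2 + (s' ^ 2 + t' ^ 2) + q1 * (a ^ 2 + b ^ 2)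
      + q2 * (s ^ 2 + t ^ 2) - (1 - θ) * (d * (s ^ 2 + t ^ 2) + g * (2 * (s * s' + t * t'))))
      - (a' * t' - b' * s' + q2 * (a * t - b * s)) + η * (a ^ 2 + b ^ 2) := by
  have p1 : 0 ≤ (1 - θ) * ((s' - g * s) ^ 2 + (t' - g * t) ^ 2) :=
    mul_nonneg (sub_nonneg.2 hθ) (by positivity)
  have p2 : 0 ≤ (θ - c0) * (s' ^ 2 + t' ^ 2) :=
    mul_nonneg (sub_nonneg.2 hc0') (by positivity)
  have p3 := mul_le_mul_of_nonneg_right q3 (show 0 ≤ s ^ 2 + t ^ 2 by positivity)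
  have p4 := mul_le_mul_of_nonneg_right b1 (show 0 ≤ a ^ 2 + b ^ 2 by positivity)
  have r1 : c0 * (s' ^ 2 + t' ^ 2 + (s ^ 2 + t ^ 2)) + (a' ^ 2 + b' ^ 2) - B * (a ^ 2 + b ^ 2) ≤
      (a' ^ 2 + b' ^ 2) + (s' ^ 2 + t' ^ 2) + q1 * (a ^ 2 + b ^ 2) + q2 * (s ^ 2 + t ^ 2)
      - (1 - θ) * (d * (s ^ 2 + t ^ 2) + g * (2 * (s * s' + t * t'))) := by
    linarith
  have r2 := mul_le_mul_of_nonneg_left r1 (zero_le_one.trans hM1)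
  have cross : |a * t - b * s| ≤ (a ^ 2 + b ^ 2 + (s ^ 2 + t ^ 2)) / 2 := by
    clear * -
    rw [abs_le]
    constructor <;> linarith [sq_nonneg (a + t), sq_nonneg (a - t), sq_nonneg (b + s),
      sq_nonneg (b - s)]
  have r3 : q2 * (a * t - b * s) ≤ B * ((a ^ 2 + b ^ 2 + (s ^ 2 + t ^ 2)) / 2) := by
    refine (le_abs_self _).trans ?_
    rw [abs_mul]
    exact mul_le_mul b2 cross (abs_nonneg _) hB0
  have r4 : a' * t' - b' * s' ≤ (a' ^ 2 + b' ^ 2 + (s' ^ 2 + t' ^ 2)) / 2 := by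
    clear * -
    linarith [sq_nonneg (a' - t'), sq_nonneg (b' + s')]
  have r5 := mul_le_mul_of_nonneg_right hM2
    (show 0 ≤ s' ^ 2 + t' ^ 2 + (s ^ 2 + t ^ 2) by positivity)
  have r6 := mul_le_mul_of_nonneg_right hM1 (show 0 ≤ a' ^ 2 + b' ^ 2 by positivity)
  have r7 : 0 ≤ B * (s' ^ 2 + t' ^ 2) := by positivity
  have r8 : 0 ≤ B * (s ^ 2 + t ^ 2) := by positivity
  have r9 : 0 ≤ B * (a ^ 2 + b ^ 2) := by positivity
  rw [hη]
  linarith [sq_nonneg a', sq_nonneg b', sq_nonneg s, sq_nonneg t, sq_nonneg s', sq_nonneg t']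

theorem exists_slope_neg (hK : G.Coercive K) (hc : ∀ x, K.c x = 0) (hw : ∀ x, K.w x = 1)
    {B : ℝ} (hB : ∀ x, 0 ≤ x → |K.q1 x| ≤ B ∧ |K.q2 x| ≤ B) :
    ∃ η : ℝ, 0 < η ∧ (slope K (η * Complex.I)).re < 0 := by
  have hB0 : 0 ≤ B := (abs_nonneg _).trans (hB 0 le_rfl).1
  have hc0 := G.c0_pos
  set M := 1 + (1 + B) / G.c0 with hM
  have hM1 : 1 ≤ M := le_add_of_nonneg_right (by positivity)
  have hM2 : 1 + B ≤ M * G.c0 := by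
    rw [hM, add_mul, div_mul_cancel₀ _ hc0.ne']; linarith
  set η := M * B + B + 1 with hη
  have hη0 : 0 < η := by positivity
  refine ⟨η, hη0, ?_⟩
  obtain ⟨Z, hZ, hf, h1, h2, h3⟩ := slope_spec hK (imag_mem_strip η)
  have hθ := G.θ_le
  have hθ' := G.θ_pos
  have hC := G.C_nonneg
  have key : ∀ x, 0 ≤ x → (Z x).1.re ^ 2 + (Z x).1.im ^ 2 ≤
      M * (((Z x).2.1.re ^ 2 + (Z x).2.1.im ^ 2)
        + ((Z x).2.2.2.re ^ 2 + (Z x).2.2.2.im ^ 2)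
        + K.q1 x * ((Z x).1.re ^ 2 + (Z x).1.im ^ 2)
        + K.q2 x * ((Z x).2.2.1.re ^ 2 + (Z x).2.2.1.im ^ 2)
        - (1 - G.θ) * (G.d2 x * ((Z x).2.2.1.re ^ 2 + (Z x).2.2.1.im ^ 2)
          + G.g2 x * (2 * ((Z x).2.2.1.re * (Z x).2.2.2.re + (Z x).2.2.1.im * (Z x).2.2.2.im))))
      - ((Z x).2.1.re * (Z x).2.2.2.im - (Z x).2.1.im * (Z x).2.2.2.re
        + K.q2 x * ((Z x).1.re * (Z x).2.2.1.im - (Z x).1.im * (Z x).2.2.1.re))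
      + η * ((Z x).1.re ^ 2 + (Z x).1.im ^ 2) := fun x hx => by
    have q2 := hK.q2_ge x hx
    rw [hc, hw, abs_zero] at q2
    have hα := G.alpha_pos
    have hW := K.one_le_W x
    have q3 : (1 - G.θ) * (G.d2 x + G.g2 x ^ 2) + G.c0 ≤ K.q2 x := by nlinarith
    have b1 := (abs_le.1 (hB x hx).1).1
    have b2 := (hB x hx).2
    have hc0' := G.c0_le
    generalize (Z x).1.re = a
    generalize (Z x).1.im = b
    generalize (Z x).2.1.re = a'
    generalize (Z x).2.1.im = b'
    generalize (Z x).2.2.1.re = s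
    generalize (Z x).2.2.1.im = t
    generalize (Z x).2.2.2.re = s'
    generalize (Z x).2.2.2.im = t'
    exact flux_bound hθ hc0' hB0 hM1 hM2 hη q3 b1 b2 _ _ _ _ _ _ _ _
  have := neg_of_hasDerivAt_nonneg
    (S := fun x => M * ((Z x).1.re * (Z x).2.1.re + (Z x).1.im * (Z x).2.1.im
        + ((Z x).2.2.1.re * (Z x).2.2.2.re + (Z x).2.2.1.im * (Z x).2.2.2.im)
        - (1 - G.θ) * (G.g2 x * ((Z x).2.2.1.re ^ 2 + (Z x).2.2.1.im ^ 2)))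
      - ((Z x).1.re * (Z x).2.2.2.im - (Z x).1.im * (Z x).2.2.2.re))
    (S' := fun x => M * (((Z x).2.1.re ^ 2 + (Z x).2.1.im ^ 2)
        + ((Z x).2.2.2.re ^ 2 + (Z x).2.2.2.im ^ 2)
        + K.q1 x * ((Z x).1.re ^ 2 + (Z x).1.im ^ 2)
        + K.q2 x * ((Z x).2.2.1.re ^ 2 + (Z x).2.2.1.im ^ 2)
        - (1 - G.θ) * (G.d2 x * ((Z x).2.2.1.re ^ 2 + (Z x).2.2.1.im ^ 2)
          + G.g2 x * (2 * ((Z x).2.2.1.re * (Z x).2.2.2.re + (Z x).2.2.1.im * (Z x).2.2.2.im))))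
      - ((Z x).2.1.re * (Z x).2.2.2.im - (Z x).2.1.im * (Z x).2.2.2.re
        + K.q2 x * ((Z x).1.re * (Z x).2.2.1.im - (Z x).1.im * (Z x).2.2.1.re))
      + η * ((Z x).1.re ^ 2 + (Z x).1.im ^ 2)) ?_ ?_ ?_ ?_
  · simp only [h1, h2, h3, G.g2_zero] at this
    simp at this
    exact (pos_iff_neg_of_mul_neg this).1 (by linarith)
  · intro x hx
    obtain ⟨k1, k2, k3, k4, k5, k6, k7, k8⟩ := hZ.reals x
    refine ((((((k1.mul k3).add (k2.mul k4)).add ((k5.mul k7).add (k6.mul k8))).sub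
      (((G.h2 x hx).mul ((k5.pow 2).add (k6.pow 2))).const_mul (1 - G.θ))).const_mul M).sub
      ((k1.mul k8).sub (k2.mul k7))).congr_deriv ?_
    simp [hc, hw]
    ring
  · exact fun x hx => (by positivity : (0:ℝ) ≤ (Z x).1.re ^ 2 + (Z x).1.im ^ 2).trans (key x hx)
  · refine lt_of_lt_of_le ?_ (key 0 le_rfl)
    simp [h1]
  · intro δ hδ X
    obtain ⟨T, hT, hT0, hsm⟩ := hf.exists_small hZ.continuous
      (δ := δ / (M * (1 + G.C) + 1)) (by positivity) X
    refine ⟨T, hT, hT0, ?_⟩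
    rw [le_div_iff₀ (by positivity)] at hsm
    refine le_trans ?_ hsm
    have hg := abs_le.1 (G.b2 T hT0)
    unfold Phase.tot
    clear key hB
    generalize (Z T).1.re = a
    generalize (Z T).1.im = b
    generalize (Z T).2.1.re = a'
    generalize (Z T).2.1.im = b'
    generalize (Z T).2.2.1.re = s
    generalize (Z T).2.2.1.im = t
    generalize (Z T).2.2.2.re = s'
    generalize (Z T).2.2.2.im = t'
    have m1 : -(G.g2 T * (s ^ 2 + t ^ 2)) ≤ G.C * (s ^ 2 + t ^ 2) := by
      nlinarith [sq_nonneg s, sq_nonneg t]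
    have m3 : 0 ≤ G.C * (s ^ 2 + t ^ 2) := by positivity
    have m4 : -((1 - G.θ) * (G.g2 T * (s ^ 2 + t ^ 2))) ≤ G.C * (s ^ 2 + t ^ 2) := by nlinarith
    have m5 : 0 ≤ G.C * (a ^ 2 + b ^ 2 + (a' ^ 2 + b' ^ 2) + (s' ^ 2 + t' ^ 2)) := by positivity
    have m6 : a * a' + b * b' + (s * s' + t * t') - (1 - G.θ) * (G.g2 T * (s ^ 2 + t ^ 2)) ≤
        (1 + G.C) * (a ^ 2 + b ^ 2 + (a' ^ 2 + b' ^ 2) + (s ^ 2 + t ^ 2) + (s' ^ 2 + t' ^ 2)) := by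
      nlinarith [sq_nonneg (a - a'), sq_nonneg (b - b'), sq_nonneg (s - s'), sq_nonneg (t - t'),
        sq_nonneg a, sq_nonneg b, sq_nonneg s, sq_nonneg t, sq_nonneg a', sq_nonneg b',
        sq_nonneg s', sq_nonneg t']
    have m7 := mul_le_mul_of_nonneg_left m6 (zero_le_one.trans hM1)
    nlinarith [sq_nonneg (a + t'), sq_nonneg (b - s'), sq_nonneg a, sq_nonneg b, sq_nonneg s,
      sq_nonneg t, sq_nonneg a', sq_nonneg b', sq_nonneg s', sq_nonneg t']

/-- An even reference problem with `c = 0`, `w = 1` has a zero of its matching determinant on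
the positive imaginary axis. -/
theorem exists_disc_zero_imag (hK : G.Coercive K) (hr : K.refl = K) (hc : ∀ x, K.c x = 0)
    (hw : ∀ x, K.w x = 1) {B : ℝ} (hB : ∀ x, 0 ≤ x → |K.q1 x| ≤ B ∧ |K.q2 x| ≤ B)
    {e e' : ℝ → ℝ} {l : ℝ} (hl : 0 < l) (he : ∀ x, HasDerivAt e (e' x) x)
    (he' : ∀ x, HasDerivAt e' ((K.q1 x + l) * e x) x) (h0 : e 0 = 1) (h0' : e' 0 = 0)
    (hlim : Tendsto e atTop (nhds 0)) (hlim' : Tendsto e' atTop (nhds 0)) :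
    (∃ η : ℝ, 0 < η ∧ K.disc (η * Complex.I) = 0) ∧ K.disc 0 ≠ 0 := by
  have hpos := slope_zero_pos hK hc hw hl he he' h0 h0' hlim hlim'
  obtain ⟨η1, hη1, hneg⟩ := exists_slope_neg hK hc hw hB
  have hs0 : (0:ℂ) ∈ G.strip := by simpa using imag_mem_strip (G := G) 0
  refine ⟨?_, ?_⟩
  · have hcont : ContinuousOn (fun η : ℝ => (slope K (η * Complex.I)).re) (Set.Icc 0 η1) :=
      Complex.continuous_re.comp_continuousOn ((continuousOn_slope hK).comp
        (by fun_prop) fun η _ => imag_mem_strip η)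
    obtain ⟨η, hη, hz⟩ := intermediate_value_Icc' hη1.le hcont
      (show (0:ℝ) ∈ _ from ⟨hneg.le, by simpa using hpos.le⟩)
    refine ⟨η, lt_of_le_of_ne hη.1 ?_, ?_⟩
    · rintro rfl
      simp at hz
      exact hpos.ne' hz
    · rw [disc_eq_slope hK hr (imag_mem_strip η),
        Complex.ext (z := slope K (η * Complex.I)) (w := 0) hz (slope_im hK hc η), mul_zero]
  · rw [disc_eq_slope hK hr hs0]
    refine mul_ne_zero (mul_ne_zero (by norm_num) (dat_slope_ne hK hs0)) fun h => ?_
    rw [h] at hpos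
    simp at hpos

end Cert

theorem Real.hasDerivAt_tanh_mul (β x : ℝ) :
    HasDerivAt (fun x => tanh (β * x)) (β * (1 - tanh (β * x) ^ 2)) x := by
  have hc : cosh (β * x) ≠ 0 := (cosh_pos _).ne'
  have h := ((hasDerivAt_sinh (β * x)).div (hasDerivAt_cosh (β * x)) hc).comp x
    ((hasDerivAt_id x).const_mul β)
  have e : (fun x => tanh (β * x)) = (sinh / cosh) ∘ fun x => β * id x := by
    ext y; simp [tanh_eq_sinh_div_cosh]
  rw [e]
  refine h.congr_deriv ?_
  rw [tanh_eq_sinh_div_cosh]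
  field_simp

theorem Real.sq_mul_one_sub_tanh_sq_le (x : ℝ) : x ^ 2 * (1 - tanh x ^ 2) ≤ 1 := by
  have hc := cosh_pos x
  have h1 := cosh_sq x
  have h2 : x ^ 2 ≤ sinh x ^ 2 := by
    rw [sq_le_sq]
    rcases le_total 0 x with hx | hx
    · rw [abs_of_nonneg hx, abs_of_nonneg (sinh_nonneg_iff.2 hx)]
      exact self_le_sinh_iff.2 hx
    · rw [abs_of_nonpos hx, abs_of_nonpos (sinh_nonpos_iff.2 hx)]
      linarith [sinh_le_self_iff.2 hx]
  have h3 : 1 - tanh x ^ 2 = 1 / cosh x ^ 2 := by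
    rw [tanh_eq_sinh_div_cosh]; field_simp; linarith
  rw [h3, mul_one_div, div_le_one (by positivity)]
  linarith

theorem Real.tanh_pos_of_pos {x : ℝ} (h : 0 < x) : 0 < tanh x := by
  rw [tanh_eq_sinh_div_cosh]
  exact div_pos (sinh_pos_iff.2 h) (cosh_pos x)

theorem Real.tanh_mono : Monotone tanh := by
  refine monotone_of_hasDerivAt_nonneg (f' := fun x => 1 - tanh x ^ 2) (fun x => ?_) fun x => ?_
  · simpa using hasDerivAt_tanh_mul 1 x
  · exact (sub_pos.2 (tanh_sq_lt_one x)).le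

theorem Real.tanh_sq_shift_le {β x η : ℝ} (hβ : 0 ≤ β) (hη : 0 ≤ η) :
    |tanh (β * (x + η)) ^ 2 - tanh (β * x) ^ 2| ≤ 2 * β * η := by
  have hd : ∀ y, HasDerivAt (fun y => tanh (β * y) ^ 2)
      (2 * tanh (β * y) * (β * (1 - tanh (β * y) ^ 2))) y := fun y =>
    ((hasDerivAt_tanh_mul β y).pow 2).congr_deriv (by simp)
  have hb : ∀ y, ‖deriv (fun y => tanh (β * y) ^ 2) y‖ ≤ 2 * β := fun y => by
    rw [(hd y).deriv, norm_eq_abs, abs_mul, abs_mul, abs_mul, abs_of_nonneg hβ,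
      abs_of_pos (sub_pos.2 (tanh_sq_lt_one _)), abs_two]
    have := (abs_tanh_lt_one (β * y)).le
    have h2 : 1 - tanh (β * y) ^ 2 ≤ 1 := by linarith [sq_nonneg (tanh (β * y))]
    have h3 := sub_pos.2 (tanh_sq_lt_one (β * y))
    calc _ ≤ 2 * 1 * (β * 1) := by gcongr
      _ = _ := by ring
  have := Convex.norm_image_sub_le_of_norm_deriv_le (s := Set.univ) (x := x) (y := x + η)
    (fun y _ => (hd y).differentiableAt) (fun y _ => hb y) convex_univ trivial trivial
  simpa [abs_of_nonneg hη] using this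

namespace Vortex

/-- The limit of `ω r² / m²` at the peak of the profile. -/
noncomputable def ast (p : ℝ) : ℝ := 4 / (p - 1)

noncomputable def rate (p : ℝ) : ℝ := (p - 1) / 2 * √(1 + ast p)

/-- The limit of the rescaled potential. -/
noncomputable def pot (p x : ℝ) : ℝ := (p + 1) / 2 * (1 + ast p) * (1 - tanh (rate p * x) ^ 2)

variable {p : ℝ}

theorem ast_pos (hp : 1 < p) : 0 < ast p := div_pos (by norm_num) (by linarith)

theorem ast_mul (hp : 1 < p) : (p - 1) * ast p = 4 := by
  unfold ast; field_simp [(sub_pos.2 hp).ne']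

theorem rate_pos (hp : 1 < p) : 0 < rate p := by
  have := ast_pos hp
  have : 0 < p - 1 := by linarith
  unfold rate; positivity

theorem pot_nonneg (hp : 1 < p) (x : ℝ) : 0 ≤ pot p x := by
  have := ast_pos hp
  have := sub_pos.2 (tanh_sq_lt_one (rate p * x))
  unfold pot; positivity

theorem pot_le (hp : 1 < p) (x : ℝ) : pot p x ≤ (p + 1) / 2 * (1 + ast p) := by
  have := ast_pos hp
  unfold pot
  refine mul_le_of_le_one_right (by positivity) ?_
  linarith [sq_nonneg (tanh (rate p * x))]

theorem sq_mul_pot_le (hp : 1 < p) (x : ℝ) :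
    x ^ 2 * pot p x ≤ (p + 1) / 2 * (1 + ast p) / rate p ^ 2 := by
  have := ast_pos hp
  have h := sq_mul_one_sub_tanh_sq_le (rate p * x)
  have hr := rate_pos hp
  rw [le_div_iff₀ (by positivity)]
  unfold pot
  calc _ = (p + 1) / 2 * (1 + ast p) * ((rate p * x) ^ 2 * (1 - tanh (rate p * x) ^ 2)) := by ring
    _ ≤ _ := mul_le_of_le_one_right (by positivity) h

theorem pot_even (x : ℝ) : pot p (-x) = pot p x := by
  unfold pot; rw [mul_neg, tanh_neg, neg_sq]

theorem continuous_pot : Continuous (pot p) := by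
  have : Continuous fun x => tanh (rate p * x) :=
    continuous_iff_continuousAt.2 fun x => (hasDerivAt_tanh_mul (rate p) x).continuousAt
  unfold pot; fun_prop

section scalar

variable {e0 κ0 as θ Qm c0 δ a0 κ w y χ Q R : ℝ}

theorem near_ineq (he0 : 0 < e0) (h1 : 64 * e0 ≤ κ0 ^ 2) (hκ0 : 0 < κ0) (hκ0' : κ0 ≤ 1 / 2)
    (has : 0 < as) (hθ : 0 < θ) (hθ1 : θ ≤ 1) (hθQ : θ * Qm ≤ e0) (hc : 0 < c0)
    (hc0 : c0 * (2 * as + 4) ≤ e0) (hδ : 0 < δ) (hδ0 : δ * (p + 2 * as + 8) ≤ e0)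
    (ha0 : |a0 - as| ≤ δ) (hκ : |κ - κ0| ≤ δ) (hχ : 0 ≤ χ) (hχ1 : χ ≤ 1)
    (hy : y ≤ χ * (1 + as - Q + 2 * e0)) (hQ : 0 ≤ Q) (hQm : Q ≤ Qm) (hR : |R - Q| ≤ p * δ)
    (hw : |w - 1| ≤ δ) (hχQ : (1 - χ) * Q ≤ e0) :
    (1 - θ) * y + |2 * κ * (w - 1)| + e0 * w + c0 * (1 + a0 * w) ≤ 1 + κ ^ 2 + a0 * w - R := by
  obtain ⟨a1, a2⟩ := abs_le.1 ha0
  obtain ⟨k1, k2⟩ := abs_le.1 hκ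
  obtain ⟨r1, r2⟩ := abs_le.1 hR
  obtain ⟨w1, w2⟩ := abs_le.1 hw
  have e1 : e0 ≤ 1 / 256 := by nlinarith
  have d1 : 8 * δ ≤ e0 := by nlinarith
  have d2 : δ * p ≤ e0 := by nlinarith
  have d3 : δ * as ≤ e0 := by nlinarith
  have t1 : (1 - θ) * y ≤ 1 + as - Q + 4 * e0 := by
    have s1 : (1 - θ) * y ≤ (1 - θ) * (χ * (1 + as - Q + 2 * e0)) :=
      mul_le_mul_of_nonneg_left hy (by linarith)
    have s2 : 0 ≤ (1 - θ) * χ := mul_nonneg (by linarith) hχ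
    have s3 : (1 - θ) * χ ≤ 1 := by nlinarith
    have s4 : (1 - (1 - θ) * χ) * Q ≤ 2 * e0 := by
      have := mul_le_mul_of_nonneg_left ((mul_le_of_le_one_left hQ hχ1).trans hQm) hθ.le
      linarith
    have s5 := mul_nonneg (sub_nonneg.2 s3) (by linarith : 0 ≤ 1 + as + 2 * e0)
    linarith
  have t2 : |2 * κ * (w - 1)| ≤ e0 := by
    rw [abs_mul]
    have : |2 * κ| ≤ 2 := abs_le.2 ⟨by linarith, by linarith⟩
    calc _ ≤ 2 * δ := mul_le_mul this hw (abs_nonneg _) (by norm_num)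
      _ ≤ e0 := by linarith
  have t3 : e0 * w ≤ e0 * 2 := mul_le_mul_of_nonneg_left (by linarith) he0.le
  have t0 : |a0 * (w - 1)| ≤ (as + 1) * δ := by
    rw [abs_mul]
    exact mul_le_mul (abs_le.2 ⟨by linarith, by linarith⟩) hw (abs_nonneg _) (by linarith)
  obtain ⟨u1, u2⟩ := abs_le.1 t0
  have t4 : c0 * (1 + a0 * w) ≤ c0 * (2 * as + 4) :=
    mul_le_mul_of_nonneg_left (by linarith) hc.le
  have t7 := mul_le_mul_of_nonneg_left k1 hκ0.le
  have t8 := mul_le_mul_of_nonneg_right hκ0' hδ.le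
  have t9 := sq_nonneg (κ - κ0)
  linarith

theorem far_ineq (he0 : 0 < e0) (h1 : 64 * e0 ≤ κ0 ^ 2) (h2 : 64 * e0 ≤ as - 2 * κ0)
    (hκ0 : 0 < κ0) (hκ0' : κ0 ≤ 1 / 2)
    (hθ : 0 < θ) (hθ1 : θ ≤ 1) (hc : 0 < c0)
    (hc0 : c0 * (2 * as + 4) ≤ e0) (hδ : 0 < δ) (hδ0 : δ * (p + 2 * as + 8) ≤ e0)
    (ha0 : |a0 - as| ≤ δ) (hκ : |κ - κ0| ≤ δ) (hχ : 0 ≤ χ)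
    (hy : y ≤ χ * (1 + as - Q + 2 * e0)) (hQ : 0 ≤ Q) (hR : |R - Q| ≤ p * δ)
    (hw : 0 < w) (hχD : χ * (1 + as + 2 * e0) ≤ e0) (hQe : Q ≤ e0) :
    (1 - θ) * y + |2 * κ * (w - 1)| + e0 * w + c0 * (1 + a0 * w) ≤ 1 + κ ^ 2 + a0 * w - R := by
  obtain ⟨a1, a2⟩ := abs_le.1 ha0
  obtain ⟨k1, k2⟩ := abs_le.1 hκ
  obtain ⟨r1, r2⟩ := abs_le.1 hR
  have e1 : e0 ≤ 1 / 256 := by nlinarith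
  have d1 : 8 * δ ≤ e0 := by nlinarith
  have d2 : δ * p ≤ e0 := by nlinarith
  have t1 : (1 - θ) * y ≤ e0 := by
    have s1 : y ≤ e0 := hy.trans ((mul_le_mul_of_nonneg_left (by linarith) hχ).trans hχD)
    nlinarith
  have hκp : 0 ≤ κ := by nlinarith
  have c1 : c0 * a0 ≤ e0 := by nlinarith
  have c2 : c0 ≤ e0 := by nlinarith
  have c3 : c0 * a0 * w ≤ e0 * w := mul_le_mul_of_nonneg_right c1 hw.le
  rw [abs_mul, abs_of_nonneg (by linarith : 0 ≤ 2 * κ)]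
  rcases le_total 1 w with h | h
  · rw [abs_of_nonneg (by linarith : 0 ≤ w - 1)]
    have : 0 ≤ (a0 - 2 * κ - 2 * e0) * w := mul_nonneg (by linarith) hw.le
    nlinarith
  · rw [abs_of_nonpos (by linarith : w - 1 ≤ 0)]
    have : 0 ≤ (a0 + 2 * κ - 2 * e0) * w := mul_nonneg (by linarith) hw.le
    have : (1 / 4 : ℝ) ^ 2 ≤ (1 - κ) ^ 2 := by
      refine pow_le_pow_left₀ (by norm_num) (by linarith) 2
    nlinarith

end scalar

/-- The logarithmic derivative of the derivative of the ground state. -/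
noncomputable def riccati (p x : ℝ) : ℝ :=
  √(1 + ast p) * ((p - 1) / 2 / tanh (rate p * x) - (p + 1) / 2 * tanh (rate p * x))

theorem hasDerivAt_riccati (hp : 1 < p) {x : ℝ} (hx : 0 < x) :
    HasDerivAt (riccati p) (1 + ast p - p * pot p x - riccati p x ^ 2) x := by
  have ht : tanh (rate p * x) ≠ 0 := (Real.tanh_pos_of_pos (mul_pos (rate_pos hp) hx)).ne'
  have h := hasDerivAt_tanh_mul (rate p) x
  refine ((((hasDerivAt_const x ((p - 1) / 2)).div h ht).sub
    (h.const_mul ((p + 1) / 2))).const_mul (√(1 + ast p))).congr_deriv ?_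
  have hs : √(1 + ast p) ^ 2 = 1 + ast p := sq_sqrt (by linarith [ast_pos hp])
  unfold riccati pot
  have hr : rate p = (p - 1) / 2 * √(1 + ast p) := rfl
  generalize tanh (rate p * x) = t at *
  rw [hr]
  generalize √(1 + ast p) = s at *
  rw [← hs]
  field_simp
  ring

theorem abs_riccati_le (hp : 1 < p) {x η : ℝ} (hη : 0 < η) (hx : η ≤ x) :
    |riccati p x| ≤ √(1 + ast p) * ((p - 1) / 2 / tanh (rate p * η) + (p + 1) / 2) := by
  have hr := rate_pos hp
  have ht : 0 < tanh (rate p * η) := Real.tanh_pos_of_pos (mul_pos hr hη)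
  have hm : tanh (rate p * η) ≤ tanh (rate p * x) := tanh_mono (by gcongr)
  have hp' : 0 < p - 1 := by linarith
  have ht' := ht.trans_le hm
  rw [riccati, abs_mul, abs_of_nonneg (sqrt_nonneg _)]
  gcongr
  refine (abs_sub _ _).trans ?_
  rw [abs_of_pos (by positivity), abs_of_pos (by positivity)]
  gcongr
  exact mul_le_of_le_one_right (by positivity) (tanh_lt_one _).le

theorem hasDerivAt_cut (σ x : ℝ) : HasDerivAt (fun x => 1 / (1 + (σ * x) ^ 2))
    (-(2 * σ ^ 2 * x) / (1 + (σ * x) ^ 2) ^ 2) x := by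
  have h : HasDerivAt (fun x => 1 + (σ * x) ^ 2) (2 * σ ^ 2 * x) x :=
    ((((hasDerivAt_id x).const_mul σ).pow 2).const_add 1).congr_deriv (by simp; ring)
  exact ((hasDerivAt_const x (1:ℝ)).div h (by positivity)).congr_deriv (by simp)

theorem abs_deriv_cut_le {σ : ℝ} (hσ : 0 < σ) (x : ℝ) :
    |-(2 * σ ^ 2 * x) / (1 + (σ * x) ^ 2) ^ 2| ≤ σ * (1 / (1 + (σ * x) ^ 2)) := by
  rw [abs_div, abs_of_pos (show 0 < (1 + (σ * x) ^ 2) ^ 2 by positivity),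
    div_le_iff₀ (by positivity)]
  have : σ * (1 / (1 + (σ * x) ^ 2)) * (1 + (σ * x) ^ 2) ^ 2 = σ * (1 + (σ * x) ^ 2) := by
    field_simp
  rw [this, abs_le]
  constructor <;> nlinarith [mul_nonneg hσ.le (sq_nonneg (σ * x + 1)),
    mul_nonneg hσ.le (sq_nonneg (σ * x - 1))]

/-- Closeness of the coefficients on the right half line to those of the limit problem. -/
def Close (p κ0 δ X : ℝ) (K : Coef) : Prop :=
  ∃ a0 κ : ℝ, |a0 - ast p| ≤ δ ∧ |κ - κ0| ≤ δ ∧ ∀ x, 0 ≤ x → 0 < K.w x ∧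
    (|K.w x - 1| ≤ δ ∨ X ≤ x) ∧ |K.c x| = |2 * κ * (K.w x - 1)| ∧ K.W x = 1 + a0 * K.w x ∧
    ∃ P, |P - pot p x| ≤ δ ∧ K.q1 x = 1 + κ ^ 2 + a0 * K.w x - p * P ∧
      K.q2 x = 1 + κ ^ 2 + a0 * K.w x - P

theorem cut_bound {χ χ' γ γ' σ Γ e0 E : ℝ} (hχ : 0 ≤ χ) (hχ1 : χ ≤ 1) (hχ' : |χ'| ≤ σ * χ)
    (hγ : |γ| ≤ Γ) (hσ : σ * Γ ≤ e0) (hσ0 : 0 ≤ σ) (hE : γ' + γ ^ 2 ≤ E) :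
    χ' * γ + χ * γ' + (χ * γ) ^ 2 ≤ χ * (E + e0) := by
  have h1 : χ' * γ ≤ σ * χ * Γ := (le_abs_self _).trans (by
    rw [abs_mul]; exact mul_le_mul hχ' hγ (abs_nonneg _) (by positivity))
  have h2 : χ * γ' + (χ * γ) ^ 2 ≤ χ * (γ' + γ ^ 2) := by
    have := mul_nonneg (mul_nonneg hχ (sub_nonneg.2 hχ1)) (sq_nonneg γ)
    linarith
  have h3 := mul_le_mul_of_nonneg_left hE hχ
  have h4 := mul_le_mul_of_nonneg_left hσ hχ
  linarith

set_option maxHeartbeats 1600000 in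
theorem exists_cert (hp : 1 < p) {κ0 : ℝ} (hκ0 : 0 < κ0) (hκ0' : κ0 ≤ 1 / 2)
    (hκa : 2 * κ0 < ast p) :
    ∃ (G : Cert) (δ X : ℝ), 0 < δ ∧ 0 < X ∧ ∀ K, Close p κ0 δ X K → G.Coercive K := by
  have has := ast_pos hp
  have hr := rate_pos hp
  have hp0 : 0 < p := by linarith
  set Qm := p * ((p + 1) / 2 * (1 + ast p)) with hQm
  have hQm0 : 0 < Qm := by positivity
  set B2 := Qm / rate p ^ 2 with hB2
  have hB20 : 0 < B2 := by positivity
  set e0 := min (κ0 ^ 2) (ast p - 2 * κ0) / 64 with he0d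
  have he0 : 0 < e0 := div_pos (lt_min (by positivity) (by linarith)) (by norm_num)
  have h1 : 64 * e0 ≤ κ0 ^ 2 := by
    have := min_le_left (κ0 ^ 2) (ast p - 2 * κ0); linarith
  have h2 : 64 * e0 ≤ ast p - 2 * κ0 := by
    have := min_le_right (κ0 ^ 2) (ast p - 2 * κ0); linarith
  have he1 : e0 ≤ 1 := by nlinarith
  set η := e0 / (Qm * (2 * rate p)) with hη
  have hη0 : 0 < η := by positivity
  have hηQ : Qm * (2 * rate p * η) = e0 := by rw [hη]; field_simp
  set t0 := tanh (rate p * η) with ht0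
  have ht0p : 0 < t0 := Real.tanh_pos_of_pos (by positivity)
  set s := √(1 + ast p) with hs
  have hs2 : s ^ 2 = 1 + ast p := sq_sqrt (by positivity)
  have hs0 : 0 < s := sqrt_pos.2 (by positivity)
  set Γ := s * ((p - 1) / 2 / t0 + (p + 1) / 2) with hΓ
  have hsΓ : s ≤ Γ := by
    have : 0 < (p - 1) / 2 / t0 := div_pos (by linarith) ht0p
    rw [hΓ]; exact le_mul_of_one_le_right hs0.le (by linarith)
  have hΓ0 : 0 < Γ := hs0.trans_le hsΓ
  set σ := min (e0 / Γ) (min 1 (e0 / B2)) with hσ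
  have hσ0 : 0 < σ := by positivity
  have hσΓ : σ * Γ ≤ e0 := (le_div_iff₀ hΓ0).1 (min_le_left _ _)
  have hσB : σ ^ 2 * B2 ≤ e0 := by
    have a1 : σ ≤ 1 := (min_le_right _ _).trans (min_le_left _ _)
    have a2 : σ * B2 ≤ e0 := (le_div_iff₀ hB20).1 ((min_le_right _ _).trans (min_le_right _ _))
    nlinarith
  set θ := min 1 (e0 / Qm) with hθ
  have hθ0 : 0 < θ := by positivity
  have hθ1 : θ ≤ 1 := min_le_left _ _
  have hθQ : θ * Qm ≤ e0 := (le_div_iff₀ hQm0).1 (min_le_right _ _)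
  set c0 := min θ (e0 / (2 * ast p + 4)) with hc0
  have hc00 : 0 < c0 := by positivity
  have hc0a : c0 * (2 * ast p + 4) ≤ e0 := (le_div_iff₀ (by positivity)).1 (min_le_right _ _)
  set δ := e0 / (p + 2 * ast p + 8) with hδ
  have hδ0 : 0 < δ := by positivity
  have hδ1 : δ * (p + 2 * ast p + 8) ≤ e0 := (div_mul_cancel₀ _ (by positivity)).le
  set X2 := (1 + ast p + 2 * e0) / (e0 * σ ^ 2) + B2 / e0 with hX2
  have hX20 : 0 < X2 := by positivity
  set χ : ℝ → ℝ := fun x => 1 / (1 + (σ * x) ^ 2) with hχ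
  set χ' : ℝ → ℝ := fun x => -(2 * σ ^ 2 * x) / (1 + (σ * x) ^ 2) ^ 2 with hχ'
  have hχ0 : ∀ x, 0 ≤ χ x := fun x => by simp only [hχ]; positivity
  have hχ1 : ∀ x, χ x ≤ 1 := fun x => by
    simp only [hχ]; rw [div_le_one (by positivity)]; linarith [sq_nonneg (σ * x)]
  have hχd : ∀ x, |χ' x| ≤ σ * χ x := fun x => abs_deriv_cut_le hσ0 x
  have hγ1 : ∀ x, 0 ≤ x → |riccati p (x + η)| ≤ Γ := fun x hx =>
    abs_riccati_le hp hη0 (by linarith)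
  have hγ2 : ∀ x, |-(s * tanh (rate p * x))| ≤ Γ := fun x => by
    rw [abs_neg, abs_mul, abs_of_pos hs0]
    exact (mul_le_of_le_one_right hs0.le (abs_tanh_lt_one _).le).trans hsΓ
  have hbd : ∀ x γ, |γ| ≤ Γ → |χ x * γ| ≤ Γ := fun x γ h => by
    rw [abs_mul, abs_of_nonneg (hχ0 x)]
    exact (mul_le_of_le_one_left (abs_nonneg _) (hχ1 x)).trans h
  let G : Cert :=
    { g1 := fun x => χ x * riccati p (x + η)
      g2 := fun x => χ x * -(s * tanh (rate p * x))
      d1 := fun x => χ' x * riccati p (x + η)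
        + χ x * (1 + ast p - p * pot p (x + η) - riccati p (x + η) ^ 2)
      d2 := fun x => χ' x * -(s * tanh (rate p * x))
        + χ x * -(s * (rate p * (1 - tanh (rate p * x) ^ 2)))
      h1 := fun x hx => (hasDerivAt_cut σ x).mul
        ((hasDerivAt_riccati hp (by linarith : 0 < x + η)).comp_add_const x η)
      h2 := fun x hx => (hasDerivAt_cut σ x).mul ((hasDerivAt_tanh_mul (rate p) x).const_mul s).neg
      θ := θ
      c0 := c0
      α0 := e0
      C := Γ
      θ_pos := hθ0
      θ_le := hθ1
      c0_pos := hc00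
      c0_le := min_le_left _ _
      alpha_pos := he0
      b1 := fun x hx => hbd x _ (hγ1 x hx)
      b2 := fun x hx => hbd x _ (hγ2 x)
      g2_zero := by simp }
  have hfar : ∀ x, √X2 ≤ x → χ x * (1 + ast p + 2 * e0) ≤ e0 ∧ B2 ≤ e0 * x ^ 2 := fun x hx => by
    have hx2 : X2 ≤ x ^ 2 := by
      rw [← sq_sqrt hX20.le]; exact pow_le_pow_left₀ (sqrt_nonneg _) hx 2
    constructor
    · have : (1 + ast p + 2 * e0) / (e0 * σ ^ 2) ≤ x ^ 2 := by
        have : 0 < B2 / e0 := by positivity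
        linarith
      rw [div_le_iff₀ (by positivity)] at this
      simp only [hχ]
      rw [div_mul_eq_mul_div, div_le_iff₀ (by positivity)]
      nlinarith
    · have : B2 / e0 ≤ x ^ 2 := by
        have : 0 < (1 + ast p + 2 * e0) / (e0 * σ ^ 2) := by positivity
        linarith
      rw [div_le_iff₀ he0] at this
      linarith
  have hnear : ∀ x Q, 0 ≤ Q → x ^ 2 * Q ≤ B2 → (1 - χ x) * Q ≤ e0 := fun x Q hQ hx => by
    have e1 : 1 - χ x ≤ σ ^ 2 * x ^ 2 := by
      simp only [hχ]
      rw [sub_le_iff_le_add, ← sub_le_iff_le_add', le_div_iff₀ (by positivity)]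
      nlinarith [sq_nonneg (σ * x), sq_nonneg ((σ * x) ^ 2)]
    calc _ ≤ σ ^ 2 * x ^ 2 * Q := mul_le_mul_of_nonneg_right e1 hQ
      _ = σ ^ 2 * (x ^ 2 * Q) := by ring
      _ ≤ σ ^ 2 * B2 := by gcongr
      _ ≤ e0 := hσB
  have hy1 : ∀ x, 0 ≤ x → G.d1 x + G.g1 x ^ 2 ≤ χ x * (1 + ast p - p * pot p x + 2 * e0) :=
    fun x hx => by
    have hsh := (abs_le.1 (tanh_sq_shift_le (x := x) hr.le hη0.le)).2
    have : (1 + ast p - p * pot p (x + η) - riccati p (x + η) ^ 2) + riccati p (x + η) ^ 2 ≤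
        1 + ast p - p * pot p x + e0 := by
      have : p * pot p x - p * pot p (x + η) = Qm * (tanh (rate p * (x + η)) ^ 2
          - tanh (rate p * x) ^ 2) := by rw [hQm]; unfold pot; ring
      have := mul_le_mul_of_nonneg_left hsh hQm0.le
      linarith
    refine (cut_bound (hχ0 x) (hχ1 x) (hχd x) (hγ1 x hx) hσΓ hσ0.le this).trans_eq ?_
    ring
  have hy2 : ∀ x, 0 ≤ x → G.d2 x + G.g2 x ^ 2 ≤ χ x * (1 + ast p - pot p x + 2 * e0) :=
    fun x hx => by
    have : -(s * (rate p * (1 - tanh (rate p * x) ^ 2))) + (-(s * tanh (rate p * x))) ^ 2 ≤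
        1 + ast p - pot p x + e0 := by
      refine le_trans (le_of_eq ?_) (le_add_of_nonneg_right he0.le)
      have hr' : rate p = (p - 1) / 2 * s := rfl
      unfold pot
      rw [← hs2, hr']
      ring
    refine (cut_bound (hχ0 x) (hχ1 x) (hχd x) (hγ2 x) hσΓ hσ0.le this).trans_eq ?_
    ring
  have hB2p : ∀ x, x ^ 2 * (p * pot p x) ≤ B2 := fun x => by
    have := mul_le_mul_of_nonneg_left (sq_mul_pot_le hp x) hp0.le
    rw [hB2, hQm, mul_div_assoc]
    linarith
  have hB21 : ∀ x, x ^ 2 * pot p x ≤ B2 := fun x => by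
    refine le_trans ?_ (hB2p x)
    have := mul_nonneg (sq_nonneg x) (pot_nonneg hp x)
    nlinarith
  have hQmp : ∀ x, p * pot p x ≤ Qm := fun x => mul_le_mul_of_nonneg_left (pot_le hp x) hp0.le
  have hQ1 : ∀ x, pot p x ≤ Qm := fun x => by
    have := pot_nonneg hp x
    refine le_trans ?_ (hQmp x)
    nlinarith
  refine ⟨G, δ, √X2, hδ0, sqrt_pos.2 hX20, fun K ⟨a0, κ, ha0, hκ, hK⟩ => ⟨fun x hx => (hK x hx).1.le,
    fun x hx => ?_, fun x hx => ?_⟩⟩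
  · obtain ⟨hw, hor, hc, hW, P, hP, hq1, hq2⟩ := hK x hx
    rw [hc, hW, hq1]
    have hR : |p * P - p * pot p x| ≤ p * δ := by
      rw [← mul_sub, abs_mul, abs_of_pos hp0]; gcongr
    have hQ : 0 ≤ p * pot p x := mul_nonneg hp0.le (pot_nonneg hp x)
    rcases hor with h | h
    · exact near_ineq he0 h1 hκ0 hκ0' has hθ0 hθ1 hθQ hc00 hc0a hδ0 hδ1 ha0 hκ (hχ0 x) (hχ1 x)
        (hy1 x hx) hQ (hQmp x) hR h (hnear x _ hQ (hB2p x))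
    · have hx0 : 0 < x := (sqrt_pos.2 hX20).trans_le h
      have := le_of_mul_le_mul_left (((hB2p x).trans (hfar x h).2).trans_eq (mul_comm _ _))
        (by positivity : 0 < x ^ 2)
      exact far_ineq he0 h1 h2 hκ0 hκ0' hθ0 hθ1 hc00 hc0a hδ0 hδ1 ha0 hκ (hχ0 x)
        (hy1 x hx) hQ hR hw (hfar x h).1 this
  · obtain ⟨hw, hor, hc, hW, P, hP, hq1, hq2⟩ := hK x hx
    rw [hc, hW, hq2]
    have hR : |P - pot p x| ≤ p * δ := hP.trans (by nlinarith)
    have hQ : 0 ≤ pot p x := pot_nonneg hp x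
    rcases hor with h | h
    · exact near_ineq he0 h1 hκ0 hκ0' has hθ0 hθ1 hθQ hc00 hc0a hδ0 hδ1 ha0 hκ (hχ0 x) (hχ1 x)
        (hy2 x hx) hQ (hQ1 x) hR h (hnear x _ hQ (hB21 x))
    · have hx0 : 0 < x := (sqrt_pos.2 hX20).trans_le h
      have := le_of_mul_le_mul_left (((hB21 x).trans (hfar x h).2).trans_eq (mul_comm _ _))
        (by positivity : 0 < x ^ 2)
      exact far_ineq he0 h1 h2 hκ0 hκ0' hθ0 hθ1 hc00 hc0a hδ0 hδ1 ha0 hκ (hχ0 x)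
        (hy2 x hx) hQ hR hw (hfar x h).1 this

end Vortex

theorem Coef.tends_of_coefs {Kn : ℕ → Coef} {K : Coef}
    (h : ∀ S δ : ℝ, 0 < δ → ∀ᶠ n in atTop, ∀ x ∈ Set.Icc 0 S, |(Kn n).q1 x - K.q1 x| ≤ δ ∧
      |(Kn n).q2 x - K.q2 x| ≤ δ ∧ |(Kn n).c x - K.c x| ≤ δ ∧ |(Kn n).w x - K.w x| ≤ δ) :
    Coef.Tends Kn K := by
  intro S δ hδ
  set B := ‖Phase.proj1‖ + ‖Phase.proj2‖ + ‖Phase.cross‖ + 1 with hB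
  have h1 := norm_nonneg Phase.proj1
  have h2 := norm_nonneg Phase.proj2
  have h3 := norm_nonneg Phase.cross
  have hB0 : 0 < B := by positivity
  have hδB : δ / B * B = δ := div_mul_cancel₀ _ hB0.ne'
  have hδ' : 0 < δ / B := by positivity
  filter_upwards [h S (δ / B) hδ'] with n hn x hx
  obtain ⟨a1, a2, a3, a4⟩ := hn x hx
  have key : ∀ (a b : ℝ) (T : Phase →L[ℂ] Phase), |a - b| ≤ δ / B →
      ‖(a : ℂ) • T - (b : ℂ) • T‖ ≤ δ / B * ‖T‖ := fun a b T hab => by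
    have e : (a : ℂ) • T - (b : ℂ) • T = ((a - b : ℝ) : ℂ) • T := by
      rw [Complex.ofReal_sub]; exact (sub_smul _ _ _).symm
    rw [e, norm_smul, Complex.norm_real, norm_eq_abs]
    gcongr
  constructor
  · have e : (Kn n).A x - K.A x = (((Kn n).q1 x : ℂ) • Phase.proj1 - (K.q1 x : ℂ) • Phase.proj1)
        + (((Kn n).q2 x : ℂ) • Phase.proj2 - (K.q2 x : ℂ) • Phase.proj2)
        + (((Kn n).c x : ℂ) • Phase.cross - (K.c x : ℂ) • Phase.cross) := by
      unfold Coef.A; abel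
    rw [e]
    refine (norm_add₃_le).trans ?_
    have := key _ _ Phase.proj1 a1
    have := key _ _ Phase.proj2 a2
    have := key _ _ Phase.cross a3
    nlinarith
  · refine (key _ _ Phase.cross a4).trans ?_
    nlinarith

namespace Vortex

variable {p : ℝ}

/-- The limit problem. -/
noncomputable def refCoef (hp : 1 < p) (κ0 : ℝ) : Coef where
  q1 := fun x => 1 + κ0 ^ 2 + ast p - p * pot p x
  q2 := fun x => 1 + κ0 ^ 2 + ast p - pot p x
  c := fun _ => 0
  w := fun _ => 1
  W := fun _ => 1 + ast p
  q1_cont := by have := continuous_pot (p := p); fun_prop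
  q2_cont := by have := continuous_pot (p := p); fun_prop
  c_cont := continuous_const
  w_cont := continuous_const
  W_cont := continuous_const
  one_le_W := fun _ => by linarith [ast_pos hp]

theorem refCoef_refl (hp : 1 < p) (κ0 : ℝ) : (refCoef hp κ0).refl = refCoef hp κ0 := by
  simp only [Coef.refl, refCoef, pot_even]

theorem refCoef_close (hp : 1 < p) (κ0 : ℝ) {δ : ℝ} (hδ : 0 < δ) (X : ℝ) :
    Close p κ0 δ X (refCoef hp κ0) :=
  ⟨ast p, κ0, by simpa using hδ.le, by simpa using hδ.le, fun x _ =>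
    ⟨one_pos, Or.inl (by simpa [refCoef] using hδ.le), by simp [refCoef], by simp [refCoef], pot p x,
      by simpa using hδ.le, by simp [refCoef], by simp [refCoef]⟩⟩

theorem Close.mono {κ0 δ δ' X X' : ℝ} {K : Coef} (h : Close p κ0 δ X K) (hδ : δ ≤ δ')
    (hX : X' ≤ X) : Close p κ0 δ' X' K := by
  obtain ⟨a0, κ, h1, h2, h3⟩ := h
  refine ⟨a0, κ, h1.trans hδ, h2.trans hδ, fun x hx => ?_⟩
  obtain ⟨b1, b2, b3, b4, P, b5, b6⟩ := h3 x hx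
  exact ⟨b1, b2.imp (·.trans hδ) hX.trans, b3, b4, P, b5.trans hδ, b6⟩

theorem tends_of_close (hp : 1 < p) {κ0 : ℝ} (hκ0 : 0 < κ0) (hκ0' : κ0 ≤ 1 / 2) {Kn : ℕ → Coef}
    (h : ∀ δ X : ℝ, 0 < δ → ∀ᶠ n in atTop, Close p κ0 δ X (Kn n)) :
    Coef.Tends Kn (refCoef hp κ0) := by
  have has := ast_pos hp
  refine Coef.tends_of_coefs fun S δ hδ => ?_
  set δ' := min 1 (δ / (ast p + p + 4)) with hδ'
  have hδ0 : 0 < δ' := by positivity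
  have hδ1 : δ' ≤ 1 := min_le_left _ _
  have hδ2 : δ' * (ast p + p + 4) ≤ δ := (le_div_iff₀ (by positivity)).1 (min_le_right _ _)
  have hap := mul_pos hδ0 has
  have hpp : 0 < δ' * p := by positivity
  filter_upwards [h δ' (S + 1) hδ0] with n hn x hx
  obtain ⟨a0, κ, h1, h2, h3⟩ := hn
  obtain ⟨-, b2, b3, -, P, b5, b6, b7⟩ := h3 x hx.1
  have b2 := b2.resolve_right (by linarith [hx.2])
  obtain ⟨a1, a2⟩ := abs_le.1 h1
  obtain ⟨k1, k2⟩ := abs_le.1 h2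
  obtain ⟨w1, w2⟩ := abs_le.1 b2
  obtain ⟨p1, p2⟩ := abs_le.1 b5
  have hκ2 : |κ ^ 2 - κ0 ^ 2| ≤ 2 * δ' := by
    rw [show κ ^ 2 - κ0 ^ 2 = (κ - κ0) * (κ + κ0) by ring, abs_mul, mul_comm]
    refine mul_le_mul ?_ h2 (abs_nonneg _) (by norm_num)
    rw [abs_le]; constructor <;> linarith
  obtain ⟨s1, s2⟩ := abs_le.1 hκ2
  have haw : |a0 * (Kn n).w x - ast p| ≤ δ' * (ast p + 2) := by
    have e : a0 * (Kn n).w x - ast p = (a0 - ast p) * ((Kn n).w x) + ast p * ((Kn n).w x - 1) := by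
      ring
    rw [e]
    refine (abs_add_le _ _).trans ?_
    rw [abs_mul, abs_mul, abs_of_pos has]
    have : |(Kn n).w x| ≤ 2 := by rw [abs_le]; constructor <;> linarith
    have := mul_le_mul h1 this (abs_nonneg _) hδ0.le
    have := mul_le_mul_of_nonneg_left b2 has.le
    linarith
  obtain ⟨v1, v2⟩ := abs_le.1 haw
  have hpP : |p * (P - pot p x)| ≤ δ' * p := by
    rw [abs_mul, abs_of_pos (by linarith : 0 < p), mul_comm]
    gcongr
  obtain ⟨u1, u2⟩ := abs_le.1 hpP
  refine ⟨?_, ?_, ?_, ?_⟩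
  · rw [b6, abs_le]
    simp only [refCoef]
    constructor <;> linarith
  · rw [b7, abs_le]
    simp only [refCoef]
    constructor <;> nlinarith
  · simp only [refCoef]
    rw [sub_zero, b3, abs_mul, abs_mul, abs_two]
    have : |κ| ≤ 2 := by rw [abs_le]; constructor <;> linarith
    have := mul_le_mul this b2 (abs_nonneg _) (by norm_num)
    linarith
  · simp only [refCoef]
    linarith

/-- The exponential profile `cosh ^ (-(p + 1) / (p - 1))`. -/
noncomputable def bump (p x : ℝ) : ℝ := exp (-((p + 1) / (p - 1) * log (cosh (rate p * x))))

theorem hasDerivAt_bump (hp : 1 < p) (x : ℝ) :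
    HasDerivAt (bump p) (-((p + 1) / 2 * √(1 + ast p) * tanh (rate p * x)) * bump p x) x := by
  have h : HasDerivAt (fun x => cosh (rate p * x)) (sinh (rate p * x) * rate p) x := by
    simpa [Function.comp_def] using
      (hasDerivAt_cosh (rate p * x)).comp x ((hasDerivAt_id x).const_mul (rate p))
  refine (((h.log (cosh_pos _).ne').const_mul ((p + 1) / (p - 1))).neg.exp).congr_deriv ?_
  rw [mul_comm, bump, tanh_eq_sinh_div_cosh]
  have := cosh_pos (rate p * x)
  have hp' : p - 1 ≠ 0 := by linarith
  congr 1
  generalize hy : rate p * x = y at *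
  rw [rate]
  field_simp

theorem tendsto_bump (hp : 1 < p) : Tendsto (bump p) atTop (nhds 0) := by
  have hr := rate_pos hp
  have hp' : 0 < p - 1 := by linarith
  have hk : 0 < (p + 1) / (p - 1) := by positivity
  refine tendsto_exp_neg_atTop_nhds_zero.comp (Tendsto.const_mul_atTop hk ?_)
  refine tendsto_atTop_mono (f := fun x => rate p * x - log 2) (fun x => ?_)
    (tendsto_atTop_add_const_right _ _ (tendsto_id.const_mul_atTop hr))
  rw [le_log_iff_exp_le (cosh_pos _), exp_sub, exp_log two_pos, cosh_eq]
  linarith [exp_pos (-(rate p * x))]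

/-- Coefficients close to the limit problem admit an exponentially growing mode. -/
theorem exists_unstable_sol (hp : 1 < p) {κ0 : ℝ} (hκ0 : 0 < κ0) (hκ0' : κ0 ≤ 1 / 2)
    (hκa : 2 * κ0 < ast p) :
    ∃ δ X : ℝ, 0 < δ ∧ ∀ K : Coef, Close p κ0 δ X K → Close p κ0 δ X K.refl →
      ∃ (ν : ℂ) (Z : ℝ → Phase), 0 < ν.im ∧ K.IsSol ν Z ∧ Z 0 ≠ 0 ∧ K.FinEn Z ∧
        K.refl.FinEn (fun x => Z (-x)) := by
  have has := ast_pos hp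
  obtain ⟨G, δ, X, hδ, -, hG⟩ := exists_cert hp hκ0 hκ0' hκa
  have hK := hG _ (refCoef_close hp κ0 hδ X)
  set s := √(1 + ast p) with hs
  have hs2 : s ^ 2 = 1 + ast p := sq_sqrt (by positivity)
  have hr : rate p = (p - 1) / 2 * s := rfl
  obtain ⟨⟨η, hη, hz⟩, hnz⟩ := Cert.exists_disc_zero_imag hK (refCoef_refl hp κ0) (fun _ => rfl)
    (fun _ => rfl) (B := 1 + κ0 ^ 2 + ast p + p * ((p + 1) / 2 * (1 + ast p)))
    (fun x _ => by
      have h1 := pot_nonneg hp x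
      have h2 := pot_le hp x
      have h3 := mul_le_mul_of_nonneg_left h2 (by linarith : 0 ≤ p)
      have h4 : pot p x ≤ p * pot p x := by nlinarith
      have h5 := sq_nonneg κ0
      simp only [refCoef]
      constructor <;> rw [abs_le] <;> constructor <;> linarith)
    (e := bump p) (e' := fun x => -((p + 1) / 2 * s * tanh (rate p * x)) * bump p x)
    (l := ((p + 1) ^ 2 / 4 - 1) * (1 + ast p) - κ0 ^ 2)
    (by
      have : ((p + 1) ^ 2 / 4 - 1) * (1 + ast p) = (p + 3) ^ 2 / 4 := by
        linear_combination (p + 3) / 4 * ast_mul hp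
      rw [this]; nlinarith)
    (hasDerivAt_bump hp)
    (fun x => by
      refine ((((hasDerivAt_tanh_mul (rate p) x).const_mul ((p + 1) / 2 * s)).neg).mul
        (hasDerivAt_bump hp x)).congr_deriv ?_
      simp only [refCoef, pot, ← hs, hr, Pi.neg_apply]
      rw [← hs2]
      have : ast p = s ^ 2 - 1 := by linarith
      rw [this]
      ring)
    (by simp [bump]) (by simp)
    (tendsto_bump hp)
    (squeeze_zero_norm (a := fun x => (p + 1) / 2 * s * ‖bump p x‖) (fun x => by
      rw [norm_mul, norm_neg, norm_mul, norm_eq_abs (tanh _), norm_of_nonneg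
        (by have := sqrt_nonneg (1 + ast p); positivity : 0 ≤ (p + 1) / 2 * s)]
      refine mul_le_mul_of_nonneg_right (mul_le_of_le_one_right
        (by have := sqrt_nonneg (1 + ast p); positivity) (abs_tanh_lt_one _).le) (norm_nonneg _))
      (by simpa using ((tendsto_bump hp).norm.const_mul ((p + 1) / 2 * s))))
  by_contra! hcon
  have hd : ∀ n : ℕ, 0 < δ / (n + 1) := fun n => by positivity
  choose Kn hKn hKn' hno using fun n : ℕ => hcon (δ / (n + 1)) (X + n) (hd n)
  have hle : ∀ n : ℕ, δ / (n + 1) ≤ δ := fun n => div_le_self hδ.le (by linarith [n.cast_nonneg (α := ℝ)])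
  have hev : ∀ F : ℕ → Coef, (∀ n : ℕ, Close p κ0 (δ / (n + 1)) (X + n) (F n)) →
      ∀ δ' X' : ℝ, 0 < δ' → ∀ᶠ n in atTop, Close p κ0 δ' X' (F n) := fun F hF δ' X' hδ' => by
    have t1 : ∀ᶠ n : ℕ in atTop, δ / δ' + (X' - X) + 0 ≤ n ∧ δ / δ' ≤ n ∧ X' - X ≤ n :=
      (tendsto_natCast_atTop_atTop.eventually_ge_atTop _).and
        ((tendsto_natCast_atTop_atTop.eventually_ge_atTop _).and
          (tendsto_natCast_atTop_atTop.eventually_ge_atTop _))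
    filter_upwards [t1] with n hn
    refine (hF n).mono ?_ (by linarith [hn.2.2])
    rw [div_le_iff₀ (by positivity)]
    have := (div_le_iff₀ hδ').1 hn.2.1
    nlinarith
  obtain ⟨n, z, hzs, hzη, hz0⟩ := Cert.exists_disc_eq_zero (G := G) (Kn := Kn)
    (tends_of_close hp hκ0 hκ0' (hev _ hKn))
    (by rw [refCoef_refl]; exact tends_of_close hp hκ0 hκ0' (hev _ hKn'))
    hK (by rwa [refCoef_refl])
    (fun n => hG _ ((hKn n).mono (hle n) (by simp))) (fun n => hG _ ((hKn' n).mono (hle n) (by simp)))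
    (Cert.imag_mem_strip η) (by simpa using Cert.imag_mem_strip (G := G) 0) hz hnz (half_pos hη)
  have him : 0 < z.im := by
    have h1 := (Complex.abs_im_le_norm (z - η * Complex.I)).trans hzη
    have h2 := (abs_le.1 h1).1
    simp at h2
    linarith
  obtain ⟨Z, hZ, hZ0, hf, hf'⟩ := Cert.exists_global_sol (hG _ ((hKn n).mono (hle n) (by simp)))
    (hG _ ((hKn' n).mono (hle n) (by simp))) hzs hz0
  exact hno n z Z him hZ hZ0 hf hf'

end Vortex

theorem le_of_hasDerivAt_nonneg {f f' : ℝ → ℝ} {x y : ℝ} (hxy : x ≤ y)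
    (hf : ∀ t, HasDerivAt f (f' t) t) (h : ∀ t ∈ Set.Icc x y, 0 ≤ f' t) : f x ≤ f y := by
  refine monotoneOn_of_deriv_nonneg (convex_Icc x y)
    (fun t _ => (hf t).continuousAt.continuousWithinAt)
    (fun t _ => (hf t).differentiableAt.differentiableWithinAt) (fun t ht => ?_)
    (Set.left_mem_Icc.2 hxy) (Set.right_mem_Icc.2 hxy) hxy
  rw [(hf t).deriv]
  exact h t (interior_subset ht)

theorem le_of_hasDerivAt_nonpos {f f' : ℝ → ℝ} {x y : ℝ} (hxy : x ≤ y)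
    (hf : ∀ t, HasDerivAt f (f' t) t) (h : ∀ t ∈ Set.Icc x y, f' t ≤ 0) : f y ≤ f x := by
  have := le_of_hasDerivAt_nonneg hxy (fun t => (hf t).neg) fun t ht => neg_nonneg.2 (h t ht)
  simpa using this

/-- A function that decreases at a definite rate while its modulus is at most `1 / 2`. -/
theorem le_of_steep {g g' : ℝ → ℝ} {c v s : ℝ} (hc : 0 < c) (hg : ∀ x, HasDerivAt g (g' x) x)
    (h : ∀ x, |g x| ≤ 1 / 2 → g' x < -c) (hv : |v| ≤ 1 / 2) (hs : g s ≤ v) :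
    (∀ x ∈ Set.Icc s (s + (v + 1 / 2) / c), g x ≤ v - c * (x - s)) ∧
      ∀ x, s + (v + 1 / 2) / c ≤ x → g x ≤ -(1 / 2) := by
  obtain ⟨v1, v2⟩ := abs_le.1 hv
  have hle : s ≤ s + (v + 1 / 2) / c := by
    have : 0 ≤ (v + 1 / 2) / c := div_nonneg (by linarith) hc.le
    linarith
  have H : ∀ x ∈ Set.Icc s (s + (v + 1 / 2) / c), g x ≤ v - c * (x - s) := by
    refine image_le_of_deriv_right_lt_deriv_boundary (f' := g') (B' := fun _ => -c)
      (fun t _ => (hg t).continuousAt.continuousWithinAt) (fun t _ => (hg t).hasDerivWithinAt)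
      (by simpa using hs)
      (fun x => ((((hasDerivAt_id x).sub_const s).const_mul c).const_sub v).congr_deriv (by simp))
      fun x hx hx' => h x ?_
    have h1 : x - s ≤ (v + 1 / 2) / c := by linarith [hx.2]
    rw [le_div_iff₀ hc] at h1
    rw [hx', abs_le]
    constructor <;> nlinarith [mul_nonneg hc.le (sub_nonneg.2 hx.1)]
  refine ⟨H, fun x hx => ?_⟩
  refine image_le_of_deriv_right_lt_deriv_boundary (f' := g') (B := fun _ => -(1 / 2))
    (B' := fun _ => 0) (a := s + (v + 1 / 2) / c) (b := x)
    (fun t _ => (hg t).continuousAt.continuousWithinAt) (fun t _ => (hg t).hasDerivWithinAt)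
    ?_ (fun x => hasDerivAt_const _ _) (fun x _ hx' => ?_) ⟨hx, le_rfl⟩
  · refine (H _ ⟨hle, le_rfl⟩).trans_eq ?_
    field_simp; ring
  · refine (h x ?_).trans (neg_lt_zero.2 hc)
    rw [hx']; norm_num

namespace Vortex

variable {p : ℝ}

/-- `ω r² / m²` in the logarithmic variable. -/
noncomputable def lev (p ε a0 x : ℝ) : ℝ := a0 * exp ((p + 3) * ε * x)

theorem hasDerivAt_lev (p ε a0 x : ℝ) :
    HasDerivAt (lev p ε a0) ((p + 3) * ε * lev p ε a0 x) x :=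
  ((((hasDerivAt_id x).const_mul ((p + 3) * ε)).exp).const_mul a0).congr_deriv (by
    simp [lev]; ring)

/-- The rescaled profile equations in the logarithmic variable: `P` is the potential, `G` the
shifted logarithmic derivative and `Y` the weighted square of the profile. -/
structure Prof (p ε a0 : ℝ) (P G Y : ℝ → ℝ) : Prop where
  a_pos : 0 < a0
  P_pos : ∀ x, 0 < P x
  Y_pos : ∀ x, 0 < Y x
  hP : ∀ x, HasDerivAt P (P x * ((p - 1) * G x + 4 * ε)) x
  hG : ∀ x, HasDerivAt G (1 - ε ^ 2 + lev p ε a0 x - P x - G x ^ 2 + 2 * ε * G x) x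
  hY : ∀ x, HasDerivAt Y ((2 * G x - 4 * ε) * Y x) x
  hbot : Tendsto (fun x => ((G x ^ 2 - (1 - ε ^ 2 + lev p ε a0 x)) / 2 + P x / (p + 1)) * Y x)
    atBot (nhds 0)
  htop : Tendsto (fun x => ((G x ^ 2 - (1 - ε ^ 2 + lev p ε a0 x)) / 2 + P x / (p + 1)) * Y x)
    atTop (nhds 0)
  exists_le : ∃ x, G x ≤ 1 / 2
  exists_ge : ∃ x, -(1 / 2) ≤ G x

namespace Prof

variable {ε a0 : ℝ} {P G Y : ℝ → ℝ}

theorem shift (F : Prof p ε a0 P G Y) (t : ℝ) : Prof p ε (lev p ε a0 t) (fun x => P (x + t))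
    (fun x => G (x + t)) (fun x => Y (x + t)) := by
  have hl : ∀ x, lev p ε (lev p ε a0 t) x = lev p ε a0 (x + t) := fun x => by
    simp only [lev]; rw [mul_assoc, ← exp_add]; ring_nf
  refine ⟨mul_pos F.a_pos (exp_pos _), fun x => F.P_pos _, fun x => F.Y_pos _,
    fun x => (F.hP _).comp_add_const x t, fun x => ?_, fun x => (F.hY _).comp_add_const x t,
    ?_, ?_, ?_, ?_⟩
  · rw [hl]; exact (F.hG _).comp_add_const x t
  · simp only [hl]; exact F.hbot.comp (tendsto_atBot_add_const_right _ t tendsto_id)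
  · simp only [hl]; exact F.htop.comp (tendsto_atTop_add_const_right _ t tendsto_id)
  · obtain ⟨x, hx⟩ := F.exists_le; exact ⟨x - t, by simpa using hx⟩
  · obtain ⟨x, hx⟩ := F.exists_ge; exact ⟨x - t, by simpa using hx⟩

/-- The defect of the first integral. -/
noncomputable def defect (p ε a0 : ℝ) (P G : ℝ → ℝ) (x : ℝ) : ℝ :=
  (G x ^ 2 - (1 - ε ^ 2 + lev p ε a0 x)) / 2 + P x / (p + 1)

theorem lev_pos (F : Prof p ε a0 P G Y) (x : ℝ) : 0 < lev p ε a0 x := mul_pos F.a_pos (exp_pos _)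

theorem P_eq (hp : 1 < p) (x : ℝ) :
    P x = (p + 1) / 2 * (1 - ε ^ 2 + lev p ε a0 x - G x ^ 2 + 2 * defect p ε a0 P G x) := by
  have : p + 1 ≠ 0 := by linarith
  unfold defect; field_simp; ring

theorem hasDerivAt_defect (F : Prof p ε a0 P G Y) (hp : 1 < p) (x : ℝ) :
    HasDerivAt (defect p ε a0 P G) ((4 * ε - 2 * G x) * defect p ε a0 P G x
      + ε * ((p - 1) / 2) * (ast p * (1 - ε ^ 2) - lev p ε a0 x)) x := by
  have : p + 1 ≠ 0 := by linarith
  have hp' : p - 1 ≠ 0 := by linarith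
  refine (((((F.hG x).pow 2).sub ((hasDerivAt_lev p ε a0 x).const_add (1 - ε ^ 2))).div_const
    2).add ((F.hP x).div_const (p + 1))).congr_deriv ?_
  unfold defect ast
  simp
  field_simp
  ring

theorem hasDerivAt_defect_mul (F : Prof p ε a0 P G Y) (hp : 1 < p) (x : ℝ) :
    HasDerivAt (fun x => defect p ε a0 P G x * Y x)
      (ε * ((p - 1) / 2) * (ast p * (1 - ε ^ 2) - lev p ε a0 x) * Y x) x :=
  ((F.hasDerivAt_defect hp x).mul (F.hY x)).congr_deriv (by ring)

theorem defect_nonneg (F : Prof p ε a0 P G Y) (hp : 1 < p) (hε : 0 < ε) (x : ℝ) :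
    0 ≤ defect p ε a0 P G x := by
  have hp' : 0 < p - 1 := by linarith
  have hmono : Monotone (lev p ε a0) := fun s t hst => by
    have := F.a_pos
    have : 0 < p + 3 := by linarith
    unfold lev; gcongr
  refine nonneg_of_mul_nonneg_left ?_ (F.Y_pos x)
  rcases le_total (lev p ε a0 x) (ast p * (1 - ε ^ 2)) with h | h
  · refine le_of_tendsto F.hbot ?_
    filter_upwards [eventually_le_atBot x] with t ht
    refine le_of_hasDerivAt_nonneg ht (F.hasDerivAt_defect_mul hp) fun y hy => ?_
    have := (hmono hy.2).trans h
    exact mul_nonneg (mul_nonneg (by positivity) (sub_nonneg.2 this)) (F.Y_pos y).le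
  · refine le_of_tendsto F.htop ?_
    filter_upwards [eventually_ge_atTop x] with t ht
    refine le_of_hasDerivAt_nonpos ht (F.hasDerivAt_defect_mul hp) fun y hy => ?_
    have := h.trans (hmono hy.1)
    exact mul_nonpos_of_nonpos_of_nonneg (mul_nonpos_of_nonneg_of_nonpos (by positivity)
      (sub_nonpos.2 this)) (F.Y_pos y).le

section small

variable (F : Prof p ε a0 P G Y) (hp : 1 < p) (hε : 0 < ε) (h1 : 8 * ((p + 3) * ε) ≤ p - 1)
  (h2 : 2 * ((p + 3) * ε) ≤ 1)

include F hp hε h1 h2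

theorem steep (x : ℝ) (hx : |G x| ≤ 1 / 2) :
    1 - ε ^ 2 + lev p ε a0 x - P x - G x ^ 2 + 2 * ε * G x < -((p - 1) / 8) := by
  have hk := F.defect_nonneg hp hε x
  have hP := P_eq (P := P) (G := G) (ε := ε) (a0 := a0) hp x
  have ha := F.lev_pos x
  have he : ε ≤ 1 / 8 := by nlinarith
  have he' : 32 * ε ≤ p - 1 := by nlinarith
  have hG2 : G x ^ 2 ≤ 1 / 4 := by
    have := pow_le_pow_left₀ (abs_nonneg _) hx 2
    rw [sq_abs] at this; linarith
  have hGl := (abs_le.1 hx).2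
  set k := defect p ε a0 P G x
  have e : 1 - ε ^ 2 + lev p ε a0 x - P x - G x ^ 2 + 2 * ε * G x =
      -((p - 1) / 2) * (1 - ε ^ 2 + lev p ε a0 x - G x ^ 2 + 2 * k) - 2 * k + 2 * ε * G x := by
    rw [hP]; ring
  rw [e]
  have : 1 / 2 ≤ 1 - ε ^ 2 + lev p ε a0 x - G x ^ 2 + 2 * k := by nlinarith
  nlinarith

theorem exists_zero : ∃ x, G x = 0 := by
  have hc : 0 < (p - 1) / 8 := by linarith
  obtain ⟨x, hx⟩ := F.exists_le
  obtain ⟨y, hy⟩ := F.exists_ge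
  have t1 := (le_of_steep hc F.hG (F.steep hp hε h1 h2) (by norm_num) hx).2
  have hg : ∀ x, HasDerivAt (fun x => -G (-x)) (1 - ε ^ 2 + lev p ε a0 (-x) - P (-x) - G (-x) ^ 2
      + 2 * ε * G (-x)) x := fun x =>
    (((F.hG (-x)).comp x (hasDerivAt_neg x)).neg).congr_deriv (by ring)
  have t2 := (le_of_steep (s := -y) (v := 1 / 2) hc hg (fun x hx => F.steep hp hε h1 h2 (-x)
    (by simpa using hx)) (by norm_num) (by simpa using neg_le_neg hy)).2
  set b := x + (1 / 2 + 1 / 2) / ((p - 1) / 8)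
  set a := -(-y + (1 / 2 + 1 / 2) / ((p - 1) / 8))
  have hb := t1 b le_rfl
  have ha := t2 (-a) (by simp [a])
  rw [neg_neg] at ha
  have := mem_range_of_exists_le_of_exists_ge (continuous_iff_continuousAt.2
    fun x => (F.hG x).continuousAt) (c := 0) ⟨b, by linarith⟩ ⟨a, by linarith⟩
  exact this

variable (h0 : G 0 = 0)

include h0

theorem right_bounds : (∀ x, 0 ≤ x → G x ≤ 0) ∧ ∀ x, 4 / (p - 1) ≤ x → G x ≤ -(1 / 2) := by
  have hc : 0 < (p - 1) / 8 := by linarith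
  obtain ⟨t1, t2⟩ := le_of_steep (s := 0) (v := 0) hc F.hG (F.steep hp hε h1 h2) (by norm_num) h0.le
  have e : 0 + (0 + 1 / 2) / ((p - 1) / 8) = 4 / (p - 1) := by
    have : p - 1 ≠ 0 := by linarith
    field_simp; norm_num
  rw [e] at t1 t2
  refine ⟨fun x hx => ?_, t2⟩
  rcases le_total (4 / (p - 1)) x with h | h
  · linarith [t2 x h]
  · have := t1 x ⟨hx, h⟩
    have := mul_nonneg hc.le hx
    linarith

theorem left_bounds : (∀ x ≤ 0, 0 ≤ G x) ∧ ∀ x, x ≤ -(4 / (p - 1)) → 1 / 2 ≤ G x := by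
  have hc : 0 < (p - 1) / 8 := by linarith
  have hg : ∀ x, HasDerivAt (fun x => -G (-x)) (1 - ε ^ 2 + lev p ε a0 (-x) - P (-x) - G (-x) ^ 2
      + 2 * ε * G (-x)) x := fun x =>
    (((F.hG (-x)).comp x (hasDerivAt_neg x)).neg).congr_deriv (by ring)
  obtain ⟨t1, t2⟩ := le_of_steep (s := 0) (v := 0) hc hg (fun x hx => F.steep hp hε h1 h2 (-x)
    (by simpa using hx)) (by norm_num) (by simp [h0])
  have e : 0 + (0 + 1 / 2) / ((p - 1) / 8) = 4 / (p - 1) := by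
    have : p - 1 ≠ 0 := by linarith
    field_simp; norm_num
  rw [e] at t1 t2
  have t2' : ∀ x, x ≤ -(4 / (p - 1)) → 1 / 2 ≤ G x := fun x hx => by
    have := t2 (-x) (by linarith)
    rw [neg_neg] at this; linarith
  refine ⟨fun x hx => ?_, t2'⟩
  rcases le_total x (-(4 / (p - 1))) with h | h
  · linarith [t2' x h]
  · have := t1 (-x) ⟨by linarith, by linarith⟩
    have := mul_nonneg hc.le (neg_nonneg.2 hx)
    rw [neg_neg] at *
    linarith

theorem defect_le_left {x : ℝ} (hx : x ≤ 0) :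
    defect p ε a0 P G x ≤ (8 + 16 / (p - 1)) * ε := by
  have hp' : 0 < p - 1 := by linarith
  obtain ⟨g1, g2⟩ := F.left_bounds hp hε h1 h2 h0
  have he : ε ≤ 1 / 8 := by nlinarith
  have has : (p - 1) * ast p = 4 := ast_mul hp
  have tail : ∀ x, x ≤ -(4 / (p - 1)) → defect p ε a0 P G x ≤ 4 * ε := fun x hx => by
    have : defect p ε a0 P G x * Y x - 4 * ε * Y x ≤ 0 := by
      refine ge_of_tendsto F.hbot ?_
      filter_upwards [eventually_le_atBot x] with t ht
      have := le_of_hasDerivAt_nonpos ht (fun t => (F.hasDerivAt_defect_mul hp t).sub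
        ((F.hY t).const_mul (4 * ε))) fun y hy => ?_
      · have hY := mul_pos hε (F.Y_pos t)
        simp only [Pi.sub_apply] at this
        change _ ≤ defect p ε a0 P G t * Y t
        linarith
      · have hG := g2 y (hy.2.trans hx)
        have hY := F.Y_pos y
        have ha := F.lev_pos y
        have : ε * ((p - 1) / 2) * (ast p * (1 - ε ^ 2) - lev p ε a0 y)
            - 4 * ε * (2 * G y - 4 * ε) ≤ 0 := by
          have e1 : ε * ((p - 1) / 2) * (ast p * (1 - ε ^ 2)) = 2 * ε * (1 - ε ^ 2) := by
            linear_combination ε * (1 - ε ^ 2) / 2 * has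
          have e2 : 0 ≤ ε * ((p - 1) / 2) * lev p ε a0 y := by positivity
          rw [mul_sub, e1]
          have : 1 - ε ^ 2 ≤ 2 * (2 * G y - 4 * ε) := by nlinarith
          have := mul_le_mul_of_nonneg_left this hε.le
          linarith
        have := mul_nonpos_of_nonpos_of_nonneg this hY.le
        linarith
    have hY := F.Y_pos x
    refine le_of_mul_le_mul_right ?_ hY
    linarith
  rcases le_total x (-(4 / (p - 1))) with h | h
  · refine (tail x h).trans ?_
    have : 0 < 16 / (p - 1) := by positivity
    gcongr; linarith
  · set l := 4 / (p - 1) with hl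
    have hl0 : 0 < l := by positivity
    have hlε : 4 * ε * l ≤ 1 / 2 := by
      rw [hl, ← mul_div_assoc, div_le_iff₀ hp']; nlinarith
    have hexp : exp (4 * ε * l) ≤ 2 := by
      refine (exp_le_exp.2 hlε).trans ?_
      have h := exp_one_lt_d9
      have : exp (1 / 2) ^ 2 = exp 1 := by rw [← exp_nat_mul]; norm_num
      nlinarith [exp_pos (1 / 2 : ℝ)]
    have key := le_of_hasDerivAt_nonpos h (fun t => ((((hasDerivAt_id t).const_mul
      (-(4 * ε))).exp).mul (F.hasDerivAt_defect hp t)).sub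
        ((hasDerivAt_id t).const_mul (4 * ε))) fun y hy => ?_
    · simp only [Pi.sub_apply, Pi.mul_apply, id] at key
      have t1 := tail (-l) le_rfl
      have e1 : 1 ≤ exp (-(4 * ε) * x) := one_le_exp (by nlinarith)
      have e2 : -(4 * ε) * -l = 4 * ε * l := by ring
      rw [e2] at key
      have k1 := F.defect_nonneg hp hε x
      have k2 := F.defect_nonneg hp hε (-l)
      have t2 : exp (4 * ε * l) * defect p ε a0 P G (-l) ≤ 2 * (4 * ε) :=
        mul_le_mul hexp t1 k2 (by norm_num)
      have t3 : defect p ε a0 P G x ≤ exp (-(4 * ε) * x) * defect p ε a0 P G x :=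
        le_mul_of_one_le_left k1 e1
      have t4 : 16 / (p - 1) = 4 * l := by rw [hl]; ring
      rw [t4]
      have : 4 * ε * x ≤ 0 := by nlinarith
      linarith
    · have k := F.defect_nonneg hp hε y
      have hG := g1 y (hy.2.trans hx)
      have ha := F.lev_pos y
      have e1 : ε * ((p - 1) / 2) * (ast p * (1 - ε ^ 2) - lev p ε a0 y) ≤ 2 * ε := by
        have e1 : ε * ((p - 1) / 2) * (ast p * (1 - ε ^ 2)) = 2 * ε * (1 - ε ^ 2) := by
          linear_combination ε * (1 - ε ^ 2) / 2 * has
        have e2 : 0 ≤ ε * ((p - 1) / 2) * lev p ε a0 y := by positivity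
        have e3 : 0 ≤ ε * ε ^ 2 := by positivity
        rw [mul_sub, e1]; linarith
      have e2 : exp (-(4 * ε) * y) ≤ 2 := by
        refine le_trans (exp_le_exp.2 ?_) hexp
        nlinarith [hy.1]
      have e0 := exp_pos (-(4 * ε) * y)
      simp only [id, mul_one]
      have e3 : exp (-(4 * ε) * y) * (ε * ((p - 1) / 2) * (ast p * (1 - ε ^ 2) - lev p ε a0 y))
          ≤ 2 * (2 * ε) := by
        refine (mul_le_mul_of_nonneg_left e1 e0.le).trans ?_
        gcongr
      have e4 : 0 ≤ exp (-(4 * ε) * y) * (G y * defect p ε a0 P G y) := by positivity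
      linarith

theorem defect_le_right {x : ℝ} (hx : 0 ≤ x) :
    defect p ε a0 P G x ≤ (2 * (p - 1) + 4) * ε * lev p ε a0 x := by
  have hp' : 0 < p - 1 := by linarith
  have hp3 : 0 < p + 3 := by linarith
  obtain ⟨g1, g2⟩ := F.right_bounds hp hε h1 h2 h0
  have he : ε ≤ 1 / 8 := by nlinarith
  have has := ast_pos hp
  have hA : 0 ≤ ast p * (1 - ε ^ 2) := mul_nonneg has.le (by nlinarith)
  have tail : ∀ x, 4 / (p - 1) ≤ x → defect p ε a0 P G x ≤ (p - 1) * ε * lev p ε a0 x :=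
      fun x hx => by
    have : defect p ε a0 P G x * Y x - (p - 1) * ε * (lev p ε a0 x * Y x) ≤ 0 := by
      refine ge_of_tendsto F.htop ?_
      filter_upwards [eventually_ge_atTop x] with t ht
      have := le_of_hasDerivAt_nonneg ht (fun t => (F.hasDerivAt_defect_mul hp t).sub
        (((hasDerivAt_lev p ε a0 t).mul (F.hY t)).const_mul ((p - 1) * ε))) fun y hy => ?_
      · have hY := mul_pos (mul_pos hp' hε) (mul_pos (F.lev_pos t) (F.Y_pos t))
        simp only [Pi.sub_apply, Pi.mul_apply] at this
        change _ ≤ defect p ε a0 P G t * Y t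
        linarith
      · have hG := g2 y (hx.trans hy.1)
        have hY := F.Y_pos y
        have ha := F.lev_pos y
        have t1 : 0 ≤ (p - 1) * ε * (lev p ε a0 y * Y y) := by positivity
        have t2 := mul_nonneg t1 (by linarith : 0 ≤ -(1 / 2) - ((p + 3) * ε + 2 * G y - 4 * ε))
        have t3 : 0 ≤ ε * ((p - 1) / 2) * (ast p * (1 - ε ^ 2)) * Y y := by positivity
        linarith
    refine le_of_mul_le_mul_right ?_ (F.Y_pos x)
    linarith
  rcases le_total (4 / (p - 1)) x with h | h
  · refine (tail x h).trans ?_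
    have := F.lev_pos x
    gcongr; linarith
  · set l := 4 / (p - 1) with hl
    have hl0 : 0 < l := by positivity
    have hlε : (p + 3) * ε * l ≤ 1 / 2 := by
      rw [hl, ← mul_div_assoc, div_le_iff₀ hp']; linarith
    have hlev : lev p ε a0 l ≤ 2 * lev p ε a0 x := by
      have e : lev p ε a0 l = exp ((p + 3) * ε * (l - x)) * lev p ε a0 x := by
        unfold lev; rw [mul_left_comm, ← exp_add]; ring_nf
      rw [e]
      refine mul_le_mul_of_nonneg_right ?_ (F.lev_pos x).le
      have : (p + 3) * ε * (l - x) ≤ 1 / 2 := by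
        have : 0 ≤ (p + 3) * ε * x := by positivity
        linarith
      refine (exp_le_exp.2 this).trans ?_
      have h := exp_one_lt_d9
      have : exp (1 / 2) ^ 2 = exp 1 := by rw [← exp_nat_mul]; norm_num
      nlinarith [exp_pos (1 / 2 : ℝ)]
    have key := le_of_hasDerivAt_nonneg h (fun t => (F.hasDerivAt_defect hp t).add
        ((hasDerivAt_id t).const_mul (ε * ((p - 1) / 2) * lev p ε a0 l))) fun y hy => ?_
    · simp only [Pi.add_apply, id] at key
      have t1 := tail l le_rfl
      have t2 : 0 ≤ ε * ((p - 1) / 2) * lev p ε a0 l * x := by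
        have := F.lev_pos l
        positivity
      have t3 : ε * ((p - 1) / 2) * lev p ε a0 l * l = 2 * ε * lev p ε a0 l := by
        rw [hl]; field_simp; ring
      rw [t3] at key
      have t4 := mul_le_mul_of_nonneg_left hlev (by positivity : 0 ≤ (p - 1) * ε + 2 * ε)
      linarith
    · have k := F.defect_nonneg hp hε y
      have hG := g1 y (hx.trans hy.1)
      have hm : lev p ε a0 y ≤ lev p ε a0 l := by
        have := F.a_pos
        have := hy.2
        unfold lev; gcongr
      have t1 := mul_nonneg (by linarith : 0 ≤ 4 * ε - 2 * G y) k
      have t2 : 0 ≤ ε * ((p - 1) / 2) * (ast p * (1 - ε ^ 2) - lev p ε a0 y + lev p ε a0 l) :=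
        mul_nonneg (by positivity) (by linarith)
      linarith

end small

end Prof

end Vortex

theorem eventually_mul_le (K : ℝ) {c : ℝ} (hc : 0 < c) :
    ∀ᶠ ε in nhdsWithin (0:ℝ) (Set.Ioi 0), K * ε ≤ c := by
  have h : Tendsto (fun ε : ℝ => K * ε) (nhds 0) (nhds 0) :=
    (continuous_const.mul continuous_id).tendsto' 0 0 (by simp)
  exact (h.mono_left nhdsWithin_le_nhds).eventually (eventually_le_nhds hc)

theorem abs_le_of_gronwall {d d' : ℝ → ℝ} {L η R : ℝ} (hL : 0 < L) (hη : 0 ≤ η)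
    (hd : ∀ x, HasDerivAt d (d' x) x) (h0 : d 0 = 0)
    (h : ∀ x, |x| ≤ R → |d' x| ≤ L * |d x| + η) {x : ℝ} (hx : |x| ≤ R) :
    |d x| ≤ η / L * exp (L * R) := by
  have key : ∀ f f' : ℝ → ℝ, (∀ x, HasDerivAt f (f' x) x) → f 0 = 0 →
      (∀ x, |x| ≤ R → |f' x| ≤ L * |f x| + η) → ∀ x, 0 ≤ x → x ≤ R →
      |f x| ≤ η / L * exp (L * R) := fun f f' hf hf0 hb x hx hxR => by
    have := norm_le_gronwallBound_of_norm_deriv_right_le (f := f) (f' := f') (δ := 0) (K := L)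
      (ε := η) (a := 0) (b := R) (fun t _ => (hf t).continuousAt.continuousWithinAt)
      (fun t _ => (hf t).hasDerivWithinAt) (by simp [hf0])
      (fun t ht => hb t (by rw [abs_of_nonneg ht.1]; exact ht.2.le)) x ⟨hx, hxR⟩
    rw [gronwallBound_of_K_ne_0 hL.ne', sub_zero] at this
    simp only [zero_mul, zero_add] at this
    refine this.trans ?_
    gcongr
    have : exp (L * x) ≤ exp (L * R) := by gcongr
    linarith
  rcases le_total 0 x with h' | h'
  · rw [abs_of_nonneg h'] at hx
    exact key d d' hd h0 h x h' hx
  · rw [abs_of_nonpos h'] at hx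
    have := key (fun x => d (-x)) (fun x => -d' (-x))
      (fun x => ((hd (-x)).comp x (hasDerivAt_neg x)).congr_deriv (by ring)) (by simpa using h0)
      (fun x hx => by rw [abs_neg]; exact h (-x) (by rwa [abs_neg])) (-x) (by linarith) hx
    simpa using this

namespace Vortex

variable {p : ℝ}

/-- Constant in the bound for the defect of the first integral. -/
noncomputable def defectBound (p : ℝ) : ℝ := 8 + 16 / (p - 1) + (2 * (p - 1) + 4)

namespace Prof

theorem eventually_small (hp : 1 < p) : ∀ᶠ ε in nhdsWithin (0:ℝ) (Set.Ioi 0),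
    0 < ε ∧ 8 * ((p + 3) * ε) ≤ p - 1 ∧ 2 * ((p + 3) * ε) ≤ 1 := by
  filter_upwards [self_mem_nhdsWithin, eventually_mul_le (8 * (p + 3)) (sub_pos.2 hp),
    eventually_mul_le (2 * (p + 3)) one_pos] with ε h0 h1 h2
  exact ⟨h0, by linarith, by linarith⟩

theorem eventually_lev_zero (hp : 1 < p) {δ : ℝ} (hδ : 0 < δ) :
    ∀ᶠ ε in nhdsWithin (0:ℝ) (Set.Ioi 0), ∀ (a0 : ℝ) (P G Y : ℝ → ℝ), Prof p ε a0 P G Y →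
      G 0 = 0 → |a0 - ast p| ≤ δ := by
  have hp' : 0 < p - 1 := by linarith
  have hp3 : 0 < p + 3 := by linarith
  have has := ast_pos hp
  set c := (p - 1) * δ / 4 with hc
  have hc0 : 0 < c := by positivity
  set l := 4 / (p - 1) with hl
  have hl0 : 0 < l := by positivity
  have h16 : 0 < 16 / (p - 1) := by positivity
  have hC0 : 0 < defectBound p := by unfold defectBound; positivity
  set S := l + (defectBound p * (ast p + 1) / c + 1) with hS
  have hSl : c * (S - l) = defectBound p * (ast p + 1) + c := by rw [hS]; field_simp; ring
  have hlS : l ≤ S := by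
    have : 0 < defectBound p * (ast p + 1) / c := by positivity
    linarith
  filter_upwards [eventually_small hp, eventually_mul_le (ast p) (by positivity : 0 < δ / 4),
    eventually_mul_le (8 * (p + 3) * ast p * S) hδ, eventually_mul_le ((p + 3) * S) one_pos,
    eventually_mul_le (2 * (ast p + δ) * (p + 3) * S) hδ]
    with ε ⟨hε, h1, h2⟩ e1 e2 e3 e4 a0 P G Y F h0
  have hε1 : ε ≤ 1 / 8 := by nlinarith
  have hAs : ast p * ε ^ 2 ≤ δ / 4 := by
    have : ast p * ε ^ 2 ≤ ast p * ε := by gcongr; nlinarith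
    linarith
  have hAs0 : 0 ≤ ast p * ε ^ 2 := by positivity
  have hμ : 0 < (p + 3) * ε := by positivity
  rw [abs_le]
  constructor
  · by_contra! hlt
    have hG := (F.right_bounds hp hε h1 h2 h0).2
    have hlev : ∀ s, s ≤ S → lev p ε a0 s ≤ ast p - 3 * δ / 4 := fun s hs => by
      have t1 : lev p ε a0 s ≤ a0 * exp ((p + 3) * ε * S) := by
        have := F.a_pos
        unfold lev; gcongr
      have t2 : |exp ((p + 3) * ε * S) - 1| ≤ 2 * |(p + 3) * ε * S| :=
        abs_exp_sub_one_le (by rw [abs_of_nonneg (by nlinarith)]; linarith)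
      rw [abs_of_nonneg (by nlinarith : 0 ≤ (p + 3) * ε * S)] at t2
      have t3 := (abs_le.1 t2).2
      have t4 := mul_le_mul_of_nonneg_left t3 F.a_pos.le
      have t5 : a0 * (2 * ((p + 3) * ε * S)) ≤ ast p * (2 * ((p + 3) * ε * S)) := by
        refine mul_le_mul_of_nonneg_right (by linarith) ?_
        have : 0 ≤ (p + 3) * ε * S := by nlinarith
        linarith
      linarith
    have key := le_of_hasDerivAt_nonneg hlS (fun t => ((F.hasDerivAt_defect hp t).add_const
      (ε * c)).mul ((hasDerivAt_neg t).exp)) fun y hy => ?_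
    · have k0 := F.defect_nonneg hp hε l
      have k1 := F.defect_le_right hp hε h1 h2 h0 (hl0.le.trans hlS)
      have k2 : (2 * (p - 1) + 4) * ε * lev p ε a0 S ≤ defectBound p * ε * ast p := by
        have := hlev S le_rfl
        have := F.lev_pos S
        gcongr
        · unfold defectBound; linarith
        · linarith
      have k3 : ε * c * exp (-l) ≤ (defectBound p * ε * ast p + ε * c) * exp (-S) := by
        refine le_trans ?_ (key.trans ?_)
        · exact mul_le_mul_of_nonneg_right (by linarith) (exp_pos _).le
        · exact mul_le_mul_of_nonneg_right (by linarith) (exp_pos _).le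
      have k4 : exp (-l) = exp (S - l) * exp (-S) := by rw [← exp_add]; ring_nf
      rw [k4, ← mul_assoc] at k3
      have k5 := le_of_mul_le_mul_right k3 (exp_pos _)
      have k6 := add_one_le_exp (S - l)
      have k7 := mul_le_mul_of_nonneg_left k6 (by positivity : 0 ≤ ε * c)
      have k8 : ε * c * (S - l) = ε * (defectBound p * (ast p + 1) + c) := by
        rw [← hSl]; ring
      have : 0 < defectBound p * ε := by positivity
      have : 0 < ε * c := by positivity
      linarith
    · have k0 := F.defect_nonneg hp hε y
      have t1 := hG y hy.1
      have t2 := hlev y hy.2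
      have t3 : 0 ≤ (4 * ε - 2 * G y - 1) * defect p ε a0 P G y :=
        mul_nonneg (by linarith) k0
      have t4 : ε * c ≤ ε * ((p - 1) / 2) * (ast p * (1 - ε ^ 2) - lev p ε a0 y) := by
        have : ε * c = ε * ((p - 1) / 2) * (δ / 2) := by rw [hc]; ring
        rw [this]
        refine mul_le_mul_of_nonneg_left ?_ (by positivity)
        linarith
      have := mul_nonneg (by linarith : 0 ≤ (4 * ε - 2 * G y) * defect p ε a0 P G y
        + ε * ((p - 1) / 2) * (ast p * (1 - ε ^ 2) - lev p ε a0 y)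
        - (defect p ε a0 P G y + ε * c)) (exp_pos (-y)).le
      linarith
  · by_contra! hlt
    have hG := (F.left_bounds hp hε h1 h2 h0).2
    have hlev : ∀ s, -S ≤ s → ast p + δ / 2 ≤ lev p ε a0 s := fun s hs => by
      have t1 : a0 * (1 - (p + 3) * ε * S) ≤ lev p ε a0 s := by
        unfold lev
        refine mul_le_mul_of_nonneg_left ?_ F.a_pos.le
        have := add_one_le_exp ((p + 3) * ε * s)
        have := mul_le_mul_of_nonneg_left hs hμ.le
        linarith
      have t2 : (ast p + δ) * (1 - (p + 3) * ε * S) ≤ a0 * (1 - (p + 3) * ε * S) :=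
        mul_le_mul_of_nonneg_right (by linarith) (by linarith)
      linarith
    have key := le_of_hasDerivAt_nonpos (neg_le_neg hlS) (fun t => ((F.hasDerivAt_defect hp
      t).add_const (2 * ε * c)).mul (((hasDerivAt_id t).div_const 2).exp)) fun y hy => ?_
    · have k0 := F.defect_nonneg hp hε (-l)
      have k1 := F.defect_le_left hp hε h1 h2 h0 (x := -S) (by linarith)
      have k2 : (8 + 16 / (p - 1)) * ε ≤ defectBound p * ε := by
        gcongr; unfold defectBound; linarith
      have k3 : 2 * ε * c * exp (-l / 2) ≤ (defectBound p * ε + 2 * ε * c) * exp (-S / 2) := by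
        refine le_trans ?_ (key.trans ?_)
        · exact mul_le_mul_of_nonneg_right (by linarith) (exp_pos _).le
        · exact mul_le_mul_of_nonneg_right (by linarith) (exp_pos _).le
      have k4 : exp (-l / 2) = exp ((S - l) / 2) * exp (-S / 2) := by
        rw [← exp_add]; ring_nf
      rw [k4, ← mul_assoc] at k3
      have k5 := le_of_mul_le_mul_right k3 (exp_pos _)
      have k6 := add_one_le_exp ((S - l) / 2)
      have k7 := mul_le_mul_of_nonneg_left k6 (by positivity : 0 ≤ 2 * ε * c)
      have k8 : ε * c * (S - l) = ε * (defectBound p * (ast p + 1) + c) := by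
        rw [← hSl]; ring
      have : 0 < defectBound p * ε * ast p := by positivity
      have : 0 < ε * c := by positivity
      linarith
    · have k0 := F.defect_nonneg hp hε y
      have t1 := hG y hy.2
      have t2 := hlev y hy.1
      have t3 : 0 ≤ (2 * G y - 4 * ε - 1 / 2) * defect p ε a0 P G y :=
        mul_nonneg (by linarith) k0
      have t4 : ε * c ≤ ε * ((p - 1) / 2) * (lev p ε a0 y - ast p * (1 - ε ^ 2)) := by
        have : ε * c = ε * ((p - 1) / 2) * (δ / 2) := by rw [hc]; ring
        rw [this]
        refine mul_le_mul_of_nonneg_left ?_ (by positivity)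
        linarith
      have := mul_nonneg (by linarith : 0 ≤ -((4 * ε - 2 * G y) * defect p ε a0 P G y
        + ε * ((p - 1) / 2) * (ast p * (1 - ε ^ 2) - lev p ε a0 y)
        + (defect p ε a0 P G y + 2 * ε * c) / 2)) (exp_pos (y / 2)).le
      simp only [id]
      linarith

set_option maxHeartbeats 800000 in
theorem eventually_near_pot (hp : 1 < p) {R η : ℝ} (hη : 0 < η) :
    ∀ᶠ ε in nhdsWithin (0:ℝ) (Set.Ioi 0), ∀ (a0 : ℝ) (P G Y : ℝ → ℝ), Prof p ε a0 P G Y →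
      G 0 = 0 → ∀ x, |x| ≤ R → |P x - pot p x| ≤ η := by
  have hp' : 0 < p - 1 := by linarith
  have hp3 : 0 < p + 3 := by linarith
  have has := ast_pos hp
  have h16 : 0 < 16 / (p - 1) := by positivity
  have hC0 : 0 < defectBound p := by unfold defectBound; positivity
  set M := 1 + 3 * (ast p + 1) with hM
  have hM0 : 0 < M := by positivity
  set s := √(1 + ast p) with hs
  have hs2 : s ^ 2 = 1 + ast p := sq_sqrt (by positivity)
  have hs0 : 0 < s := sqrt_pos.2 (by positivity)
  have hr : rate p = (p - 1) / 2 * s := rfl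
  set L := (p - 1) / 2 * (M + 2 + s) with hL
  have hL0 : 0 < L := by positivity
  set Cg := 2 * (p + 1) / L * exp (L * R) with hCg
  have hCg0 : 0 < Cg := by positivity
  set τ := min 1 (η / ((p + 1) / 2 * (4 + Cg * (M + 2 + s)))) with hτ
  have hτ0 : 0 < τ := by positivity
  have hτ1 : τ ≤ 1 := min_le_left _ _
  have hτη : τ * ((p + 1) / 2 * (4 + Cg * (M + 2 + s))) ≤ η :=
    (le_div_iff₀ (by positivity)).1 (min_le_right _ _)
  filter_upwards [eventually_small hp, eventually_lev_zero hp (by positivity : 0 < τ / 6),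
    eventually_mul_le ((p + 3) * R) one_pos, eventually_mul_le (4 * ast p * (p + 3) * R) hτ0,
    eventually_mul_le (defectBound p * M) hτ0, eventually_mul_le (M + 2) hτ0]
    with ε ⟨hε, h1, h2⟩ hloc e1 e2 e3 e4 a0 P G Y F h0
  have ha0 := hloc a0 P G Y F h0
  have hlev : ∀ x, |x| ≤ R → |lev p ε a0 x - ast p| ≤ τ := fun x hx => by
    have t0 : |(p + 3) * ε * x| ≤ (p + 3) * R * ε := by
      rw [abs_mul, abs_of_pos (by positivity : 0 < (p + 3) * ε)]
      have := mul_le_mul_of_nonneg_left hx (by positivity : 0 ≤ (p + 3) * ε)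
      linarith
    have t1 := abs_exp_sub_one_le (t0.trans e1)
    have t2 : exp ((p + 3) * ε * x) ≤ 3 := by
      have := exp_le_exp.2 ((le_abs_self _).trans (t0.trans e1))
      linarith [exp_one_lt_d9]
    have e : lev p ε a0 x - ast p = (a0 - ast p) * exp ((p + 3) * ε * x)
        + ast p * (exp ((p + 3) * ε * x) - 1) := by unfold lev; ring
    rw [e]
    refine (abs_add_le _ _).trans ?_
    rw [abs_mul, abs_mul, abs_of_pos has, abs_of_pos (exp_pos _)]
    have t3 := mul_le_mul ha0 t2 (exp_pos _).le (by positivity)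
    have t4 := mul_le_mul_of_nonneg_left (t1.trans (mul_le_mul_of_nonneg_left t0 two_pos.le)) has.le
    linarith
  have hk : ∀ x, |x| ≤ R → |defect p ε a0 P G x| ≤ τ := fun x hx => by
    rw [abs_of_nonneg (F.defect_nonneg hp hε x)]
    have hl := (abs_le.1 (hlev x hx)).2
    have hl0 := F.lev_pos x
    refine le_trans ?_ e3
    rcases le_total x 0 with h | h
    · refine (F.defect_le_left hp hε h1 h2 h0 h).trans ?_
      have : 8 + 16 / (p - 1) ≤ defectBound p := by unfold defectBound; linarith
      have t : defectBound p * 1 ≤ defectBound p * M := by gcongr; linarith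
      gcongr
      linarith
    · refine (F.defect_le_right hp hε h1 h2 h0 h).trans ?_
      have : 2 * (p - 1) + 4 ≤ defectBound p := by unfold defectBound; linarith
      rw [mul_right_comm]
      gcongr
      linarith
  have hG : ∀ x, |x| ≤ R → |G x| ≤ M + 2 := fun x hx => by
    have hl := (abs_le.1 (hlev x hx)).2
    have k := (abs_le.1 (hk x hx)).2
    have hP := F.P_pos x
    rw [P_eq (P := P) (G := G) (ε := ε) (a0 := a0) hp x] at hP
    have := pos_of_mul_pos_right hP (by positivity)
    refine abs_le_of_sq_le_sq ?_ (by positivity)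
    nlinarith [sq_nonneg ε]
  have hG0 : ∀ x, |s * tanh (rate p * x)| ≤ s := fun x => by
    rw [abs_mul, abs_of_pos hs0]
    exact mul_le_of_le_one_right hs0.le (abs_tanh_lt_one _).le
  have hε2 : |ε ^ 2| ≤ τ := by
    rw [abs_of_nonneg (sq_nonneg ε)]
    have : ε ≤ 1 := by nlinarith
    nlinarith
  have hsum : ∀ x, |x| ≤ R → |G x - s * tanh (rate p * x)| ≤ M + 2 + s := fun x hx =>
    (abs_sub _ _).trans (add_le_add (hG x hx) (hG0 x))
  have hd : ∀ x, HasDerivAt (fun x => G x + s * tanh (rate p * x))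
      ((p - 1) / 2 * (G x - s * tanh (rate p * x)) * (G x + s * tanh (rate p * x))
        + (-((p - 1) / 2) * (lev p ε a0 x - ast p - ε ^ 2)
          - (p + 1) * defect p ε a0 P G x + 2 * (ε * G x))) x := fun x => by
    refine ((F.hG x).add ((hasDerivAt_tanh_mul (rate p) x).const_mul s)).congr_deriv ?_
    rw [P_eq (P := P) (G := G) (ε := ε) (a0 := a0) hp x, hr]
    linear_combination (p - 1) / 2 * hs2
  have hgr := fun x (hx : |x| ≤ R) => abs_le_of_gronwall hL0 (η := 2 * (p + 1) * τ) (R := R)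
    (by positivity) hd (by simp [h0]) (fun x hx => by
      refine (abs_add_le _ _).trans (add_le_add ?_ ?_)
      · rw [abs_mul, abs_mul, abs_of_pos (by positivity : 0 < (p - 1) / 2), hL]
        have := hsum x hx
        gcongr
      · obtain ⟨b1, b2⟩ := abs_le.1 (hlev x hx)
        obtain ⟨b3, b4⟩ := abs_le.1 (hk x hx)
        obtain ⟨b5, b6⟩ := abs_le.1 hε2
        have b7 : |ε * G x| ≤ τ := by
          rw [abs_mul, abs_of_pos hε]
          have := mul_le_mul_of_nonneg_left (hG x hx) hε.le
          linarith
        obtain ⟨b8, b9⟩ := abs_le.1 b7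
        have hq : 0 ≤ (p - 1) / 2 := by positivity
        have hq' : 0 ≤ p + 1 := by linarith
        have n1 := mul_le_mul_of_nonneg_left (by linarith : lev p ε a0 x - ast p - ε ^ 2 ≤ 2 * τ) hq
        have n2 := mul_le_mul_of_nonneg_left
          (by linarith : -(2 * τ) ≤ lev p ε a0 x - ast p - ε ^ 2) hq
        have n3 := mul_le_mul_of_nonneg_left b3 hq'
        have n4 := mul_le_mul_of_nonneg_left b4 hq'
        rw [abs_le]
        constructor <;> linarith) hx
  intro x hx
  have hgx := hgr x hx
  have e : P x - pot p x = (p + 1) / 2 * ((lev p ε a0 x - ast p) - ε ^ 2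
      + 2 * defect p ε a0 P G x
      - (G x + s * tanh (rate p * x)) * (G x - s * tanh (rate p * x))) := by
    rw [P_eq (P := P) (G := G) (ε := ε) (a0 := a0) hp x]
    unfold pot
    linear_combination -((p + 1) / 2 * tanh (rate p * x) ^ 2) * hs2
  have hprod : |(G x + s * tanh (rate p * x)) * (G x - s * tanh (rate p * x))|
      ≤ Cg * τ * (M + 2 + s) := by
    rw [abs_mul]
    refine mul_le_mul (hgx.trans_eq ?_) (hsum x hx) (abs_nonneg _) (by positivity)
    rw [hCg]; ring
  obtain ⟨b1, b2⟩ := abs_le.1 (hlev x hx)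
  obtain ⟨b3, b4⟩ := abs_le.1 (hk x hx)
  obtain ⟨b5, b6⟩ := abs_le.1 hε2
  obtain ⟨b7, b8⟩ := abs_le.1 hprod
  rw [e, abs_mul, abs_of_pos (by positivity : 0 < (p + 1) / 2)]
  have : |(lev p ε a0 x - ast p) - ε ^ 2 + 2 * defect p ε a0 P G x
      - (G x + s * tanh (rate p * x)) * (G x - s * tanh (rate p * x))|
      ≤ τ * (4 + Cg * (M + 2 + s)) := by
    rw [abs_le]; constructor <;> linarith
  refine (mul_le_mul_of_nonneg_left this (by positivity)).trans ?_
  linarith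

/-- The rescaled potential of the profile converges uniformly to the limiting potential. -/
theorem eventually_close (hp : 1 < p) {δ : ℝ} (hδ : 0 < δ) :
    ∀ᶠ ε in nhdsWithin (0:ℝ) (Set.Ioi 0), ∀ (a0 : ℝ) (P G Y : ℝ → ℝ), Prof p ε a0 P G Y →
      G 0 = 0 → |a0 - ast p| ≤ δ ∧ ∀ x, |P x - pot p x| ≤ δ := by
  have hp' : 0 < p - 1 := by linarith
  set B := (p + 1) / 2 * (1 + ast p) / rate p ^ 2
  set R := 4 / (p - 1) + √(2 * B / δ) with hR
  have hl0 : 0 < 4 / (p - 1) := by positivity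
  have hR0 : 0 < R := by positivity
  have hlR : 4 / (p - 1) ≤ R := by rw [hR]; linarith [sqrt_nonneg (2 * B / δ)]
  have hpot : ∀ x, R ≤ |x| → pot p x ≤ δ / 2 := fun x hx => by
    have h1 : 2 * B / δ ≤ x ^ 2 := by
      rw [← sq_abs]
      refine (sqrt_le_iff.1 (le_trans ?_ hx)).2
      linarith
    have h2 := sq_mul_pot_le hp x
    rw [div_le_iff₀ hδ] at h1
    have hx2 : 0 < x ^ 2 := by
      rw [← sq_abs]; have := hR0.trans_le hx; positivity
    refine le_of_mul_le_mul_left ?_ hx2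
    change x ^ 2 * pot p x ≤ B at h2
    linarith
  filter_upwards [eventually_small hp, eventually_lev_zero hp hδ,
    eventually_near_pot hp (R := R) (half_pos hδ), eventually_mul_le 8 hp'] with ε ⟨hε, h1, h2⟩ e1 e2 e3 a0 P G Y F h0
  refine ⟨e1 a0 P G Y F h0, fun x => ?_⟩
  have hin := e2 a0 P G Y F h0
  have fin : ∀ x, R ≤ |x| → P x ≤ δ → |P x - pot p x| ≤ δ := fun x hx hP => by
    have := hpot x hx
    have := pot_nonneg hp x
    have := F.P_pos x
    rw [abs_le]; constructor <;> linarith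
  rcases le_total |x| R with h | h
  · exact (hin x h).trans (by linarith)
  · refine fin x h ?_
    rcases le_total 0 x with h' | h'
    · rw [abs_of_nonneg h'] at h
      have t1 := (abs_le.1 (hin R (abs_of_pos hR0).le)).2
      have t2 := hpot R (le_abs_self R)
      have t3 := le_of_hasDerivAt_nonpos h F.hP fun y hy => by
        have g := (F.right_bounds hp hε h1 h2 h0).2 y (hlR.trans hy.1)
        refine mul_nonpos_of_nonneg_of_nonpos (F.P_pos y).le ?_
        nlinarith
      linarith
    · rw [abs_of_nonpos h'] at h
      have hneg : |-R| = R := by rw [abs_neg, abs_of_pos hR0]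
      have t1 := (abs_le.1 (hin (-R) hneg.le)).2
      have t2 := hpot (-R) hneg.ge
      have t3 := le_of_hasDerivAt_nonneg (by linarith : x ≤ -R) F.hP fun y hy => by
        have g := (F.left_bounds hp hε h1 h2 h0).2 y (hy.2.trans (neg_le_neg hlR))
        have := F.P_pos y
        have : 0 ≤ (p - 1) * G y := mul_nonneg hp'.le (by linarith)
        positivity
      linarith

end Prof

end Vortex

namespace Vortex

variable {p : ℝ}

/-- The rescaled potential `r² φ ^ (p - 1) / m²` in the logarithmic variable, with `h = 1 / m`. -/
noncomputable def resc (p h : ℝ) (Φ : ℝ → ℝ) (x : ℝ) : ℝ :=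
  h ^ 2 * exp (2 * h * x) * Φ x ^ (p - 1)

section logvar

variable {ω h : ℝ} {Φ Φ1 : ℝ → ℝ} (hp : 1 < p) (hω : 0 < ω) (hh : 0 < h)
  (hpos : ∀ x, 0 < Φ x) (h1 : ∀ x, HasDerivAt Φ (Φ1 x) x)
  (h2 : ∀ x, HasDerivAt Φ1 ((1 + ω * h ^ 2 * exp (2 * h * x) - resc p h Φ x) * Φ x) x)
  (htop : Tendsto Φ atTop (nhds 0))

include hp hω hh hpos h1 h2 htop

theorem decay_atTop : Tendsto Φ1 atTop (nhds 0) ∧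
    Tendsto (fun x => ω * h ^ 2 * exp (2 * h * x) * Φ x) atTop (nhds 0) := by
  have hp' : 0 < p - 1 := by linarith
  have hpw : Tendsto (fun x => Φ x ^ (p - 1)) atTop (nhds 0) := by
    simpa [zero_rpow hp'.ne'] using htop.rpow_const (Or.inr hp'.le)
  obtain ⟨s0, hs0⟩ := eventually_atTop.1 (hpw.eventually (eventually_le_nhds (half_pos hω)))
  have hconv : ∀ x, s0 ≤ x → (1 + ω * h ^ 2 * exp (2 * h * x) / 2) * Φ x ≤
      (1 + ω * h ^ 2 * exp (2 * h * x) - resc p h Φ x) * Φ x := fun x hx => by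
    refine mul_le_mul_of_nonneg_right ?_ (hpos x).le
    have := mul_le_mul_of_nonneg_left (hs0 x hx) (by positivity : 0 ≤ h ^ 2 * exp (2 * h * x))
    unfold resc
    linarith
  have hconv0 : ∀ x, s0 ≤ x → 0 ≤ (1 + ω * h ^ 2 * exp (2 * h * x) - resc p h Φ x) * Φ x :=
    fun x hx => by
    have := hpos x
    exact le_trans (by positivity) (hconv x hx)
  have hmono : ∀ x y, s0 ≤ x → x ≤ y → Φ1 x ≤ Φ1 y := fun x y hx hxy =>
    le_of_hasDerivAt_nonneg hxy h2 fun t ht => hconv0 t (hx.trans ht.1)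
  have hneg : ∀ x, s0 ≤ x → Φ1 x ≤ 0 := fun x hx => by
    by_contra! hc
    have : Φ x ≤ 0 := ge_of_tendsto htop (by
      filter_upwards [eventually_ge_atTop x] with y hy
      exact le_of_hasDerivAt_nonneg hy h1 fun t ht => hc.le.trans (hmono x t hx ht.1))
    exact absurd (hpos x) this.not_gt
  have hb : ∀ x, s0 + 1 ≤ x → -Φ1 x ≤ Φ (x - 1) := fun x hx => by
    have := le_of_hasDerivAt_nonpos (x := x - 1) (y := x) (by linarith)
      (fun t => (h1 t).sub ((hasDerivAt_id t).const_mul (Φ1 x))) fun t ht => by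
        have := hmono t x (by linarith [ht.1]) ht.2
        linarith
    simp only [Pi.sub_apply, id] at this
    have := hpos x
    linarith
  have hsh : ∀ c : ℝ, Tendsto (fun x => Φ (x - c)) atTop (nhds 0) := fun c =>
    htop.comp (tendsto_atTop_add_const_right _ (-c) tendsto_id)
  constructor
  · refine squeeze_zero_norm' ?_ (hsh 1)
    filter_upwards [eventually_ge_atTop (s0 + 1)] with x hx
    rw [norm_eq_abs, abs_of_nonpos (hneg x (by linarith))]
    exact hb x hx
  · have hlim := (hsh 2).const_mul (2 * exp (2 * h))
    rw [mul_zero] at hlim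
    refine squeeze_zero' (Eventually.of_forall fun x => ?_) ?_ hlim
    · have := hpos x; positivity
    · filter_upwards [eventually_ge_atTop (s0 + 2)] with x hx
      set a := ω * h ^ 2 * exp (2 * h * (x - 1)) with ha
      have ha0 : 0 < a := by positivity
      have e : ω * h ^ 2 * exp (2 * h * x) = exp (2 * h) * a := by
        rw [ha, mul_left_comm, ← exp_add]; ring_nf
      have := le_of_hasDerivAt_nonneg (x := x - 1) (y := x) (by linarith)
        (fun t => (h2 t).sub ((hasDerivAt_id t).const_mul (a / 2 * Φ x))) fun t ht => by
          have t1 := hconv t (by linarith [ht.1])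
          have t2 : Φ x ≤ Φ t := le_of_hasDerivAt_nonpos ht.2 h1 fun u hu =>
            hneg u (by linarith [hu.1, ht.1])
          have t3 : a ≤ ω * h ^ 2 * exp (2 * h * t) := by
            have := ht.1
            rw [ha]; gcongr
          have t4 : a / 2 * Φ x ≤ (1 + ω * h ^ 2 * exp (2 * h * t) / 2) * Φ t :=
            mul_le_mul (by linarith) t2 (hpos x).le (by positivity)
          linarith
      simp only [Pi.sub_apply, id] at this
      have t5 := hb (x - 1) (by linarith)
      have t6 := hneg x (by linarith)
      have t7 : a * Φ x ≤ 2 * Φ (x - 2) := by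
        rw [show x - 1 - 1 = x - 2 by ring] at t5
        linarith
      have t8 := mul_le_mul_of_nonneg_left t7 (exp_pos (2 * h)).le
      rw [e]
      linarith

theorem prof_of_log {L : ℝ} (hbot0 : Tendsto Φ atBot (nhds 0))
    (hb : Tendsto (fun x => Φ x / exp x) atBot (nhds L))
    (hb1 : Tendsto (fun x => Φ1 x / exp x) atBot (nhds L)) {ε : ℝ} (hε : 0 < ε)
    (hε1 : ε ≤ 1 / 4) (hεh : (p + 3) * ε = 2 * h) :
    Prof p ε (ω * h ^ 2) (resc p h Φ) (fun x => Φ1 x / Φ x + ε)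
      (fun x => Φ x ^ 2 * exp (-(2 * ε) * x)) := by
  have hp' : 0 < p - 1 := by linarith
  have hlev : ∀ x, lev p ε (ω * h ^ 2) x = ω * h ^ 2 * exp (2 * h * x) := fun x => by
    rw [lev, hεh]
  have hrpos : ∀ x, 0 < resc p h Φ x := fun x => by
    have := rpow_pos_of_pos (hpos x) (p - 1)
    unfold resc; positivity
  have hdef : ∀ x, (((Φ1 x / Φ x + ε) ^ 2 - (1 - ε ^ 2 + lev p ε (ω * h ^ 2) x)) / 2
      + resc p h Φ x / (p + 1)) * (Φ x ^ 2 * exp (-(2 * ε) * x)) =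
      exp (-(2 * ε) * x) * (((Φ1 x + ε * Φ x) ^ 2 - (1 - ε ^ 2 + ω * h ^ 2 * exp (2 * h * x))
        * Φ x ^ 2) / 2 + resc p h Φ x * Φ x ^ 2 / (p + 1)) := fun x => by
    have := (hpos x).ne'
    have : p + 1 ≠ 0 := by linarith
    rw [hlev]
    field_simp
  refine ⟨by positivity, hrpos, fun x => ?_, fun x => ?_, fun x => ?_, fun x => ?_, ?_, ?_, ?_, ?_⟩
  · have := hpos x; positivity
  · have hx := hpos x
    refine (((((hasDerivAt_id x).const_mul (2 * h)).exp).const_mul (h ^ 2)).mul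
      ((h1 x).rpow_const (p := p - 1) (Or.inl hx.ne'))).congr_deriv ?_
    have e : resc p h Φ x = h ^ 2 * exp (2 * h * x) * Φ x ^ (p - 1) := rfl
    rw [e, rpow_sub_one hx.ne' (p - 1)]
    generalize Φ x ^ (p - 1) = b
    simp only [id]
    field_simp
    linear_combination (-(b * Φ x)) * hεh
  · have hx := (hpos x).ne'
    refine (((h2 x).div (h1 x) hx).add_const ε).congr_deriv ?_
    rw [hlev]
    field_simp
    ring
  · have hx := (hpos x).ne'
    refine (((h1 x).pow 2).mul (((hasDerivAt_id x).const_mul (-(2 * ε))).exp)).congr_deriv ?_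
    simp only [id]
    field_simp
    simp
    ring
  · simp only [hdef]
    have ha : Tendsto (fun x => exp (2 * h * x)) atBot (nhds 0) :=
      tendsto_exp_atBot.comp (tendsto_id.const_mul_atBot (by positivity))
    have hpw : Tendsto (fun x => Φ x ^ (p - 1)) atBot (nhds 0) := by
      simpa [zero_rpow hp'.ne'] using hbot0.rpow_const (Or.inr hp'.le)
    have hr : Tendsto (resc p h Φ) atBot (nhds 0) := by
      have := (ha.const_mul (h ^ 2)).mul hpw
      rw [mul_zero] at this
      exact this
    have he : Tendsto (fun x => exp ((2 - 2 * ε) * x)) atBot (nhds 0) :=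
      tendsto_exp_atBot.comp (tendsto_id.const_mul_atBot (by linarith))
    have key := he.mul ((((hb1.add (hb.const_mul ε)).pow 2).sub
      (((ha.const_mul (ω * h ^ 2)).const_add (1 - ε ^ 2)).mul (hb.pow 2))).div_const 2 |>.add
        ((hr.mul (hb.pow 2)).div_const (p + 1)))
    rw [zero_mul] at key
    refine key.congr fun x => ?_
    have e : exp ((2 - 2 * ε) * x) = exp x ^ 2 * exp (-(2 * ε) * x) := by
      rw [← exp_nat_mul, ← exp_add]; push_cast; ring_nf
    have := (exp_pos x).ne'
    rw [e]
    have : p + 1 ≠ 0 := by linarith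
    field_simp
  · simp only [hdef]
    obtain ⟨d1, d2⟩ := decay_atTop hp hω hh hpos h1 h2 htop
    have hpw : Tendsto (fun x => Φ x ^ (p - 1)) atTop (nhds 0) := by
      simpa [zero_rpow hp'.ne'] using htop.rpow_const (Or.inr hp'.le)
    have key := ((((d1.add (htop.const_mul ε)).pow 2).sub
      (((htop.pow 2).const_mul (1 - ε ^ 2)).add (d2.mul htop))).div_const 2 |>.add
        (((d2.mul htop).mul hpw).div_const (ω * (p + 1))))
    refine squeeze_zero_norm' ?_ (by simpa using key.norm)
    filter_upwards [eventually_ge_atTop 0] with x hx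
    rw [norm_mul, norm_of_nonneg (exp_pos _).le]
    have t : exp (-(2 * ε) * x) ≤ 1 := exp_le_one_iff.2 (by nlinarith)
    refine (mul_le_of_le_one_left (norm_nonneg _) t).trans_eq ?_
    rw [norm_eq_abs]
    congr 1
    have : p + 1 ≠ 0 := by linarith
    unfold resc
    field_simp
  · by_contra! hc
    have : Φ 0 ≤ 0 := ge_of_tendsto htop (by
      filter_upwards [eventually_ge_atTop 0] with y hy
      refine le_of_hasDerivAt_nonneg hy h1 fun t _ => ?_
      have t1 : 0 < Φ1 t / Φ t := by have := hc t; linarith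
      exact ((div_pos_iff_of_pos_right (hpos t)).1 t1).le)
    exact absurd (hpos 0) this.not_gt
  · by_contra! hc
    have : Φ 0 ≤ 0 := ge_of_tendsto hbot0 (by
      filter_upwards [eventually_le_atBot 0] with y hy
      refine le_of_hasDerivAt_nonpos hy h1 fun t _ => ?_
      have t1 : Φ1 t / Φ t < 0 := by have := hc t; linarith
      have t2 := mul_neg_of_neg_of_pos t1 (hpos t)
      rw [div_mul_cancel₀ _ (hpos t).ne'] at t2
      exact t2.le)
    exact absurd (hpos 0) this.not_gt

end logvar

/-- Radial profile of a vortex standing wave. -/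
structure Profile (p ω : ℝ) (m : ℕ) (φ : ℝ → ℝ) : Prop where
  smooth : ContDiffOn ℝ 2 φ (Set.Ioi 0)
  pos : ∀ r ∈ Set.Ioi (0:ℝ), 0 < φ r
  ode : ∀ r ∈ Set.Ioi (0:ℝ), deriv (deriv φ) r + deriv φ r / r
    - (ω + (m : ℝ) ^ 2 / r ^ 2) * φ r + φ r ^ p = 0
  zero : ∃ L : ℝ, Tendsto (fun r => φ r / r ^ m) (nhdsWithin 0 (Set.Ioi 0)) (nhds L) ∧
    Tendsto (fun r => deriv φ r / ((m : ℝ) * r ^ (m - 1))) (nhdsWithin 0 (Set.Ioi 0)) (nhds L)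
  top : Tendsto φ atTop (nhds 0)

namespace Profile

variable {ω : ℝ} {m : ℕ} {φ : ℝ → ℝ}

theorem exists_prof (F : Profile p ω m φ) (hp : 1 < p) (hω : 0 < ω) (hm : 0 < m)
    (hε1 : 2 * (m : ℝ)⁻¹ / (p + 3) ≤ 1 / 4) :
    ∃ G Y : ℝ → ℝ, Prof p (2 * (m : ℝ)⁻¹ / (p + 3)) (ω * (m : ℝ)⁻¹ ^ 2)
      (resc p (m : ℝ)⁻¹ fun x => φ (exp ((m : ℝ)⁻¹ * x))) G Y := by
  have hm' : 0 < (m : ℝ) := by exact_mod_cast hm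
  set h := (m : ℝ)⁻¹ with hh
  have hh0 : 0 < h := by positivity
  have hhm : m * h = 1 := mul_inv_cancel₀ hm'.ne'
  have hd1 : ∀ r, 0 < r → HasDerivAt φ (deriv φ r) r := fun r hr =>
    ((F.smooth.contDiffAt (Ioi_mem_nhds hr)).differentiableAt (by norm_num)).hasDerivAt
  have hd2 : ∀ r, 0 < r → HasDerivAt (deriv φ) (deriv (deriv φ) r) r := fun r hr => by
    have : ContDiffOn ℝ 1 (deriv φ) (Set.Ioi 0) :=
      ((contDiffOn_succ_iff_deriv_of_isOpen (n := 1) isOpen_Ioi).1 (F.smooth.of_le (by norm_num))).2.2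
    exact ((this.contDiffAt (Ioi_mem_nhds hr)).differentiableAt (by norm_num)).hasDerivAt
  have hE : ∀ x, HasDerivAt (fun x => exp (h * x)) (h * exp (h * x)) x := fun x =>
    (((hasDerivAt_id x).const_mul h).exp).congr_deriv (by simp; ring)
  have e2 : ∀ x, exp (2 * h * x) = exp (h * x) ^ 2 := fun x => by
    rw [← exp_nat_mul]; push_cast; ring_nf
  have em : ∀ x, exp (h * x) ^ m = exp x := fun x => by
    rw [← exp_nat_mul, ← mul_assoc, hhm, one_mul]
  have h1 : ∀ x, HasDerivAt (fun x => φ (exp (h * x)))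
      (h * exp (h * x) * deriv φ (exp (h * x))) x := fun x =>
    ((hd1 _ (exp_pos (h * x))).comp x (hE x)).congr_deriv (by ring)
  have h2 : ∀ x, HasDerivAt (fun x => h * exp (h * x) * deriv φ (exp (h * x)))
      ((1 + ω * h ^ 2 * exp (2 * h * x) - resc p h (fun x => φ (exp (h * x))) x)
        * φ (exp (h * x))) x := fun x => by
    refine (((hE x).const_mul h).mul ((hd2 _ (exp_pos (h * x))).comp x (hE x))).congr_deriv ?_
    have ho := F.ode _ (exp_pos (h * x))
    have hr := exp_pos (h * x)
    have hpw : φ (exp (h * x)) ^ p = φ (exp (h * x)) ^ (p - 1) * φ (exp (h * x)) := by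
      rw [← rpow_add_one (F.pos _ hr).ne', sub_add_cancel]
    rw [hpw] at ho
    simp only [resc, Function.comp_apply]
    rw [e2]
    generalize exp (h * x) = r at *
    have hm2 : (m : ℝ) = h⁻¹ := by rw [hh, inv_inv]
    rw [hm2] at ho
    have hr' := hr.ne'
    have hh' := hh0.ne'
    field_simp at ho
    linear_combination ho
  have hbz : Tendsto (fun x => exp (h * x)) atBot (nhdsWithin 0 (Set.Ioi 0)) :=
    tendsto_exp_atBot_nhdsGT.comp (tendsto_id.const_mul_atBot hh0)
  obtain ⟨L, l1, l2⟩ := F.zero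
  have b1 : Tendsto (fun x => φ (exp (h * x)) / exp x) atBot (nhds L) :=
    (l1.comp hbz).congr fun x => by simp only [Function.comp_apply, em]
  have b2 : Tendsto (fun x => h * exp (h * x) * deriv φ (exp (h * x)) / exp x) atBot (nhds L) :=
    (l2.comp hbz).congr fun x => by
      have hr := exp_pos (h * x)
      have e : exp x = exp (h * x) ^ (m - 1) * exp (h * x) := by
        rw [← pow_succ, Nat.sub_add_cancel hm, em]
      simp only [Function.comp_apply]
      rw [e, hh]
      field_simp
  have b0 : Tendsto (fun x => φ (exp (h * x))) atBot (nhds 0) := by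
    have := b1.mul tendsto_exp_atBot
    rw [mul_zero] at this
    exact this.congr fun x => div_mul_cancel₀ _ (exp_pos x).ne'
  have htop : Tendsto (fun x => φ (exp (h * x))) atTop (nhds 0) :=
    F.top.comp (tendsto_exp_atTop.comp (tendsto_id.const_mul_atTop hh0))
  exact ⟨_, _, prof_of_log hp hω hh0 (fun x => F.pos _ (exp_pos _)) h1 h2 htop b0 b1 b2
    (by have : 0 < p + 3 := by linarith
        positivity) hε1 (by have : p + 3 ≠ 0 := by linarith
                            field_simp)⟩

/-- For large `m` the profile concentrates near a circle, with a universal shape. -/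
theorem eventually_exists_peak (hp : 1 < p) (hω : 0 < ω) {δ : ℝ} (hδ : 0 < δ) :
    ∀ᶠ m : ℕ in atTop, ∀ φ, Profile p ω m φ → ∃ R : ℝ, 0 < R ∧
      |ω * (R / m) ^ 2 - ast p| ≤ δ ∧
      ∀ x, |(R * exp (x / m) / m) ^ 2 * φ (R * exp (x / m)) ^ (p - 1) - pot p x| ≤ δ := by
  have hp3 : 0 < p + 3 := by linarith
  have ht : Tendsto (fun m : ℕ => 2 * (m : ℝ)⁻¹ / (p + 3)) atTop
      (nhdsWithin 0 (Set.Ioi 0)) := by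
    refine tendsto_nhdsWithin_iff.2 ⟨?_, ?_⟩
    · simpa using ((tendsto_inv_atTop_nhds_zero_nat (𝕜 := ℝ)).const_mul 2).div_const (p + 3)
    · filter_upwards [eventually_gt_atTop 0] with m hm
      have : 0 < (m : ℝ) := by exact_mod_cast hm
      exact div_pos (by positivity) hp3
  filter_upwards [eventually_gt_atTop 0, ht.eventually (Prof.eventually_small hp),
    ht.eventually (eventually_mul_le 4 one_pos), ht.eventually (Prof.eventually_close hp hδ)]
    with m hm ⟨e0, e1, e2⟩ e3 e4 φ F
  have hm' : 0 < (m : ℝ) := by exact_mod_cast hm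
  obtain ⟨G, Y, Q⟩ := F.exists_prof hp hω hm (by linarith)
  obtain ⟨t, ht⟩ := Q.exists_zero hp e0 e1 e2
  obtain ⟨c1, c2⟩ := e4 _ _ _ _ (Q.shift t) (by simpa using ht)
  have hexp : ∀ x, exp (2 * (m : ℝ)⁻¹ * x) = exp ((m : ℝ)⁻¹ * x) ^ 2 := fun x => by
    rw [← exp_nat_mul]; push_cast; ring_nf
  refine ⟨exp ((m : ℝ)⁻¹ * t), exp_pos _, ?_, fun x => ?_⟩
  · convert c1 using 3
    rw [lev, mul_div_cancel₀ _ hp3.ne', hexp]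
    field_simp
  · convert c2 x using 3
    have e : exp ((m : ℝ)⁻¹ * (x + t)) = exp ((m : ℝ)⁻¹ * t) * exp (x / m) := by
      rw [← exp_add]; ring_nf
    simp only [resc]
    rw [hexp, e]
    field_simp

end Profile

end Vortex

section radial

variable {f f1 f2 : ℝ → ℂ} {M R : ℝ}

theorem hasDerivAt_mul_log_div (hR : 0 < R) {r : ℝ} (hr : 0 < r) :
    HasDerivAt (fun r => M * log (r / R)) (M / r) r := by
  have hr' := hr.ne'
  have hR' := hR.ne'
  refine ((((hasDerivAt_id r).div_const R).log (div_pos hr hR).ne').const_mul M).congr_deriv ?_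
  simp only [id]
  field_simp

theorem hasDerivAt_radial (hR : 0 < R) (h1 : ∀ x, HasDerivAt f (f1 x) x) {r : ℝ} (hr : 0 < r) :
    HasDerivAt (fun r => f (M * log (r / R))) (((M / r : ℝ) : ℂ) * f1 (M * log (r / R))) r := by
  have := (h1 (M * log (r / R))).scomp r (hasDerivAt_mul_log_div hR hr)
  rwa [Complex.real_smul] at this

theorem deriv_deriv_radial (hR : 0 < R) (h1 : ∀ x, HasDerivAt f (f1 x) x)
    (h2 : ∀ x, HasDerivAt f1 (f2 x) x) {r : ℝ} (hr : 0 < r) :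
    deriv (deriv fun r => f (M * log (r / R))) r =
      ((M / r : ℝ) : ℂ) ^ 2 * f2 (M * log (r / R))
        - ((M / r ^ 2 : ℝ) : ℂ) * f1 (M * log (r / R)) := by
  have e : deriv (fun r => f (M * log (r / R))) =ᶠ[nhds r]
      fun r => ((M / r : ℝ) : ℂ) * f1 (M * log (r / R)) := by
    filter_upwards [Ioi_mem_nhds hr] with s hs using (hasDerivAt_radial hR h1 hs).deriv
  rw [e.deriv_eq]
  have d : HasDerivAt (fun r : ℝ => ((M / r : ℝ) : ℂ)) ((-(M / r ^ 2) : ℝ) : ℂ) r := by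
    refine HasDerivAt.ofReal_comp ?_
    refine ((hasDerivAt_inv hr.ne').const_mul M).congr_deriv ?_
    rw [mul_neg, div_eq_mul_inv]
  refine (d.mul (hasDerivAt_radial hR h2 hr)).deriv.trans ?_
  push_cast
  ring

theorem contDiffOn_radial (hR : 0 < R) (h1 : ∀ x, HasDerivAt f (f1 x) x)
    (h2 : ∀ x, HasDerivAt f1 (f2 x) x) (hc : Continuous f2) :
    ContDiffOn ℝ 2 (fun r => f (M * log (r / R))) (Set.Ioi 0) := by
  have hf1 : ContDiff ℝ 1 f1 := by
    rw [contDiff_one_iff_deriv, funext fun x => (h2 x).deriv]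
    exact ⟨fun x => (h2 x).differentiableAt, hc⟩
  have hf : ContDiff ℝ 2 f := by
    rw [show (2 : WithTop ℕ∞) = 1 + 1 by norm_num, contDiff_succ_iff_deriv,
      funext fun x => (h1 x).deriv]
    exact ⟨fun x => (h1 x).differentiableAt, by simp, hf1⟩
  refine hf.comp_contDiffOn (contDiffOn_const.mul ?_)
  exact (contDiffOn_id.div_const R).log fun r hr => (div_pos hr hR).ne'

/-- Weighted integrability in the radial variable follows from a bound in the logarithmic one. -/
theorem integrableOn_radial (hM : 0 < M) (hR : 0 < R) (h1 : ∀ x, HasDerivAt f (f1 x) x)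
    (hc : Continuous f1) {E : ℝ → ℝ} (hE : Integrable E)
    (hb : ∀ x, (R * exp (x / M)) ^ 2 * ‖f x‖ ^ 2 + ‖f1 x‖ ^ 2 + ‖f x‖ ^ 2 ≤ E x) :
    IntegrableOn (fun r => (‖f (M * log (r / R))‖ ^ 2
      + ‖deriv (fun r => f (M * log (r / R))) r‖ ^ 2
      + (r ^ 2)⁻¹ * ‖f (M * log (r / R))‖ ^ 2) * r) (Set.Ioi 0) := by
  have hcf : Continuous f := continuous_iff_continuousAt.2 fun x => (h1 x).continuousAt
  have hd : ∀ x, HasDerivAt (fun x => R * exp (x / M)) (R * exp (x / M) / M) x := fun x =>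
    ((((hasDerivAt_id x).div_const M).exp).const_mul R).congr_deriv (by simp only [id]; ring)
  have hpos : ∀ x, 0 < R * exp (x / M) := fun x => by positivity
  have hlog : ∀ x, M * log (R * exp (x / M) / R) = x := fun x => by
    rw [mul_div_cancel_left₀ _ hR.ne', log_exp, mul_div_cancel₀ _ hM.ne']
  have himg : Set.Ioi 0 = (fun x => R * exp (x / M)) '' Set.univ := by
    ext r
    refine ⟨fun hr => ⟨M * log (r / R), trivial, ?_⟩, ?_⟩
    · have : 0 < r / R := div_pos hr hR
      simp only
      rw [mul_div_cancel_left₀ _ hM.ne', exp_log this, mul_div_cancel₀ _ hR.ne']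
    · rintro ⟨x, -, rfl⟩
      exact hpos x
  have hinj : Set.InjOn (fun x => R * exp (x / M)) Set.univ := fun x _ y _ hxy => by
    have := congrArg (fun r => M * log (r / R)) hxy
    simpa only [hlog] using this
  rw [himg, integrableOn_image_iff_integrableOn_abs_deriv_smul MeasurableSet.univ
    (fun x _ => (hd x).hasDerivWithinAt) hinj, integrableOn_univ]
  have e : ∀ x, |R * exp (x / M) / M| • ((‖f (M * log (R * exp (x / M) / R))‖ ^ 2
      + ‖deriv (fun r => f (M * log (r / R))) (R * exp (x / M))‖ ^ 2
      + ((R * exp (x / M)) ^ 2)⁻¹ * ‖f (M * log (R * exp (x / M) / R))‖ ^ 2)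
        * (R * exp (x / M))) =
      M⁻¹ * ((R * exp (x / M)) ^ 2 * ‖f x‖ ^ 2 + M ^ 2 * ‖f1 x‖ ^ 2 + ‖f x‖ ^ 2) := fun x => by
    have h0 := hpos x
    rw [(hasDerivAt_radial hR h1 h0).deriv, hlog, norm_mul, Complex.norm_real, norm_eq_abs,
      abs_of_pos (div_pos h0 hM), abs_of_pos (div_pos hM h0), smul_eq_mul]
    generalize R * exp (x / M) = r at *
    field_simp
  simp only [e]
  refine (hE.const_mul (M⁻¹ * (1 + M ^ 2))).mono' (by fun_prop) (Eventually.of_forall fun x => ?_)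
  rw [norm_of_nonneg (by positivity), mul_assoc]
  refine mul_le_mul_of_nonneg_left (le_trans ?_
    (mul_le_mul_of_nonneg_left (hb x) (by positivity : 0 ≤ 1 + M ^ 2))) (by positivity)
  have : 0 ≤ M ^ 2 * ((R * exp (x / M)) ^ 2 * ‖f x‖ ^ 2) := by positivity
  have : 0 ≤ M ^ 2 * ‖f x‖ ^ 2 := by positivity
  have : 0 ≤ ‖f1 x‖ ^ 2 := by positivity
  linarith

end radial

theorem Coef.FinEn.integrable {K : Coef} {Z : ℝ → Phase} (hZ : Continuous Z) (h : K.FinEn Z)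
    (h' : K.refl.FinEn fun x => Z (-x)) : Integrable fun x => K.en x (Z x) := by
  have hh : ∀ {K : Coef} {Z : ℝ → Phase}, Continuous Z → K.FinEn Z →
      IntegrableOn (fun x => K.en x (Z x)) (Set.Ioi 0) := fun {K Z} hZ ⟨C, hC⟩ => by
    have hc := K.continuous_en hZ
    refine integrableOn_Ioi_of_intervalIntegral_norm_bounded C 0
      (fun T => (hc.integrableOn_Icc (a := 0) (b := T)).mono_set Set.Ioc_subset_Icc_self)
      tendsto_id ?_
    filter_upwards [eventually_ge_atTop 0] with T hT
    simpa only [norm_of_nonneg (K.en_nonneg _ _), id] using hC T hT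
  have h1 := hh hZ h
  have h2 := (hh (hZ.comp continuous_neg) h')
  have h3 : IntegrableOn (fun x => K.en x (Z x)) (Set.Iic 0) := by
    rw [integrableOn_Iic_iff_integrableOn_Iio,
      ← (Measure.measurePreserving_neg volume).integrableOn_comp_preimage
        (Homeomorph.neg ℝ).measurableEmbedding, Set.neg_preimage, Set.neg_Iio, neg_zero]
    exact h2
  rw [← integrableOn_univ, ← Set.Iic_union_Ioi (a := (0:ℝ))]
  exact h3.union h1

namespace Vortex

variable {p : ℝ}

/-- Coefficients of the linearized system in the variable `x = M log (r / R)`. -/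
noncomputable def linCoef (p a0 κ M R : ℝ) (φ : ℝ → ℝ) (ha : 0 ≤ a0) (hR : 0 < R)
    (hφ : ContinuousOn φ (Set.Ioi 0)) (hpos : ∀ r ∈ Set.Ioi (0:ℝ), 0 < φ r) : Coef :=
  have hP : Continuous fun x => (R * exp (x / M) / M) ^ 2 * φ (R * exp (x / M)) ^ (p - 1) := by
    have h : Continuous fun x => φ (R * exp (x / M)) :=
      hφ.comp_continuous (by fun_prop) fun x => mul_pos hR (exp_pos _)
    have := h.rpow_const (p := p - 1) fun x => Or.inl (hpos _ (mul_pos hR (exp_pos _))).ne'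
    fun_prop
  { q1 x := 1 + κ ^ 2 + a0 * exp (2 * x / M)
      - p * ((R * exp (x / M) / M) ^ 2 * φ (R * exp (x / M)) ^ (p - 1))
    q2 x := 1 + κ ^ 2 + a0 * exp (2 * x / M)
      - (R * exp (x / M) / M) ^ 2 * φ (R * exp (x / M)) ^ (p - 1)
    c x := 2 * κ * (exp (2 * x / M) - 1)
    w x := exp (2 * x / M)
    W x := 1 + a0 * exp (2 * x / M)
    q1_cont := by fun_prop
    q2_cont := by fun_prop
    c_cont := by fun_prop
    w_cont := by fun_prop
    W_cont := by fun_prop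
    one_le_W x := by have := exp_pos (2 * x / M); nlinarith }

theorem abs_exp_sub_one_le_or {δ X M x : ℝ} (hM : 0 < M) (h1 : 4 * X / M ≤ δ)
    (h2 : 2 * X / M ≤ 1) {s : ℝ} (hs : |s| = x) :
    |exp (2 * s / M) - 1| ≤ δ ∨ X ≤ x := by
  by_cases h : X ≤ x
  · exact Or.inr h
  left
  push Not at h
  have e : |2 * s / M| = 2 * x / M := by
    rw [abs_div, abs_mul, hs, abs_of_pos hM, abs_two]
  have h3 : 2 * x / M ≤ 2 * X / M := by gcongr
  have := abs_exp_sub_one_le (x := 2 * s / M) (by rw [e]; linarith)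
  rw [e] at this
  have e4 : 4 * X / M = 2 * (2 * X / M) := by ring
  linarith

section linCoef

variable {a0 κ M R δ X κ0 : ℝ} {φ : ℝ → ℝ} (ha : 0 ≤ a0) (hR : 0 < R)
  (hφ : ContinuousOn φ (Set.Ioi 0)) (hpos : ∀ r ∈ Set.Ioi (0:ℝ), 0 < φ r)

theorem linCoef_close (hM : 0 < M) (h1 : 4 * X / M ≤ δ) (h2 : 2 * X / M ≤ 1)
    (ha0 : |a0 - ast p| ≤ δ) (hκ : |κ - κ0| ≤ δ)
    (hP : ∀ x, |(R * exp (x / M) / M) ^ 2 * φ (R * exp (x / M)) ^ (p - 1) - pot p x| ≤ δ) :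
    Close p κ0 δ X (linCoef p a0 κ M R φ ha hR hφ hpos) ∧
      Close p κ0 δ X (linCoef p a0 κ M R φ ha hR hφ hpos).refl :=
  ⟨⟨a0, κ, ha0, hκ, fun x hx => ⟨exp_pos _,
    abs_exp_sub_one_le_or hM h1 h2 (abs_of_nonneg hx), rfl, rfl, _, hP x, rfl, rfl⟩⟩,
   ⟨a0, κ, ha0, hκ, fun x hx => ⟨exp_pos _,
    abs_exp_sub_one_le_or hM h1 h2 (by rw [abs_neg, abs_of_nonneg hx]), rfl, rfl, _,
    by simpa only [pot_even] using hP (-x), rfl, rfl⟩⟩⟩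

end linCoef

/-- The algebra relating the logarithmic and the radial form of the linearized system. -/
theorem radial_identity {r M ω κ a0 w P : ℝ} {j : ℝ} (b p : ℝ) {ν y y1 y2 z : ℂ} (hr : 0 < r)
    (ha : 0 < a0) (hj : κ * M = j) (hw : a0 * w * M ^ 2 = ω * r ^ 2)
    (hP : P * M ^ 2 = r ^ 2 * b) (s : ℝ) (hs : s ^ 2 = 1)
    (hy : y2 = ((1 + κ ^ 2 + a0 * w - (p + 1) / 2 * P : ℝ) : ℂ) * y
      - (((p - 1) / 2 * P : ℝ) : ℂ) * z - s * (2 * κ * (w - 1) + ν * w) * y) :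
    ((M / r : ℝ) : ℂ) ^ 2 * y2 - ((M / r ^ 2 : ℝ) : ℂ) * y1 + ((M / r : ℝ) : ℂ) * y1 / (r : ℂ)
      - ((ω + (M + s * j) ^ 2 / r ^ 2 : ℝ) : ℂ) * y
      + s * (Complex.I * (-(Complex.I * ((ω / a0 : ℝ) * (ν + 2 * κ))))) * y
      + (((p + 1) / 2 * b : ℝ) : ℂ) * y + (((p - 1) / 2 * b : ℝ) : ℂ) * z = 0 := by
  have hr' : (r : ℂ) ≠ 0 := by exact_mod_cast hr.ne'
  have ha' : (a0 : ℂ) ≠ 0 := by exact_mod_cast ha.ne'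
  have hw' : (a0 : ℂ) * w * M ^ 2 = ω * r ^ 2 := by exact_mod_cast hw
  have hP' : (P : ℂ) * M ^ 2 = r ^ 2 * b := by exact_mod_cast hP
  have hs' : (s : ℂ) ^ 2 = 1 := by exact_mod_cast hs
  have hω : (ω : ℂ) = a0 * w * M ^ 2 / r ^ 2 := by field_simp; linear_combination -hw'
  have hb : (b : ℂ) = P * M ^ 2 / r ^ 2 := by field_simp; linear_combination -hP'
  rw [hy, ← hj]
  push_cast
  rw [hω, hb, mul_neg, ← mul_assoc Complex.I, Complex.I_mul_I]
  field_simp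
  linear_combination (-2 * (κ : ℂ) ^ 2 * M ^ 2 * y) * hs'

theorem two_mul_en_bound {A B W a0 w R : ℝ} {u v u' v' : ℂ} (ha : 0 < a0) (hw : 0 < w)
    (hW : W = 1 + a0 * w) (hA : A = ‖u'‖ ^ 2 + ‖v'‖ ^ 2) (hB : B = ‖u‖ ^ 2 + ‖v‖ ^ 2)
    {f f1 : ℂ} (hf : ‖f‖ ≤ ‖u‖ + ‖v‖) (hf1 : ‖f1‖ ≤ ‖u'‖ + ‖v'‖) :
    R ^ 2 * w * ‖f‖ ^ 2 + ‖f1‖ ^ 2 + ‖f‖ ^ 2 ≤ 2 * (1 + R ^ 2 / a0) * (A + W * B) := by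
  have e : ∀ {a b c : ℝ}, 0 ≤ a → a ≤ b + c → a ^ 2 ≤ 2 * (b ^ 2 + c ^ 2) := fun {a b c} h0 h => by
    nlinarith [sq_nonneg (b - c)]
  have t1 : ‖f‖ ^ 2 ≤ 2 * B := hB ▸ e (norm_nonneg _) hf
  have t2 : ‖f1‖ ^ 2 ≤ 2 * A := hA ▸ e (norm_nonneg _) hf1
  have hA0 : 0 ≤ A := by rw [hA]; positivity
  have hB0 : 0 ≤ B := by rw [hB]; positivity
  have t3 := mul_le_mul_of_nonneg_left t1 (by positivity : 0 ≤ R ^ 2 * w)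
  have t4 : 2 * (1 + R ^ 2 / a0) * (A + W * B) = R ^ 2 * w * (2 * B) + 2 * A + 2 * B
      + (2 * a0 * w * B + 2 * (R ^ 2 / a0) * (A + B)) := by
    rw [hW]; field_simp; ring
  have t5 : 0 ≤ 2 * a0 * w * B + 2 * (R ^ 2 / a0) * (A + B) := by positivity
  linarith

theorem exists_unstable_mode {ω a0 κ M R : ℝ} {φ : ℝ → ℝ} (ha : 0 < a0) (hω : 0 < ω) (hR : 0 < R)
    (hM : 0 < M) (haR : a0 * M ^ 2 = ω * R ^ 2)
    {K : Coef} (hq1 : ∀ x, K.q1 x = 1 + κ ^ 2 + a0 * exp (2 * x / M)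
      - p * ((R * exp (x / M) / M) ^ 2 * φ (R * exp (x / M)) ^ (p - 1)))
    (hq2 : ∀ x, K.q2 x = 1 + κ ^ 2 + a0 * exp (2 * x / M)
      - (R * exp (x / M) / M) ^ 2 * φ (R * exp (x / M)) ^ (p - 1))
    (hc : ∀ x, K.c x = 2 * κ * (exp (2 * x / M) - 1)) (hKw : ∀ x, K.w x = exp (2 * x / M))
    (hW : ∀ x, K.W x = 1 + a0 * exp (2 * x / M)) {ν : ℂ}
    {Z : ℝ → Phase} (hν : 0 < ν.im) (hZ : K.IsSol ν Z) (hZ0 : Z 0 ≠ 0) (hf : K.FinEn Z)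
    (hf' : K.refl.FinEn fun x => Z (-x)) {j : ℝ} (hj : κ * M = j) :
    ∃ lam : ℂ, 0 < lam.re ∧
      ∃ yp ym : ℝ → ℂ,
        ContDiffOn ℝ 2 yp (Set.Ioi 0) ∧ ContDiffOn ℝ 2 ym (Set.Ioi 0) ∧
        IntegrableOn (fun r => (‖yp r‖ ^ 2 + ‖deriv yp r‖ ^ 2
          + (r ^ 2)⁻¹ * ‖yp r‖ ^ 2) * r) (Set.Ioi 0) ∧
        IntegrableOn (fun r => (‖ym r‖ ^ 2 + ‖deriv ym r‖ ^ 2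
          + (r ^ 2)⁻¹ * ‖ym r‖ ^ 2) * r) (Set.Ioi 0) ∧
        (∃ r ∈ Set.Ioi (0:ℝ), yp r ≠ 0 ∨ ym r ≠ 0) ∧
        (∀ r ∈ Set.Ioi (0:ℝ),
          deriv (deriv yp) r + deriv yp r / (r : ℂ)
            - ((ω + (M + j) ^ 2 / r ^ 2 : ℝ) : ℂ) * yp r
            + Complex.I * lam * yp r
            + (((p + 1) / 2 * φ r ^ (p - 1) : ℝ) : ℂ) * yp r
            + (((p - 1) / 2 * φ r ^ (p - 1) : ℝ) : ℂ) * ym r = 0) ∧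
        (∀ r ∈ Set.Ioi (0:ℝ),
          deriv (deriv ym) r + deriv ym r / (r : ℂ)
            - ((ω + (M - j) ^ 2 / r ^ 2 : ℝ) : ℂ) * ym r
            - Complex.I * lam * ym r
            + (((p + 1) / 2 * φ r ^ (p - 1) : ℝ) : ℂ) * ym r
            + (((p - 1) / 2 * φ r ^ (p - 1) : ℝ) : ℂ) * yp r = 0) := by
  have hZc := hZ.continuous
  have c1 := fun x => (hZ.comps x).1
  have c2 := fun x => (hZ.comps x).2.1
  have c3 := fun x => (hZ.comps x).2.2.1
  have c4 := fun x => (hZ.comps x).2.2.2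
  have p1 := fun x => (c1 x).fun_add (c3 x)
  have p2 := fun x => (c2 x).fun_add (c4 x)
  have m1 := fun x => (c1 x).fun_sub (c3 x)
  have m2 := fun x => (c2 x).fun_sub (c4 x)
  have k1 := K.q1_cont
  have k2 := K.q2_cont
  have k3 := K.c_cont
  have k4 := K.w_cont
  have hE := (hf.integrable hZc hf').const_mul (2 * (1 + R ^ 2 / a0))
  have hexp : ∀ x, (R * exp (x / M)) ^ 2 = R ^ 2 * exp (2 * x / M) := fun x => by
    rw [mul_pow, ← exp_nat_mul]; push_cast; ring_nf
  have hlog : ∀ {r : ℝ}, 0 < r → R * exp (M * log (r / R) / M) = r := fun {r} hr => by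
    rw [mul_div_cancel_left₀ _ hM.ne', exp_log (div_pos hr hR), mul_div_cancel₀ _ hR.ne']
  have hen : ∀ x (f f1 : ℂ), ‖f‖ ≤ ‖(Z x).1‖ + ‖(Z x).2.2.1‖ →
      ‖f1‖ ≤ ‖(Z x).2.1‖ + ‖(Z x).2.2.2‖ →
      (R * exp (x / M)) ^ 2 * ‖f‖ ^ 2 + ‖f1‖ ^ 2 + ‖f‖ ^ 2
        ≤ 2 * (1 + R ^ 2 / a0) * K.en x (Z x) := fun x f f1 h1 h2 => by
    rw [hexp]
    exact two_mul_en_bound ha (exp_pos _) (hW x) (by simp only [Complex.norm_sq_eq_re_im])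
      (by simp only [Complex.norm_sq_eq_re_im]) h1 h2
  have hw : ∀ {r : ℝ}, 0 < r → a0 * exp (2 * (M * log (r / R)) / M) * M ^ 2 = ω * r ^ 2 :=
    fun {r} hr => by
      have := hexp (M * log (r / R))
      rw [hlog hr] at this
      rw [this]
      linear_combination exp (2 * (M * log (r / R)) / M) * haR
  have hPP : ∀ {r : ℝ}, 0 < r → (r / M) ^ 2 * φ r ^ (p - 1) * M ^ 2 = r ^ 2 * φ r ^ (p - 1) :=
    fun {r} hr => by field_simp
  have sp := contDiffOn_radial (M := M) hR p1 p2 (by fun_prop)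
  have sm := contDiffOn_radial (M := M) hR m1 m2 (by fun_prop)
  have ip := integrableOn_radial hM hR p1 (by fun_prop) hE fun x =>
    hen x _ _ (norm_add_le _ _) (norm_add_le _ _)
  have im := integrableOn_radial hM hR m1 (by fun_prop) hE fun x =>
    hen x _ _ (norm_sub_le _ _) (norm_sub_le _ _)
  refine ⟨-(Complex.I * ((ω / a0 : ℝ) * (ν + 2 * κ))), ?_,
    fun r => (Z (M * log (r / R))).1 + (Z (M * log (r / R))).2.2.1,
    fun r => (Z (M * log (r / R))).1 - (Z (M * log (r / R))).2.2.1,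
    sp, sm, ip, im, ?_, fun r hr => ?_, fun r hr => ?_⟩
  · have : 0 < ω / a0 * ν.im := by positivity
    simpa using this
  · by_contra! hc
    have hz : ∀ x, (Z x).1 = 0 ∧ (Z x).2.2.1 = 0 := fun x => by
      obtain ⟨h1, h2⟩ := hc (R * exp (x / M)) (mul_pos hR (exp_pos _))
      rw [mul_div_cancel_left₀ _ hR.ne', log_exp, mul_div_cancel₀ _ hM.ne'] at h1 h2
      constructor
      · linear_combination (h1 + h2) / 2
      · linear_combination (h1 - h2) / 2
    have d1 : (Z 0).2.1 = 0 := by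
      have := c1 0
      simp only [hz] at this
      exact this.unique (hasDerivAt_const _ _)
    have d2 : (Z 0).2.2.2 = 0 := by
      have := c3 0
      simp only [hz] at this
      exact this.unique (hasDerivAt_const _ _)
    exact hZ0 (Prod.ext (hz 0).1 (Prod.ext d1 (Prod.ext (hz 0).2 d2)))
  · have hr' : 0 < r := hr
    rw [deriv_deriv_radial hR p1 p2 hr', (hasDerivAt_radial hR p1 hr').deriv]
    have := radial_identity (b := φ r ^ (p - 1)) (p := p) (ν := ν)
      (y1 := (Z (M * log (r / R))).2.1 + (Z (M * log (r / R))).2.2.2) hr' ha hj (hw hr')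
      (hPP hr') 1 (by norm_num) (y := (Z (M * log (r / R))).1 + (Z (M * log (r / R))).2.2.1)
      (z := (Z (M * log (r / R))).1 - (Z (M * log (r / R))).2.2.1) rfl
    simp only [one_mul, Complex.ofReal_one] at this
    convert this using 6
    rw [hq1, hq2, hc, hKw, hlog hr']
    push_cast
    ring
  · have hr' : 0 < r := hr
    rw [deriv_deriv_radial hR m1 m2 hr', (hasDerivAt_radial hR m1 hr').deriv]
    have := radial_identity (b := φ r ^ (p - 1)) (p := p) (ν := ν)
      (y1 := (Z (M * log (r / R))).2.1 - (Z (M * log (r / R))).2.2.2) hr' ha hj (hw hr')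
      (hPP hr') (-1) (by norm_num) (y := (Z (M * log (r / R))).1 - (Z (M * log (r / R))).2.2.1)
      (z := (Z (M * log (r / R))).1 + (Z (M * log (r / R))).2.2.1) rfl
    rw [neg_one_mul, ← sub_eq_add_neg, Complex.ofReal_neg, Complex.ofReal_one,
      neg_one_mul (Complex.I * _), neg_mul (Complex.I * _), ← sub_eq_add_neg] at this
    convert this using 6
    rw [hq1, hq2, hc, hKw, hlog hr']
    push_cast
    ring

end Vortex

theorem stmt18 (p ω : ℝ) (hp : 1 < p) (hω : 0 < ω) :
    ∃ mstar : ℕ, ∀ m : ℕ, mstar ≤ m →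
      ∀ φ : ℝ → ℝ, ContDiffOn ℝ 2 φ (Set.Ioi 0) →
      (∀ r ∈ Set.Ioi (0:ℝ), 0 < φ r) →
      (∀ r ∈ Set.Ioi (0:ℝ),
        deriv (deriv φ) r + deriv φ r / r - (ω + (m : ℝ) ^ 2 / r ^ 2) * φ r
          + φ r ^ p = 0) →
      (∃ L : ℝ,
        Tendsto (fun r => φ r / r ^ m) (nhdsWithin 0 (Set.Ioi 0)) (nhds L) ∧
        Tendsto (fun r => deriv φ r / ((m : ℝ) * r ^ (m - 1)))
          (nhdsWithin 0 (Set.Ioi 0)) (nhds L)) →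
      Tendsto φ atTop (nhds 0) →
      ∃ j : ℤ, ∃ lam : ℂ, 0 < lam.re ∧
      ∃ yp ym : ℝ → ℂ,
        ContDiffOn ℝ 2 yp (Set.Ioi 0) ∧ ContDiffOn ℝ 2 ym (Set.Ioi 0) ∧
        IntegrableOn (fun r => (‖yp r‖ ^ 2 + ‖deriv yp r‖ ^ 2
          + (r ^ 2)⁻¹ * ‖yp r‖ ^ 2) * r) (Set.Ioi 0) ∧
        IntegrableOn (fun r => (‖ym r‖ ^ 2 + ‖deriv ym r‖ ^ 2
          + (r ^ 2)⁻¹ * ‖ym r‖ ^ 2) * r) (Set.Ioi 0) ∧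
        (∃ r ∈ Set.Ioi (0:ℝ), yp r ≠ 0 ∨ ym r ≠ 0) ∧
        (∀ r ∈ Set.Ioi (0:ℝ),
          deriv (deriv yp) r + deriv yp r / (r : ℂ)
            - ((ω + ((m : ℝ) + (j : ℝ)) ^ 2 / r ^ 2 : ℝ) : ℂ) * yp r
            + Complex.I * lam * yp r
            + (((p + 1) / 2 * φ r ^ (p - 1) : ℝ) : ℂ) * yp r
            + (((p - 1) / 2 * φ r ^ (p - 1) : ℝ) : ℂ) * ym r = 0) ∧
        (∀ r ∈ Set.Ioi (0:ℝ),
          deriv (deriv ym) r + deriv ym r / (r : ℂ)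
            - ((ω + ((m : ℝ) - (j : ℝ)) ^ 2 / r ^ 2 : ℝ) : ℂ) * ym r
            - Complex.I * lam * ym r
            + (((p + 1) / 2 * φ r ^ (p - 1) : ℝ) : ℂ) * ym r
            + (((p - 1) / 2 * φ r ^ (p - 1) : ℝ) : ℂ) * yp r = 0) := by
  obtain ⟨n0, hn0⟩ := exists_nat_gt (max 2 (2 / Vortex.ast p))
  have hn2 : 2 < (n0 : ℝ) := (le_max_left _ _).trans_lt hn0
  have hn3 : 2 / Vortex.ast p < n0 := (le_max_right _ _).trans_lt hn0
  have hn1 : 0 < n0 := by exact_mod_cast two_pos.trans hn2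
  have hn : 0 < (n0 : ℝ) := by exact_mod_cast hn1
  have has := Vortex.ast_pos hp
  obtain ⟨δ, X, hδ, hdX⟩ := Vortex.exists_unstable_sol (κ0 := (n0 : ℝ)⁻¹) hp (by positivity)
    (by rw [one_div]; exact inv_anti₀ two_pos hn2.le)
    (by rw [← div_eq_mul_inv, div_lt_iff₀ hn]; rwa [div_lt_iff₀' has] at hn3)
  have htend : ∀ c : ℝ, Tendsto (fun m : ℕ => c / (m : ℝ)) atTop (nhds 0) := fun c =>
    tendsto_const_div_atTop_nhds_zero_nat c
  have hev := (Vortex.Profile.eventually_exists_peak hp hω hδ).and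
    (((htend 1).eventually_le_const hδ).and (((htend (4 * X)).eventually_le_const hδ).and
      (((htend (2 * X)).eventually_le_const one_pos).and (eventually_gt_atTop 0))))
  obtain ⟨mstar, hm⟩ := eventually_atTop.1 hev
  refine ⟨mstar, fun m hle φ h1 h2 h3 h4 h5 => ?_⟩
  obtain ⟨peak, e1, e2, e3, hm0⟩ := hm m hle
  have hM : 0 < (m : ℝ) := by exact_mod_cast hm0
  obtain ⟨R, hR, r1, r2⟩ := peak φ ⟨h1, h2, h3, h4, h5⟩
  have ha : 0 < ω * (R / m) ^ 2 := by positivity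
  have hκ : |((m / n0 : ℕ) : ℝ) / m - (n0 : ℝ)⁻¹| ≤ δ := by
    have t1 : ((m / n0 : ℕ) : ℝ) ≤ m / n0 := Nat.cast_div_le
    have t2 : (m : ℝ) / n0 < (m / n0 : ℕ) + 1 := by
      rw [div_lt_iff₀ hn]
      exact_mod_cast Nat.lt_mul_of_div_lt (Nat.lt_succ_self _) hn1
    have e : ((m / n0 : ℕ) : ℝ) / m - (n0 : ℝ)⁻¹ = (((m / n0 : ℕ) : ℝ) - m / n0) / m := by
      field_simp
    rw [e, abs_div, abs_of_pos hM]
    refine le_trans ?_ e1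
    gcongr
    rw [abs_le]
    constructor <;> linarith
  obtain ⟨k1, k2⟩ := Vortex.linCoef_close (κ0 := (n0 : ℝ)⁻¹) ha.le hR h1.continuousOn h2 hM e2 e3
    r1 hκ r2
  obtain ⟨ν, Z, hν, hZ, hZ0, hf, hf'⟩ := hdX _ k1 k2
  exact ⟨(m / n0 : ℕ), by
    simpa only [Int.cast_natCast] using Vortex.exists_unstable_mode ha hω hR hM
      (by field_simp) (fun _ => rfl) (fun _ => rfl)
      (fun _ => rfl) (fun _ => rfl) (fun _ => rfl) hν hZ hZ0 hf hf' (div_mul_cancel₀ _ hM.ne')⟩
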